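/- arXiv:math/0207207 — 2 statements merged into one kernel-verified Lean document; each statement's English description precedes it below -/
import Mathlib

section
/- Let q ∈ ℂ* and let ξ be a ℂ-point of M_q. Then the kernel of the co-orbit map α^ξ contains the left ideal Σ_{f∈O(M_q)^{α-GL_q}} O(M_q)·(f − f(ξ)), which in turn contains the left ideal Σ_{i=1}^N O(M_q)·(σ_i − σ_i(ξ)). Moreover, if q is not a root of unity (or q = 1), then these two left ideals are equal. -/
open TensorProduct

noncomputable section

/-- Number of inversions (the length) of a permutation of `Fin t`. -/
def invCount {t : ℕ} (σ : Equiv.Perm (Fin t)) : ℕ :=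
  (Finset.univ.filter fun p : Fin t × Fin t => p.1 < p.2 ∧ σ p.2 < σ p.1).card

/-- The principal quantum minor `[I|I]` of the matrix of generators `x`. -/
def qMinor {A : Type} [CommRing A] {M : Type} [Ring M] [Algebra A M] {N : ℕ}
    (q : A) (x : Fin N → Fin N → M) (I : Finset (Fin N)) : M :=
  ∑ σ : Equiv.Perm (Fin I.card),
    ((-q) ^ invCount σ) •
      ((List.finRange I.card).map fun k =>
        x ((I.orderIsoOfFin rfl) k).1 ((I.orderIsoOfFin rfl) (σ k)).1).prod

/-- The quantum determinant. -/
def qdet {A : Type} [CommRing A] {M : Type} [Ring M] [Algebra A M] {N : ℕ}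
    (q : A) (x : Fin N → Fin N → M) : M :=
  qMinor q x Finset.univ

/-- `w(I)`: the sum of the elements of `I` (with `{1, …, N}` indexing). -/
def wtSet {N : ℕ} (I : Finset (Fin N)) : ℕ := ∑ j ∈ I, (j.1 + 1)

/-- The weighted sum `τ_i` of principal quantum minors of size `i`. -/
def tauCoinv {A : Type} [CommRing A] {M : Type} [Ring M] [Algebra A M] {N : ℕ}
    (q qinv : A) (x : Fin N → Fin N → M) (i : ℕ) : M :=
  ∑ I ∈ Finset.univ.filter (fun I : Finset (Fin N) => I.card = i),
    qinv ^ (2 * wtSet I) • qMinor q x I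

/-- The sum `σ_i` of all principal quantum minors of size `i`. -/
def sigmaCoinv {A : Type} [CommRing A] {M : Type} [Ring M] [Algebra A M] {N : ℕ}
    (q : A) (x : Fin N → Fin N → M) (i : ℕ) : M :=
  ∑ I ∈ Finset.univ.filter (fun I : Finset (Fin N) => I.card = i), qMinor q x I

/-- The right adjoint coaction `β(h) = Σ h₂ ⊗ S(h₁)h₃`. -/
def adjBeta {A : Type} [CommRing A] {M G : Type} [Ring M] [Algebra A M] [Ring G] [Algebra A G]
    (ΔM : M →ₐ[A] M ⊗[A] M) (ι : M →ₐ[A] G) (St : G →ₗ[A] G) : M →ₗ[A] M ⊗[A] G :=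
  TensorProduct.map LinearMap.id (LinearMap.mul' A G) ∘ₗ
  (TensorProduct.assoc A M G G).toLinearMap ∘ₗ
  TensorProduct.map
    ((TensorProduct.comm A G M).toLinearMap ∘ₗ
      TensorProduct.map (St ∘ₗ ι.toLinearMap) LinearMap.id)
    ι.toLinearMap ∘ₗ
  TensorProduct.map ΔM.toLinearMap LinearMap.id ∘ₗ ΔM.toLinearMap

/-- The right coaction `α(h) = Σ h₂ ⊗ h₃S(h₁)`. -/
def adjAlpha {A : Type} [CommRing A] {M G : Type} [Ring M] [Algebra A M] [Ring G] [Algebra A G]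
    (ΔM : M →ₐ[A] M ⊗[A] M) (ι : M →ₐ[A] G) (St : G →ₗ[A] G) : M →ₗ[A] M ⊗[A] G :=
  TensorProduct.map LinearMap.id (LinearMap.mul' A G) ∘ₗ
  TensorProduct.map LinearMap.id (TensorProduct.comm A G G).toLinearMap ∘ₗ
  (TensorProduct.assoc A M G G).toLinearMap ∘ₗ
  TensorProduct.map
    ((TensorProduct.comm A G M).toLinearMap ∘ₗ
      TensorProduct.map (St ∘ₗ ι.toLinearMap) LinearMap.id)
    ι.toLinearMap ∘ₗ
  TensorProduct.map ΔM.toLinearMap LinearMap.id ∘ₗ ΔM.toLinearMap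

/-- The co-orbit map associated to a point `e = ev_ξ` and a coaction `b`. -/
def coorbit {A : Type} [CommRing A] {M G : Type} [Ring M] [Algebra A M] [Ring G] [Algebra A G]
    (e : M →ₐ[A] A) (b : M →ₗ[A] M ⊗[A] G) : M →ₗ[A] G :=
  (TensorProduct.lid A G).toLinearMap ∘ₗ TensorProduct.map e.toLinearMap LinearMap.id ∘ₗ b

/-- The left coaction `λ_D = (π_D ⊗ id) ∘ Δ` of a quotient Hopf algebra. -/
def leftCoact {A : Type} [CommRing A] {G D : Type} [Ring G] [Algebra A G]
    [CommRing D] [Algebra A D]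
    (πD : G →ₐ[A] D) (ΔG : G →ₐ[A] G ⊗[A] G) : G →ₗ[A] D ⊗[A] G :=
  TensorProduct.map πD.toLinearMap LinearMap.id ∘ₗ ΔG.toLinearMap

/-- Coinvariants of the left coaction `λ_D`. -/
def dCoinv {A : Type} [CommRing A] {G D : Type} [Ring G] [Algebra A G]
    [CommRing D] [Algebra A D]
    (πD : G →ₐ[A] D) (ΔG : G →ₐ[A] G ⊗[A] G) : Set G :=
  {f : G | leftCoact πD ΔG f = (1 : D) ⊗ₜ[A] f}

/-- The right coaction `ρ_D = (id ⊗ π_D) ∘ Δ`. -/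
def rightCoact {A : Type} [CommRing A] {G D : Type} [Ring G] [Algebra A G]
    [CommRing D] [Algebra A D]
    (πD : G →ₐ[A] D) (ΔG : G →ₐ[A] G ⊗[A] G) : G →ₗ[A] G ⊗[A] D :=
  TensorProduct.map LinearMap.id πD.toLinearMap ∘ₗ ΔG.toLinearMap

/-- The weight space of weight `ta : D` for the grading induced by `ρ_D`. -/
def weightSpace' {A : Type} [CommRing A] {G D : Type} [Ring G] [Algebra A G]
    [CommRing D] [Algebra A D]
    (πD : G →ₐ[A] D) (ΔG : G →ₐ[A] G ⊗[A] G) (ta : D) : Submodule A G :=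
  LinearMap.ker (rightCoact πD ΔG - (TensorProduct.mk A G D).flip ta)

/-- The subcomodule generated by a subset `s` of the comodule `(M, b)`. -/
def comodGen {A : Type} [CommRing A] {M G : Type} [Ring M] [Algebra A M] [Ring G] [Algebra A G]
    (b : M →ₗ[A] M ⊗[A] G) (s : Set M) : Submodule A M :=
  sInf {W : Submodule A M | s ⊆ W ∧
    ∀ w ∈ W, b w ∈ LinearMap.range (TensorProduct.map W.subtype (LinearMap.id : G →ₗ[A] G))}

/-- The defining relations of quantum matrices, for a matrix `y` over an algebra `B`. -/
structure IsQuantumMatrix {N : ℕ} (q : ℂ) {B : Type} [Ring B] [Algebra ℂ B]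
    (y : Fin N → Fin N → B) : Prop where
  row : ∀ i j l : Fin N, j < l → y i j * y i l = q • (y i l * y i j)
  col : ∀ i k j : Fin N, i < k → y i j * y k j = q • (y k j * y i j)
  anti : ∀ i k j l : Fin N, i < k → j < l → y i l * y k j = y k j * y i l
  diag : ∀ i k j l : Fin N, i < k → j < l →
    y i j * y k l - y k l * y i j = (q - q⁻¹) • (y i l * y k j)

/-- `M` is the universal algebra generated by a quantum matrix `x`, and `Δ` is its matrix
comultiplication. -/
structure IsQuantumMatrixAlgebra {N : ℕ} (q : ℂ) {M : Type} [Ring M] [Algebra ℂ M]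
    (x : Fin N → Fin N → M) (Δ : M →ₐ[ℂ] M ⊗[ℂ] M) : Prop extends IsQuantumMatrix q x where
  gen : Algebra.adjoin ℂ (Set.range fun p : Fin N × Fin N => x p.1 p.2) = ⊤
  lift : ∀ (B : Type) [Ring B] [Algebra ℂ B] (y : Fin N → Fin N → B), IsQuantumMatrix q y →
    ∃ φ : M →ₐ[ℂ] B, ∀ i j, φ (x i j) = y i j
  comul : ∀ i j, Δ (x i j) = ∑ k, x i k ⊗ₜ[ℂ] x k j

theorem isQuantumMatrix_diagonal {N : ℕ} (q : ℂ) {B : Type} [CommRing B] [Algebra ℂ B]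
    (t : Fin N → B) : IsQuantumMatrix q (fun i j => if i = j then t i else 0) where
  row i j l h := by
    by_cases h1 : i = j
    · subst h1; simp [h.ne]
    · simp [h1]
  col i k j h := by
    by_cases h1 : i = j
    · subst h1; simp [h.ne']
    · simp [h1]
  anti i k j l h h' := mul_comm _ _
  diag i k j l h h' := by
    rw [mul_comm, sub_self]
    by_cases h1 : i = l
    · subst h1
      have : k ≠ j := (h'.trans h).ne'
      simp [this]
    · simp [h1]

/-- The functional-induced operator `f ↦ f₁ u(f₂)`. -/
def colAct {M : Type} [Ring M] [Algebra ℂ M] (Δ : M →ₐ[ℂ] M ⊗[ℂ] M) (u : M →ₗ[ℂ] ℂ) :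
    M →ₗ[ℂ] M :=
  (TensorProduct.rid ℂ M).toLinearMap ∘ₗ TensorProduct.map LinearMap.id u ∘ₗ Δ.toLinearMap

/-- The functional-induced operator `f ↦ u(f₁) f₂`. -/
def rowAct {M : Type} [Ring M] [Algebra ℂ M] (Δ : M →ₐ[ℂ] M ⊗[ℂ] M) (u : M →ₗ[ℂ] ℂ) :
    M →ₗ[ℂ] M :=
  (TensorProduct.lid ℂ M).toLinearMap ∘ₗ TensorProduct.map u LinearMap.id ∘ₗ Δ.toLinearMap

section Leibniz

variable {M : Type} [Ring M] [Algebra ℂ M] (Δ : M →ₐ[ℂ] M ⊗[ℂ] M)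

theorem colAct_mul {u v₁ w₁ v₂ w₂ : M →ₗ[ℂ] ℂ}
    (h : ∀ a b, u (a * b) = v₁ a * w₁ b + v₂ a * w₂ b) (f g : M) :
    colAct Δ u (f * g) = colAct Δ v₁ f * colAct Δ w₁ g + colAct Δ v₂ f * colAct Δ w₂ g := by
  simp only [colAct, LinearMap.comp_apply, AlgHom.toLinearMap_apply, map_mul,
    LinearEquiv.coe_coe]
  generalize Δ f = X
  generalize Δ g = Y
  induction X with
  | zero => simp
  | add X X' hX hX' => simp only [add_mul, map_add, hX, hX']; abel
  | tmul a b =>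
    induction Y with
    | zero => simp
    | add Y Y' hY hY' => simp only [mul_add, map_add, hY, hY']; abel
    | tmul c d =>
      simp [h, add_smul, smul_smul, mul_comm]

theorem rowAct_mul {u v₁ w₁ v₂ w₂ : M →ₗ[ℂ] ℂ}
    (h : ∀ a b, u (a * b) = v₁ a * w₁ b + v₂ a * w₂ b) (f g : M) :
    rowAct Δ u (f * g) = rowAct Δ v₁ f * rowAct Δ w₁ g + rowAct Δ v₂ f * rowAct Δ w₂ g := by
  simp only [rowAct, LinearMap.comp_apply, AlgHom.toLinearMap_apply, map_mul,
    LinearEquiv.coe_coe]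
  generalize Δ f = X
  generalize Δ g = Y
  induction X with
  | zero => simp
  | add X X' hX hX' => simp only [add_mul, map_add, hX, hX']; abel
  | tmul a b =>
    induction Y with
    | zero => simp
    | add Y Y' hY hY' => simp only [mul_add, map_add, hY, hY']; abel
    | tmul c d =>
      simp [h, add_smul, smul_smul, mul_comm]

theorem colAct_algHom_mul (χ : M →ₐ[ℂ] ℂ) (f g : M) :
    colAct Δ χ.toLinearMap (f * g)
      = colAct Δ χ.toLinearMap f * colAct Δ χ.toLinearMap g := by
  simpa [colAct] using colAct_mul Δ (u := χ.toLinearMap) (v₁ := χ.toLinearMap)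
    (w₁ := χ.toLinearMap) (v₂ := 0) (w₂ := 0) (by simp) f g

theorem rowAct_algHom_mul (χ : M →ₐ[ℂ] ℂ) (f g : M) :
    rowAct Δ χ.toLinearMap (f * g)
      = rowAct Δ χ.toLinearMap f * rowAct Δ χ.toLinearMap g := by
  simpa [rowAct] using rowAct_mul Δ (u := χ.toLinearMap) (v₁ := χ.toLinearMap)
    (w₁ := χ.toLinearMap) (v₂ := 0) (w₂ := 0) (by simp) f g

theorem colAct_algHom_one (χ : M →ₐ[ℂ] ℂ) : colAct Δ χ.toLinearMap 1 = 1 := by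
  simp [colAct, Algebra.TensorProduct.one_def]

theorem rowAct_algHom_one (χ : M →ₐ[ℂ] ℂ) : rowAct Δ χ.toLinearMap 1 = 1 := by
  simp [rowAct, Algebra.TensorProduct.one_def]

theorem colAct_one_eq_zero {u : M →ₗ[ℂ] ℂ} (hu : u 1 = 0) : colAct Δ u 1 = 0 := by
  simp [colAct, Algebra.TensorProduct.one_def, hu]

theorem rowAct_one_eq_zero {u : M →ₗ[ℂ] ℂ} (hu : u 1 = 0) : rowAct Δ u 1 = 0 := by
  simp [rowAct, Algebra.TensorProduct.one_def, hu]

end Leibniz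

namespace IsQuantumMatrixAlgebra

variable {N : ℕ} {q : ℂ} {M : Type} [Ring M] [Algebra ℂ M] {x : Fin N → Fin N → M}
  {Δ : M →ₐ[ℂ] M ⊗[ℂ] M} (hM : IsQuantumMatrixAlgebra q x Δ)
include hM

theorem induction {p : M → Prop} (one : p 1) (add : ∀ a b, p a → p b → p (a + b))
    (smul : ∀ (c : ℂ) a, p a → p (c • a)) (gen_mul : ∀ i j a, p a → p (x i j * a)) (m : M) :
    p m := by
  have hm : m ∈ Submodule.span ℂ
      (Submonoid.closure (Set.range fun p : Fin N × Fin N => x p.1 p.2) : Set M) := by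
    rw [← Algebra.adjoin_eq_span, hM.gen]; trivial
  induction hm using Submodule.span_induction with
  | zero => simpa using smul 0 1 one
  | add a b _ _ ha hb => exact add a b ha hb
  | smul c a _ ha => exact smul c a ha
  | mem a ha =>
    induction ha using Submonoid.closure_induction_left with
    | one => exact one
    | mul_left a ha b _ hb =>
      obtain ⟨⟨i, j⟩, rfl⟩ := ha
      exact gen_mul i j b hb

theorem algHom_ext {B : Type} [Ring B] [Algebra ℂ B] {φ ψ : M →ₐ[ℂ] B}
    (h : ∀ i j, φ (x i j) = ψ (x i j)) (m : M) : φ m = ψ m := by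
  induction m using hM.induction with
  | one => simp
  | add a b ha hb => simp [ha, hb]
  | smul c a ha => simp [ha]
  | gen_mul i j a ha => simp [h, ha]

theorem colAct_gen (u : M →ₗ[ℂ] ℂ) (i j : Fin N) :
    colAct Δ u (x i j) = ∑ k, u (x k j) • x i k := by
  simp [colAct, hM.comul]

theorem rowAct_gen (u : M →ₗ[ℂ] ℂ) (i j : Fin N) :
    rowAct Δ u (x i j) = ∑ k, u (x i k) • x k j := by
  simp [rowAct, hM.comul]

theorem coassoc (m : M) : TensorProduct.assoc ℂ M M M
    (TensorProduct.map Δ.toLinearMap LinearMap.id (Δ m)) =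
      TensorProduct.map LinearMap.id Δ.toLinearMap (Δ m) := by
  have := hM.algHom_ext
    (φ := (Algebra.TensorProduct.assoc ℂ ℂ ℂ M M M).toAlgHom.comp
      ((Algebra.TensorProduct.map Δ (.id ℂ M)).comp Δ))
    (ψ := (Algebra.TensorProduct.map (.id ℂ M) Δ).comp Δ) (fun i j => by
      simp [hM.comul, TensorProduct.sum_tmul, TensorProduct.tmul_sum]
      exact Finset.sum_comm) m
  exact this

theorem rowAct_colAct (u v : M →ₗ[ℂ] ℂ) (m : M) :
    rowAct Δ u (colAct Δ v m) = colAct Δ v (rowAct Δ u m) := by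
  let T : M ⊗[ℂ] (M ⊗[ℂ] M) →ₗ[ℂ] M := (TensorProduct.lid ℂ M).toLinearMap ∘ₗ
    TensorProduct.map u ((TensorProduct.rid ℂ M).toLinearMap ∘ₗ TensorProduct.map .id v)
  have h1 : ∀ X : M ⊗[ℂ] M, rowAct Δ u (TensorProduct.rid ℂ M (TensorProduct.map .id v X))
      = T (TensorProduct.assoc ℂ M M M (TensorProduct.map Δ.toLinearMap .id X)) := by
    intro X
    induction X with
    | zero => simp
    | add X Y hX hY => simp only [map_add, hX, hY]
    | tmul a b =>
      simp only [TensorProduct.map_tmul, TensorProduct.rid_tmul, map_smul, rowAct,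
        LinearMap.comp_apply, LinearMap.id_apply, AlgHom.toLinearMap_apply, LinearEquiv.coe_coe]
      generalize Δ a = Y
      induction Y with
      | zero => simp
      | add X Y hX hY => simp only [map_add, TensorProduct.add_tmul, smul_add, hX, hY]
      | tmul c d => simp [T, smul_smul, mul_comm]
  have h2 : ∀ X : M ⊗[ℂ] M, colAct Δ v (TensorProduct.lid ℂ M (TensorProduct.map u .id X))
      = T (TensorProduct.map .id Δ.toLinearMap X) := by
    intro X
    induction X with
    | zero => simp
    | add X Y hX hY => simp only [map_add, hX, hY]
    | tmul a b => simp [T, colAct]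
  have := h1 (Δ m)
  rw [hM.coassoc, ← h2] at this
  exact this

/-- The character of `M` given by a diagonal matrix over a commutative algebra. -/
theorem exists_diagonal_hom {B : Type} [CommRing B] [Algebra ℂ B] (t : Fin N → B) :
    ∃ χ : M →ₐ[ℂ] B, ∀ i j, χ (x i j) = if i = j then t i else 0 :=
  hM.lift B _ (isQuantumMatrix_diagonal q t)

/-- Evaluation at a diagonal matrix over a commutative algebra. -/
def diagHom {B : Type} [CommRing B] [Algebra ℂ B] (t : Fin N → B) : M →ₐ[ℂ] B :=
  (hM.exists_diagonal_hom t).choose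

theorem diagHom_gen {B : Type} [CommRing B] [Algebra ℂ B] (t : Fin N → B) (i j : Fin N) :
    hM.diagHom t (x i j) = if i = j then t i else 0 :=
  (hM.exists_diagonal_hom t).choose_spec i j

theorem colAct_diagHom_gen (t : Fin N → ℂ) (i j : Fin N) :
    colAct Δ (hM.diagHom t).toLinearMap (x i j) = t j • x i j := by
  simp [hM.colAct_gen, hM.diagHom_gen]

theorem rowAct_diagHom_gen (t : Fin N → ℂ) (i j : Fin N) :
    rowAct Δ (hM.diagHom t).toLinearMap (x i j) = t i • x i j := by
  simp [hM.rowAct_gen, hM.diagHom_gen]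

theorem colAct_diagHom_one (m : M) : colAct Δ (hM.diagHom 1).toLinearMap m = m := by
  induction m using hM.induction with
  | one => exact colAct_algHom_one Δ _
  | add a b ha hb => rw [map_add, ha, hb]
  | smul c a ha => rw [map_smul, ha]
  | gen_mul i j a ha => rw [colAct_algHom_mul, ha, hM.colAct_diagHom_gen]; simp

theorem rowAct_diagHom_one (m : M) : rowAct Δ (hM.diagHom 1).toLinearMap m = m := by
  induction m using hM.induction with
  | one => exact rowAct_algHom_one Δ _
  | add a b ha hb => rw [map_add, ha, hb]
  | smul c a ha => rw [map_smul, ha]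
  | gen_mul i j a ha => rw [rowAct_algHom_mul, ha, hM.rowAct_diagHom_gen]; simp

end IsQuantumMatrixAlgebra

/-- An upper triangular `2 × 2` matrix of characters and a skew derivation. -/
def skewMatrix {N : ℕ} (t s : Fin N → ℂ) (a b i j : Fin N) : Matrix (Fin 2) (Fin 2) ℂ :=
  !![if i = j then t i else 0, if i = a ∧ j = b then 1 else 0; 0, if i = j then s i else 0]

theorem isQuantumMatrix_skewMatrix {N : ℕ} {q : ℂ} {c d : Fin N} (hcd : c.val + 1 = d.val)
    {t s : Fin N → ℂ} (hc : t c = q * s c) (hd : s d = q * t d)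
    (hts : ∀ i, i ≠ c → i ≠ d → t i = s i)
    {a b : Fin N} (hab : a = c ∧ b = d ∨ a = d ∧ b = c) :
    IsQuantumMatrix q (skewMatrix t s a b) := by
  have ht := isQuantumMatrix_diagonal q t
  have hs := isQuantumMatrix_diagonal q s
  have key : ∀ i : Fin N, i = c ∨ i = d ∨ (i ≠ c ∧ i ≠ d ∧ t i = s i) := by
    intro i
    have := hts i
    tauto
  constructor
  · intro i j l h
    have h1 := ht.row i j l h
    have h2 := hs.row i j l h
    simp only [smul_eq_mul] at h1 h2
    have h3 : (if i = j then t i else 0) * (if i = a ∧ l = b then 1 else 0) +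
        (if i = a ∧ j = b then 1 else 0) * (if i = l then s i else 0) =
        q * ((if i = l then t i else 0) * (if i = a ∧ j = b then 1 else 0) +
        (if i = a ∧ l = b then 1 else 0) * (if i = j then s i else 0)) := by
      grind
    ext m n
    fin_cases m <;> fin_cases n <;>
      simp only [skewMatrix, Matrix.mul_apply, Fin.sum_univ_two, Matrix.smul_apply, smul_eq_mul] <;>
      simp <;> first | simpa using h1 | simpa using h2 | simpa using h3
  · intro i k j h
    have h1 := ht.col i k j h
    have h2 := hs.col i k j h
    simp only [smul_eq_mul] at h1 h2
    have h3 : (if i = j then t i else 0) * (if k = a ∧ j = b then 1 else 0) +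
        (if i = a ∧ j = b then 1 else 0) * (if k = j then s k else 0) =
        q * ((if k = j then t k else 0) * (if i = a ∧ j = b then 1 else 0) +
        (if k = a ∧ j = b then 1 else 0) * (if i = j then s i else 0)) := by
      grind
    ext m n
    fin_cases m <;> fin_cases n <;>
      simp only [skewMatrix, Matrix.mul_apply, Fin.sum_univ_two, Matrix.smul_apply, smul_eq_mul] <;>
      simp <;> first | simpa using h1 | simpa using h2 | simpa using h3
  · intro i k j l h h'
    have h1 := ht.anti i k j l h h'
    have h2 := hs.anti i k j l h h'
    have h3 : (if i = l then t i else 0) * (if k = a ∧ j = b then 1 else 0) +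
        (if i = a ∧ l = b then 1 else 0) * (if k = j then s k else 0) =
        ((if k = j then t k else 0) * (if i = a ∧ l = b then 1 else 0) +
        (if k = a ∧ j = b then 1 else 0) * (if i = l then s i else 0)) := by
      grind
    ext m n
    fin_cases m <;> fin_cases n <;>
      simp only [skewMatrix, Matrix.mul_apply, Fin.sum_univ_two] <;>
      simp <;> first | simpa using h1 | simpa using h2 | simpa using h3
  · intro i k j l h h'
    have h1 := ht.diag i k j l h h'
    have h2 := hs.diag i k j l h h'
    simp only [smul_eq_mul] at h1 h2
    have h3 : ((if i = j then t i else 0) * (if k = a ∧ l = b then 1 else 0) +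
        (if i = a ∧ j = b then 1 else 0) * (if k = l then s k else 0)) -
        ((if k = l then t k else 0) * (if i = a ∧ j = b then 1 else 0) +
        (if k = a ∧ l = b then 1 else 0) * (if i = j then s i else 0)) = (q - q⁻¹) *
        ((if i = l then t i else 0) * (if k = a ∧ j = b then 1 else 0) +
        (if i = a ∧ l = b then 1 else 0) * (if k = j then s k else 0)) := by
      grind
    ext m n
    fin_cases m <;> fin_cases n <;>
      simp only [skewMatrix, Matrix.mul_apply, Fin.sum_univ_two, Matrix.smul_apply, smul_eq_mul,
        Matrix.sub_apply] <;>
      simp <;> first | simpa using h1 | simpa using h2 | simpa using h3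

theorem prod_list_ofFn_triangular {N : ℕ} {B : Type} [Ring B] {y : Fin N → Fin N → B}
    (hy : ∀ i j, i < j → y i j = 0) (σ : Equiv.Perm (Fin N)) (hσ : σ ≠ 1) :
    ((List.finRange N).map fun k => y k (σ k)).prod = 0 := by
  have : ∃ k, k < σ k := by
    by_contra! h
    apply hσ
    have hle : ∀ k, σ k = k := by
      intro k
      induction k using WellFoundedLT.induction with
      | ind k ih =>
        by_contra hne
        have hlt : σ k < k := lt_of_le_of_ne (h k) hne
        exact hne (σ.injective (ih _ hlt))
    ext k; simp [hle k]
  obtain ⟨k, hk⟩ := this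
  apply List.prod_eq_zero
  rw [List.mem_map]
  exact ⟨k, List.mem_finRange k, hy _ _ hk⟩

theorem invCount_one (t : ℕ) : invCount (1 : Equiv.Perm (Fin t)) = 0 := by
  simp only [invCount, Finset.card_eq_zero, Finset.filter_eq_empty_iff]
  rintro p - ⟨h1, h2⟩
  exact lt_asymm h1 h2

theorem qMinor_triangular {N : ℕ} (q : ℂ) {B : Type} [Ring B] [Algebra ℂ B]
    {y : Fin N → Fin N → B} (hy : ∀ i j, i < j → y i j = 0) (I : Finset (Fin N)) :
    qMinor q y I = ((List.finRange I.card).map fun k =>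
      y ((I.orderIsoOfFin rfl) k).1 ((I.orderIsoOfFin rfl) k).1).prod := by
  rw [qMinor, Finset.sum_eq_single 1]
  · simp [invCount_one]
  · intro σ _ hσ
    rw [prod_list_ofFn_triangular (y := fun i j => y ((I.orderIsoOfFin rfl) i).1
      ((I.orderIsoOfFin rfl) j).1) _ σ hσ, smul_zero]
    intro i j hij
    exact hy _ _ (by simpa using hij)
  · simp

theorem map_qMinor {N : ℕ} (q : ℂ) {M B : Type} [Ring M] [Algebra ℂ M] [Ring B] [Algebra ℂ B]
    (x : Fin N → Fin N → M) (φ : M →ₐ[ℂ] B) (I : Finset (Fin N)) :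
    φ (qMinor q x I) = qMinor q (fun i j => φ (x i j)) I := by
  simp [qMinor, map_sum, map_list_prod, Function.comp_def]

theorem List.isUnit_prod {B : Type} [Monoid B] (L : List B) (h : ∀ y ∈ L, IsUnit y) :
    IsUnit L.prod := by
  induction L with
  | nil => simp
  | cons a L ih =>
    rw [List.prod_cons]
    exact (h a (by simp)).mul (ih fun y hy => h y (by simp [hy]))

/-- A triangular matrix with invertible diagonal has invertible quantum determinant. -/
theorem isUnit_qdet_triangular {N : ℕ} (q : ℂ) {B : Type} [Ring B] [Algebra ℂ B]
    {y : Fin N → Fin N → B} (hy : ∀ i j, i < j → y i j = 0) (hd : ∀ i, IsUnit (y i i)) :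
    IsUnit (qdet q y) := by
  rw [qdet, qMinor_triangular q hy]
  apply List.isUnit_prod
  simp only [List.mem_map]
  rintro _ ⟨k, -, rfl⟩
  exact hd _

namespace IsQuantumMatrixAlgebra

variable {N : ℕ} {q : ℂ} {M : Type} [Ring M] [Algebra ℂ M] {x : Fin N → Fin N → M}
  {Δ : M →ₐ[ℂ] M ⊗[ℂ] M} (hM : IsQuantumMatrixAlgebra q x Δ)
include hM

/-- Skew-primitive functionals, realised as an entry of a triangular representation. -/
theorem exists_skew {c d : Fin N} (hcd : c.val + 1 = d.val)
    {t s : Fin N → ℂ} (hc : t c = q * s c) (hd : s d = q * t d)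
    (hts : ∀ i, i ≠ c → i ≠ d → t i = s i)
    {a b : Fin N} (hab : a = c ∧ b = d ∨ a = d ∧ b = c) :
    ∃ φ : M →ₐ[ℂ] Matrix (Fin 2) (Fin 2) ℂ, (∀ i j, φ (x i j) = skewMatrix t s a b i j) ∧
      ∀ f g, φ (f * g) 0 1 =
        hM.diagHom t f * φ g 0 1 + φ f 0 1 * hM.diagHom s g := by
  obtain ⟨φ, hφ⟩ := hM.lift _ _ (isQuantumMatrix_skewMatrix hcd hc hd hts hab)
  refine ⟨φ, hφ, ?_⟩
  have h : ∀ f, φ f 0 0 = hM.diagHom t f ∧ φ f 1 0 = 0 ∧ φ f 1 1 = hM.diagHom s f := by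
    intro f
    induction f using hM.induction with
    | one => simp
    | add a b ha hb => simp [ha, hb]
    | smul c a ha => simp [ha]
    | gen_mul i j a ha =>
      simp only [map_mul, Matrix.mul_apply, Fin.sum_univ_two, ha, hφ, hM.diagHom_gen]
      simp [skewMatrix]
  intro f g
  rw [map_mul, Matrix.mul_apply, Fin.sum_univ_two, (h f).1, (h g).2.2]

end IsQuantumMatrixAlgebra

/-- Pairs of adjacent indices. -/
abbrev AdjPair (N : ℕ) : Type := {p : Fin N × Fin N // p.1.val + 1 = p.2.val}

namespace AdjPair

variable {N : ℕ} (s : AdjPair N)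

/-- The smaller index. -/
def lo : Fin N := s.1.1

/-- The larger index. -/
def hi : Fin N := s.1.2

theorem lo_hi : s.lo.val + 1 = s.hi.val := s.2

theorem lo_ne_hi : s.lo ≠ s.hi := fun h => by
  have := s.lo_hi
  rw [h] at this
  omega

/-- The simple root attached to an adjacent pair. -/
def root : Fin N → ℤ := Pi.single s.lo 1 - Pi.single s.hi 1

theorem root_lo : s.root s.lo = 1 := by simp [root, s.lo_ne_hi]

theorem root_hi : s.root s.hi = -1 := by simp [root, s.lo_ne_hi.symm]

theorem root_of_ne {i : Fin N} (h : i ≠ s.lo) (h' : i ≠ s.hi) : s.root i = 0 := by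
  simp [root, h, h']

theorem root_apply (i : Fin N) :
    s.root i = (if i = s.lo then 1 else 0) - (if i = s.hi then 1 else 0) := by
  simp [root, Pi.single_apply]

theorem eq_of_lo_eq {s s' : AdjPair N} (h : s.lo = s'.lo) : s = s' := by
  have h1 := s.lo_hi
  have h2 := s'.lo_hi
  rw [h, h2] at h1
  exact Subtype.ext (Prod.ext h (Fin.ext h1.symm))

theorem eq_of_hi_eq {s s' : AdjPair N} (h : s.hi = s'.hi) : s = s' := by
  apply eq_of_lo_eq
  have h1 := s.lo_hi
  have h2 := s'.lo_hi
  rw [h] at h1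
  exact Fin.ext (by omega)

end AdjPair

namespace IsQuantumMatrixAlgebra

variable {N : ℕ} {q : ℂ} {M : Type} [Ring M] [Algebra ℂ M] {x : Fin N → Fin N → M}
  {Δ : M →ₐ[ℂ] M ⊗[ℂ] M} (hM : IsQuantumMatrixAlgebra q x Δ) (hq : q ≠ 0)
include hM hq

theorem exists_skew_raise (s : AdjPair N) :
    ∃ φ : M →ₐ[ℂ] Matrix (Fin 2) (Fin 2) ℂ,
      (∀ i j, φ (x i j) = skewMatrix (fun i => q ^ s.root i) 1 s.lo s.hi i j) ∧
      ∀ f g, φ (f * g) 0 1 =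
        hM.diagHom (fun i => q ^ s.root i) f * φ g 0 1 + φ f 0 1 * hM.diagHom 1 g :=
  hM.exists_skew s.lo_hi (by simp [s.root_lo]) (by simp [s.root_hi, hq])
    (fun i h h' => by simp [s.root_of_ne h h']) (Or.inl ⟨rfl, rfl⟩)

theorem exists_skew_lower (s : AdjPair N) :
    ∃ φ : M →ₐ[ℂ] Matrix (Fin 2) (Fin 2) ℂ,
      (∀ i j, φ (x i j) = skewMatrix 1 (fun i => q ^ (-s.root i)) s.hi s.lo i j) ∧
      ∀ f g, φ (f * g) 0 1 =
        hM.diagHom 1 f * φ g 0 1 + φ f 0 1 * hM.diagHom (fun i => q ^ (-s.root i)) g :=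
  hM.exists_skew s.lo_hi (by simp [s.root_lo, hq]) (by simp [s.root_hi])
    (fun i h h' => by simp [s.root_of_ne h h']) (Or.inr ⟨rfl, rfl⟩)

/-- The functional defining the raising operators. -/
def raiseFun (s : AdjPair N) : M →ₗ[ℂ] ℂ :=
  Matrix.entryLinearMap ℂ ℂ 0 1 ∘ₗ (hM.exists_skew_raise hq s).choose.toLinearMap

/-- The functional defining the lowering operators. -/
def lowerFun (s : AdjPair N) : M →ₗ[ℂ] ℂ :=
  Matrix.entryLinearMap ℂ ℂ 0 1 ∘ₗ (hM.exists_skew_lower hq s).choose.toLinearMap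

/-- The raising operator on columns. -/
def raise (s : AdjPair N) : M →ₗ[ℂ] M := colAct Δ (hM.raiseFun hq s)

/-- The lowering operator on columns. -/
def lower (s : AdjPair N) : M →ₗ[ℂ] M := colAct Δ (hM.lowerFun hq s)

/-- The operator on rows attached to the functional of `lower`. -/
def rowLower (s : AdjPair N) : M →ₗ[ℂ] M := rowAct Δ (hM.lowerFun hq s)

omit hq in
/-- The diagonal column operator `q^{n·α}` attached to a simple root. -/
def tor (n : ℤ) (s : AdjPair N) : M →ₗ[ℂ] M :=
  colAct Δ (hM.diagHom (fun i => q ^ (n * s.root i))).toLinearMap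

theorem raiseFun_gen (s : AdjPair N) (i j : Fin N) :
    hM.raiseFun hq s (x i j) = if i = s.lo ∧ j = s.hi then 1 else 0 := by
  change (hM.exists_skew_raise hq s).choose (x i j) 0 1 = _
  rw [(hM.exists_skew_raise hq s).choose_spec.1]
  simp [skewMatrix]

theorem lowerFun_gen (s : AdjPair N) (i j : Fin N) :
    hM.lowerFun hq s (x i j) = if i = s.hi ∧ j = s.lo then 1 else 0 := by
  change (hM.exists_skew_lower hq s).choose (x i j) 0 1 = _
  rw [(hM.exists_skew_lower hq s).choose_spec.1]
  simp [skewMatrix]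

theorem raise_one (s : AdjPair N) : hM.raise hq s 1 = 0 :=
  colAct_one_eq_zero Δ (by simp [raiseFun])

theorem lower_one (s : AdjPair N) : hM.lower hq s 1 = 0 :=
  colAct_one_eq_zero Δ (by simp [lowerFun])

theorem rowLower_one (s : AdjPair N) : hM.rowLower hq s 1 = 0 :=
  rowAct_one_eq_zero Δ (by simp [lowerFun])

theorem raise_gen (s : AdjPair N) (i j : Fin N) :
    hM.raise hq s (x i j) = if j = s.hi then x i s.lo else 0 := by
  rw [raise, hM.colAct_gen, Finset.sum_eq_single s.lo] <;> simp +contextual [raiseFun_gen]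

theorem lower_gen (s : AdjPair N) (i j : Fin N) :
    hM.lower hq s (x i j) = if j = s.lo then x i s.hi else 0 := by
  rw [lower, hM.colAct_gen, Finset.sum_eq_single s.hi] <;> simp +contextual [lowerFun_gen]

theorem rowLower_gen (s : AdjPair N) (i j : Fin N) :
    hM.rowLower hq s (x i j) = if i = s.hi then x s.lo j else 0 := by
  rw [rowLower, hM.rowAct_gen, Finset.sum_eq_single s.lo] <;> simp +contextual [lowerFun_gen]

theorem raise_mul (s : AdjPair N) (f g : M) :
    hM.raise hq s (f * g) = hM.raise hq s f * g + hM.tor 1 s f * hM.raise hq s g := by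
  have := colAct_mul Δ (u := hM.raiseFun hq s)
    (v₁ := (hM.diagHom fun i => q ^ s.root i).toLinearMap) (w₁ := hM.raiseFun hq s)
    (v₂ := hM.raiseFun hq s) (w₂ := (hM.diagHom 1).toLinearMap)
    (fun a b => (hM.exists_skew_raise hq s).choose_spec.2 a b) f g
  rw [hM.colAct_diagHom_one, add_comm] at this
  simpa only [raise, tor, one_mul] using this

theorem lower_mul (s : AdjPair N) (f g : M) :
    hM.lower hq s (f * g) = hM.lower hq s f * hM.tor (-1) s g + f * hM.lower hq s g := by
  have := colAct_mul Δ (u := hM.lowerFun hq s)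
    (v₁ := (hM.diagHom 1).toLinearMap) (w₁ := hM.lowerFun hq s)
    (v₂ := hM.lowerFun hq s) (w₂ := (hM.diagHom fun i => q ^ (-s.root i)).toLinearMap)
    (fun a b => (hM.exists_skew_lower hq s).choose_spec.2 a b) f g
  rw [hM.colAct_diagHom_one, add_comm] at this
  simpa only [lower, tor, neg_mul, one_mul] using this

theorem rowLower_mul (s : AdjPair N) (f g : M) :
    hM.rowLower hq s (f * g) = hM.rowLower hq s f *
      rowAct Δ (hM.diagHom fun i => q ^ (-s.root i)).toLinearMap g + f * hM.rowLower hq s g := by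
  have := rowAct_mul Δ (u := hM.lowerFun hq s)
    (v₁ := (hM.diagHom 1).toLinearMap) (w₁ := hM.lowerFun hq s)
    (v₂ := hM.lowerFun hq s) (w₂ := (hM.diagHom fun i => q ^ (-s.root i)).toLinearMap)
    (fun a b => (hM.exists_skew_lower hq s).choose_spec.2 a b) f g
  rw [hM.rowAct_diagHom_one, add_comm] at this
  simpa only [rowLower] using this

omit hq in
theorem tor_gen (n : ℤ) (s : AdjPair N) (i j : Fin N) :
    hM.tor n s (x i j) = q ^ (n * s.root j) • x i j := hM.colAct_diagHom_gen _ i j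

end IsQuantumMatrixAlgebra

/-- Monomials in the entries of `x` with prescribed column content. -/
inductive IsColWord {N : ℕ} {M : Type} [Ring M] (x : Fin N → Fin N → M) :
    (Fin N → ℤ) → M → Prop
  | one : IsColWord x 0 1
  | gen_mul (i j : Fin N) {μ : Fin N → ℤ} {m : M} (h : IsColWord x μ m) :
      IsColWord x (μ + Pi.single j 1) (x i j * m)

/-- The span of the monomials of column content `μ`. -/
def colWt {N : ℕ} {M : Type} [Ring M] [Algebra ℂ M] (x : Fin N → Fin N → M)
    (μ : Fin N → ℤ) : Submodule ℂ M := Submodule.span ℂ {m | IsColWord x μ m}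

section colWt

variable {N : ℕ} {M : Type} [Ring M] [Algebra ℂ M] {x : Fin N → Fin N → M}

theorem one_mem_colWt : (1 : M) ∈ colWt x 0 := Submodule.subset_span .one

theorem gen_mul_mem_colWt (i j : Fin N) {μ : Fin N → ℤ} {m : M} (h : m ∈ colWt x μ) :
    x i j * m ∈ colWt x (μ + Pi.single j 1) := by
  induction h using Submodule.span_induction with
  | zero => simp
  | add a b _ _ ha hb => rw [mul_add]; exact add_mem ha hb
  | smul c a _ ha => rw [mul_smul_comm]; exact Submodule.smul_mem _ _ ha
  | mem a ha => exact Submodule.subset_span (.gen_mul i j ha)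

theorem colWt_induction {Q : (μ : Fin N → ℤ) → (m : M) → m ∈ colWt x μ → Prop}
    (zero : ∀ μ, Q μ 0 (zero_mem _)) (one : Q 0 1 one_mem_colWt)
    (add : ∀ μ a b ha hb, Q μ a ha → Q μ b hb → Q μ (a + b) (add_mem ha hb))
    (smul : ∀ μ (c : ℂ) a ha, Q μ a ha → Q μ (c • a) (Submodule.smul_mem _ c ha))
    (gen_mul : ∀ i j μ m hm, Q μ m hm →
      Q (μ + Pi.single j 1) (x i j * m) (gen_mul_mem_colWt i j hm))
    {μ : Fin N → ℤ} {m : M} (h : m ∈ colWt x μ) : Q μ m h := by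
  induction h using Submodule.span_induction with
  | zero => exact zero μ
  | add a b _ _ ha hb => exact add μ a b _ _ ha hb
  | smul c a _ ha => exact smul μ c a _ ha
  | mem a ha =>
    induction ha with
    | one => exact one
    | gen_mul i j h ih => exact gen_mul i j _ _ (Submodule.subset_span h) ih

/-- A product of integer powers of one number. -/
theorem prod_zpow_eq_zpow_sum {α : Type*} {q : ℂ} (hq : q ≠ 0) (s : Finset α) (f : α → ℤ) :
    ∏ i ∈ s, q ^ f i = q ^ ∑ i ∈ s, f i := by
  classical
  induction s using Finset.induction_on with
  | empty => simp
  | insert a s ha ih => rw [Finset.prod_insert ha, Finset.sum_insert ha, zpow_add₀ hq, ih]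

theorem eq_zero_of_mem_colWt {μ : Fin N → ℤ} {k : Fin N} (hk : μ k < 0) {m : M}
    (h : m ∈ colWt x μ) : m = 0 := by
  have hw : ∀ {μ : Fin N → ℤ} {m : M}, IsColWord x μ m → 0 ≤ μ k := by
    intro μ m h
    induction h with
    | one => simp
    | gen_mul i j h ih =>
      have : (0 : ℤ) ≤ (Pi.single j 1 : Fin N → ℤ) k := by
        rw [Pi.single_apply]; split_ifs <;> simp
      simpa using add_nonneg ih this
  have : {m : M | IsColWord x μ m} = ∅ := by
    ext m
    simpa using fun hm => absurd (hw hm) (not_le.mpr hk)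
  simpa [colWt, this] using h

end colWt

namespace IsQuantumMatrixAlgebra

variable {N : ℕ} {q : ℂ} {M : Type} [Ring M] [Algebra ℂ M] {x : Fin N → Fin N → M}
  {Δ : M →ₐ[ℂ] M ⊗[ℂ] M} (hM : IsQuantumMatrixAlgebra q x Δ) (hq : q ≠ 0)
include hM

theorem iSup_colWt : ⨆ μ, colWt x μ = ⊤ := by
  rw [eq_top_iff]
  rintro m -
  induction m using hM.induction with
  | one => exact Submodule.mem_iSup_of_mem 0 one_mem_colWt
  | add a b ha hb => exact add_mem ha hb
  | smul c a ha => exact Submodule.smul_mem _ _ ha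
  | gen_mul i j a ha =>
    induction ha using Submodule.iSup_induction' with
    | mem μ a ha => exact Submodule.mem_iSup_of_mem _ (gen_mul_mem_colWt i j ha)
    | zero => simp
    | add a b _ _ ha hb => rw [mul_add]; exact add_mem ha hb

/-- A diagonal character acts on a column weight space by a scalar. -/
theorem colAct_diagHom_of_mem (t : Fin N → ℂ) (ht : ∀ i, t i ≠ 0) {μ : Fin N → ℤ} {m : M}
    (hm : m ∈ colWt x μ) :
    colAct Δ (hM.diagHom t).toLinearMap m = (∏ j, t j ^ μ j) • m := by
  induction hm using colWt_induction with
  | zero μ => simp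
  | one => simp [colAct_algHom_one]
  | add μ a b _ _ ha hb => rw [map_add, ha, hb, smul_add]
  | smul μ c a _ ha => rw [map_smul, ha, smul_comm]
  | gen_mul i j μ m hm ih =>
    rw [colAct_algHom_mul, ih, hM.colAct_diagHom_gen, smul_mul_smul_comm]
    congr 1
    simp only [Pi.add_apply, zpow_add₀ (ht _), Finset.prod_mul_distrib]
    rw [mul_comm, Finset.prod_eq_single (f := fun k => t k ^ (Pi.single j 1 : Fin N → ℤ) k) j]
    · simp
    · intro b _ hb; simp [hb]
    · simp

include hq in
theorem tor_of_mem (n : ℤ) (s : AdjPair N) {μ : Fin N → ℤ} {m : M} (hm : m ∈ colWt x μ) :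
    hM.tor n s m = q ^ (n * (μ s.lo - μ s.hi)) • m := by
  rw [tor, hM.colAct_diagHom_of_mem _ (fun i => zpow_ne_zero _ hq) hm]
  congr 1
  simp only [← zpow_mul]
  rw [prod_zpow_eq_zpow_sum hq]
  congr 1
  simp only [AdjPair.root_apply, mul_assoc, ← Finset.mul_sum, sub_mul, ite_mul, one_mul, zero_mul,
    Finset.sum_sub_distrib, Finset.sum_ite_eq', Finset.mem_univ, if_true]

theorem raise_mem (s : AdjPair N) {μ : Fin N → ℤ} {m : M} (hm : m ∈ colWt x μ) :
    hM.raise hq s m ∈ colWt x (μ + s.root) := by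
  induction hm using colWt_induction with
  | zero μ => simp
  | one => simp [hM.raise_one]
  | add μ a b _ _ ha hb => rw [map_add]; exact add_mem ha hb
  | smul μ c a _ ha => rw [map_smul]; exact Submodule.smul_mem _ _ ha
  | gen_mul i j μ m hm ih =>
    rw [hM.raise_mul, hM.raise_gen, hM.tor_gen, smul_mul_assoc]
    refine add_mem ?_ (Submodule.smul_mem _ _ ?_)
    · split_ifs with h
      · subst h
        convert gen_mul_mem_colWt i s.lo hm using 1
        rw [AdjPair.root]; congr 1; abel
      · simp
    · convert gen_mul_mem_colWt i j ih using 1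
      congr 1; abel

theorem lower_mem (s : AdjPair N) {μ : Fin N → ℤ} {m : M} (hm : m ∈ colWt x μ) :
    hM.lower hq s m ∈ colWt x (μ - s.root) := by
  induction hm using colWt_induction with
  | zero μ => simp
  | one => simp [hM.lower_one]
  | add μ a b _ _ ha hb => rw [map_add]; exact add_mem ha hb
  | smul μ c a _ ha => rw [map_smul]; exact Submodule.smul_mem _ _ ha
  | gen_mul i j μ m hm ih =>
    rw [hM.lower_mul, hM.lower_gen, hM.tor_of_mem hq _ _ hm, mul_smul_comm]
    refine add_mem (Submodule.smul_mem _ _ ?_) ?_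
    · split_ifs with h
      · subst h
        convert gen_mul_mem_colWt i s.hi hm using 1
        rw [AdjPair.root]; congr 1; abel
      · simp
    · convert gen_mul_mem_colWt i j ih using 1
      congr 1; abel

end IsQuantumMatrixAlgebra

/-- Symmetric quantum integers, with the ordinary integers at `q = 1`. -/
def quantumInt (q : ℂ) (n : ℤ) : ℂ :=
  if q = 1 then (n : ℂ) else (q ^ n - q ^ (-n)) / (q - q⁻¹)

/-- The parameter `q` is `1` or not a root of unity. -/
def IsGeneric (q : ℂ) : Prop := (∀ n : ℕ, 0 < n → q ^ n ≠ 1) ∨ q = 1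

namespace IsGeneric

variable {q : ℂ} (hg : IsGeneric q) (hq : q ≠ 0)
include hg hq

omit hq in
theorem zpow_ne_one (h1 : q ≠ 1) {n : ℤ} (hn : n ≠ 0) : q ^ n ≠ 1 := by
  obtain hg | hg := hg
  · intro h
    apply hg n.natAbs (Int.natAbs_pos.mpr hn)
    obtain h' | h' := Int.natAbs_eq n
    · rwa [h', zpow_natCast] at h
    · rwa [h', zpow_neg, zpow_natCast, inv_eq_one] at h
  · exact absurd hg h1

theorem zpow_sub_zpow_neg_ne_zero (h1 : q ≠ 1) {n : ℤ} (hn : n ≠ 0) :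
    q ^ n - q ^ (-n) ≠ 0 := by
  intro h
  apply hg.zpow_ne_one h1 (n := n + n) (by omega)
  rw [zpow_add₀ hq]
  nth_rewrite 1 [sub_eq_zero.mp h]
  rw [← zpow_add₀ hq]
  simp

theorem sub_inv_ne_zero (h1 : q ≠ 1) : q - q⁻¹ ≠ 0 := by
  simpa using hg.zpow_sub_zpow_neg_ne_zero hq h1 one_ne_zero

theorem quantumInt_ne_zero {n : ℤ} (hn : n ≠ 0) : quantumInt q n ≠ 0 := by
  rw [quantumInt]
  split_ifs with h1
  · exact_mod_cast hn
  · exact div_ne_zero (hg.zpow_sub_zpow_neg_ne_zero hq h1 hn) (hg.sub_inv_ne_zero hq h1)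

theorem quantumInt_add_one (n : ℤ) :
    quantumInt q (n + 1) = q * quantumInt q n + q ^ (-n) := by
  rw [quantumInt, quantumInt]
  split_ifs with h1
  · simp [h1]
  · have := hg.sub_inv_ne_zero hq h1
    rw [mul_div_assoc', div_add' _ _ _ this]
    congr 1
    rw [neg_add, zpow_add₀ hq, zpow_add₀ hq, zpow_neg_one, zpow_one]
    ring

theorem quantumInt_sub_one (n : ℤ) :
    quantumInt q (n - 1) = q⁻¹ * quantumInt q n - q ^ (-n) := by
  have := hg.quantumInt_add_one hq (n - 1)
  rw [sub_add_cancel] at this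
  rw [this, neg_sub, sub_eq_add_neg 1 n, zpow_add₀ hq, zpow_one, mul_add,
    inv_mul_cancel_left₀ hq, inv_mul_cancel_left₀ hq, add_sub_cancel_right]

theorem quantumInt_mul_succ (k n : ℤ) :
    quantumInt q (k + 1) * quantumInt q (n - k)
      = quantumInt q n + quantumInt q k * quantumInt q (n - k - 1) := by
  simp only [quantumInt]
  split_ifs with h1
  · push_cast; ring
  · have := hg.sub_inv_ne_zero hq h1
    simp only [neg_add, sub_eq_add_neg, zpow_add₀ hq, neg_neg, zpow_one, zpow_neg]
    have hk : q ^ k ≠ 0 := zpow_ne_zero _ hq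
    have hn : q ^ n ≠ 0 := zpow_ne_zero _ hq
    generalize q ^ k = u at *
    generalize q ^ n = v at *
    have h2 : q ^ 2 - 1 ≠ 0 := by
      intro h; apply this; field_simp; rw [h, mul_zero]
    have h3 : q + -q⁻¹ = (q ^ 2 - 1) / q := by field_simp; ring
    rw [h3]
    field_simp
    ring

end IsGeneric

theorem quantumInt_zero (q : ℂ) : quantumInt q 0 = 0 := by simp [quantumInt]

namespace IsQuantumMatrixAlgebra

variable {N : ℕ} {q : ℂ} {M : Type} [Ring M] [Algebra ℂ M] {x : Fin N → Fin N → M}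
  {Δ : M →ₐ[ℂ] M ⊗[ℂ] M} (hM : IsQuantumMatrixAlgebra q x Δ) (hq : q ≠ 0)
include hM

theorem raise_lower_of_ne {s s' : AdjPair N} (hs : s ≠ s') (m : M) :
    hM.raise hq s (hM.lower hq s' m) = hM.lower hq s' (hM.raise hq s m) := by
  have hm : m ∈ ⨆ μ, colWt x μ := by rw [hM.iSup_colWt]; trivial
  induction hm using Submodule.iSup_induction' with
  | zero => simp
  | add a b _ _ ha hb => simp only [map_add, ha, hb]
  | mem μ m hm =>
  induction hm using colWt_induction with
  | zero μ => simp
  | one => simp [raise_one, lower_one]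
  | add μ a b _ _ ha hb => simp only [map_add, ha, hb]
  | smul μ c a _ ha => simp only [map_smul, ha]
  | gen_mul i j μ m hm ih =>
    have hlo : s.lo ≠ s'.lo := fun h => hs (AdjPair.eq_of_lo_eq h)
    have hhi : s.hi ≠ s'.hi := fun h => hs (AdjPair.eq_of_hi_eq h)
    simp only [raise_mul, lower_mul, map_add, raise_gen, lower_gen, hM.tor_gen,
      hM.tor_of_mem hq _ _ hm, hM.tor_of_mem hq _ _ (hM.raise_mem hq s hm), ih, map_smul,
      smul_mul_assoc, mul_smul_comm, smul_add]
    by_cases hj : j = s'.lo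
    · subst hj
      have h1 : q ^ (-1 * (μ s'.lo - μ s'.hi)) * q ^ (1 * s.root s'.hi) =
          q ^ (1 * s.root s'.lo) *
            q ^ (-1 * ((μ + s.root) s'.lo - (μ + s.root) s'.hi)) := by
        rw [← zpow_add₀ hq, ← zpow_add₀ hq]
        congr 1
        simp only [Pi.add_apply]
        ring
      simp only [if_true, hM.raise_gen, hM.tor_gen, hhi.symm, if_false, zero_mul, smul_zero,
        zero_add, smul_mul_assoc, smul_smul, h1]
      have h2 : hM.lower hq s' (if s'.lo = s.hi then x i s.lo else 0) = 0 := by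
        split_ifs <;> simp [hM.lower_gen, hlo]
      rw [h2, zero_mul, smul_zero, zero_add]
      abel
    · simp only [hj, if_false, map_zero, zero_mul, smul_zero, zero_add, add_zero]
      have h2 : hM.lower hq s' (if j = s.hi then x i s.lo else 0) = 0 := by
        split_ifs <;> simp [hM.lower_gen, hlo]
      rw [h2, zero_mul, smul_zero, zero_add]

theorem raise_lower_self (hg : IsGeneric q) (s : AdjPair N) {μ : Fin N → ℤ} {m : M}
    (hm : m ∈ colWt x μ) :
    hM.raise hq s (hM.lower hq s m) =
      hM.lower hq s (hM.raise hq s m) + quantumInt q (μ s.lo - μ s.hi) • m := by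
  induction hm using colWt_induction with
  | zero μ => simp
  | one => simp [raise_one, lower_one, quantumInt_zero]
  | add μ a b _ _ ha hb => simp only [map_add, ha, hb, smul_add]; abel
  | smul μ c a _ ha => simp only [map_smul, ha, smul_add, smul_comm c]
  | gen_mul i j μ m hm ih =>
    have hne := s.lo_ne_hi
    simp only [raise_mul, lower_mul, map_add, raise_gen, lower_gen, hM.tor_gen,
      hM.tor_of_mem hq _ _ hm, hM.tor_of_mem hq _ _ (hM.raise_mem hq s hm), ih, map_smul,
      smul_mul_assoc, mul_smul_comm, smul_add, mul_add]
    by_cases hj : j = s.lo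
    · subst hj
      have h1 : q ^ (-1 * (μ s.lo - μ s.hi)) * q ^ (1 * s.root s.hi) =
          q ^ (1 * s.root s.lo) *
            q ^ (-1 * ((μ + s.root) s.lo - (μ + s.root) s.hi)) := by
        rw [← zpow_add₀ hq, ← zpow_add₀ hq]
        congr 1
        simp only [Pi.add_apply, s.root_lo, s.root_hi]
        ring
      have h3 : quantumInt q ((μ + Pi.single s.lo 1 : Fin N → ℤ) s.lo - (μ + Pi.single s.lo 1 : Fin N → ℤ) s.hi) =
          q ^ (-1 * (μ s.lo - μ s.hi)) +
            q ^ (1 * s.root s.lo) * quantumInt q (μ s.lo - μ s.hi) := by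
        simp only [Pi.add_apply, Pi.single_eq_same, Pi.single_eq_of_ne hne.symm, s.root_lo]
        rw [show μ s.lo + 1 - (μ s.hi + 0) = (μ s.lo - μ s.hi) + 1 by ring,
          hg.quantumInt_add_one hq]
        simp [add_comm]
      simp only [if_true, hM.raise_gen, hM.tor_gen, hne, if_false, zero_mul, smul_zero,
        zero_add, smul_mul_assoc, smul_smul, h1, h3, map_zero, add_smul]
      module
    · simp only [hj, if_false, map_zero, zero_mul, smul_zero, zero_add, add_zero]
      by_cases hj' : j = s.hi
      · subst hj'
        have h3 : quantumInt q ((μ + Pi.single s.hi 1 : Fin N → ℤ) s.lo - (μ + Pi.single s.hi 1 : Fin N → ℤ) s.hi) =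
            q ^ (1 * s.root s.hi) * quantumInt q (μ s.lo - μ s.hi) -
              q ^ (-1 * (μ s.lo - μ s.hi)) := by
          simp only [Pi.add_apply, Pi.single_eq_same, Pi.single_eq_of_ne hne, s.root_hi]
          rw [show μ s.lo + 0 - (μ s.hi + 1) = (μ s.lo - μ s.hi) - 1 by ring,
            hg.quantumInt_sub_one hq]
          simp
        simp only [if_true, hM.lower_gen, h3, sub_smul]
        module
      · have h3 : (μ + Pi.single j 1 : Fin N → ℤ) s.lo - (μ + Pi.single j 1 : Fin N → ℤ) s.hi = μ s.lo - μ s.hi := by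
          simp [Pi.single_eq_of_ne (Ne.symm hj), Pi.single_eq_of_ne (Ne.symm hj')]
        simp only [hj', if_false, map_zero, zero_mul, zero_add, h3, s.root_of_ne hj hj',
          mul_zero, zpow_zero, one_smul, smul_zero]

end IsQuantumMatrixAlgebra

/-- A functional supported on a single column weight. -/
def HasColWt {N : ℕ} {M : Type} [Ring M] [Algebra ℂ M] (x : Fin N → Fin N → M)
    (L : M →ₗ[ℂ] ℂ) (w : Fin N → ℤ) : Prop :=
  ∀ μ, μ ≠ w → ∀ m ∈ colWt x μ, L m = 0

namespace IsQuantumMatrixAlgebra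

variable {N : ℕ} {q : ℂ} {M : Type} [Ring M] [Algebra ℂ M] {x : Fin N → Fin N → M}
  {Δ : M →ₐ[ℂ] M ⊗[ℂ] M} (hM : IsQuantumMatrixAlgebra q x Δ) (hq : q ≠ 0)
  {L : M →ₗ[ℂ] ℂ} {w : Fin N → ℤ}
include hM

theorem hasColWt_raise (hL : HasColWt x L w) (s : AdjPair N) :
    HasColWt x (L ∘ₗ hM.raise hq s) (w - s.root) := fun μ hμ m hm =>
  hL _ (fun h => hμ (by rw [← h]; abel)) _ (hM.raise_mem hq s hm)

theorem hasColWt_lower (hL : HasColWt x L w) (s : AdjPair N) :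
    HasColWt x (L ∘ₗ hM.lower hq s) (w + s.root) := fun μ hμ m hm =>
  hL _ (fun h => hμ (by rw [← h]; abel)) _ (hM.lower_mem hq s hm)

theorem eq_of_colWt {L L' : M →ₗ[ℂ] ℂ} (h : ∀ μ, ∀ m ∈ colWt x μ, L m = L' m) (m : M) :
    L m = L' m := by
  have hm : m ∈ ⨆ μ, colWt x μ := by rw [hM.iSup_colWt]; trivial
  induction hm using Submodule.iSup_induction' with
  | zero => simp
  | add a b _ _ ha hb => simp only [map_add, ha, hb]
  | mem μ m hm => exact h μ m hm

theorem apply_raise_lower_self (hg : IsGeneric q) (hL : HasColWt x L w) (s : AdjPair N) (m : M) :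
    L (hM.raise hq s (hM.lower hq s m)) =
      L (hM.lower hq s (hM.raise hq s m)) + quantumInt q (w s.lo - w s.hi) * L m := by
  refine hM.eq_of_colWt (L := L ∘ₗ hM.raise hq s ∘ₗ hM.lower hq s)
    (L' := L ∘ₗ hM.lower hq s ∘ₗ hM.raise hq s + quantumInt q (w s.lo - w s.hi) • L)
    (fun μ m hm => ?_) m
  by_cases hμ : μ = w
  · subst hμ
    simp [hM.raise_lower_self hq hg s hm]
  · simp [hM.raise_lower_self hq hg s hm, hL μ hμ m hm]

theorem apply_colAct_diagHom (hL : HasColWt x L w) (t : Fin N → ℂ) (ht : ∀ i, t i ≠ 0) (m : M) :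
    L (colAct Δ (hM.diagHom t).toLinearMap m) = (∏ j, t j ^ w j) * L m := by
  refine hM.eq_of_colWt (L := L ∘ₗ colAct Δ (hM.diagHom t).toLinearMap)
    (L' := (∏ j, t j ^ w j) • L) (fun μ m hm => ?_) m
  by_cases hμ : μ = w
  · subst hμ
    simp [hM.colAct_diagHom_of_mem t ht hm]
  · simp [hM.colAct_diagHom_of_mem t ht hm, hL μ hμ m hm]

/-- Composition of raising operators along a list. -/
def raiseList : List (AdjPair N) → M →ₗ[ℂ] M
  | [] => LinearMap.id
  | s :: J => hM.raise hq s ∘ₗ raiseList J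

/-- Composition of lowering operators along a list. -/
def lowerList : List (AdjPair N) → M →ₗ[ℂ] M
  | [] => LinearMap.id
  | s :: J => hM.lower hq s ∘ₗ lowerList J

theorem raiseList_cons (s : AdjPair N) (J : List (AdjPair N)) (m : M) :
    hM.raiseList hq (s :: J) m = hM.raise hq s (hM.raiseList hq J m) := rfl

theorem lowerList_cons (s : AdjPair N) (J : List (AdjPair N)) (m : M) :
    hM.lowerList hq (s :: J) m = hM.lower hq s (hM.lowerList hq J m) := rfl

theorem lowerList_append_singleton (I : List (AdjPair N)) (s : AdjPair N) (m : M) :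
    hM.lowerList hq (I ++ [s]) m = hM.lowerList hq I (hM.lower hq s m) := by
  induction I with
  | nil => rfl
  | cons a I ih => rw [List.cons_append, lowerList_cons, ih]; rfl

theorem hasColWt_raiseList (hL : HasColWt x L w) (J : List (AdjPair N)) :
    HasColWt x (L ∘ₗ hM.raiseList hq J) (w - (J.map AdjPair.root).sum) := by
  induction J generalizing L w with
  | nil => simpa [raiseList] using hL
  | cons s J ih =>
    have := ih (hM.hasColWt_raise hq hL s)
    rw [List.map_cons, List.sum_cons, ← sub_sub]
    exact this

theorem hasColWt_lowerList (hL : HasColWt x L w) (J : List (AdjPair N)) :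
    HasColWt x (L ∘ₗ hM.lowerList hq J) (w + (J.map AdjPair.root).sum) := by
  induction J generalizing L w with
  | nil => simpa [lowerList] using hL
  | cons s J ih =>
    have := ih (hM.hasColWt_lower hq hL s)
    rw [List.map_cons, List.sum_cons, ← add_assoc]
    exact this

theorem apply_raiseList_lower (hg : IsGeneric q) (hL : HasColWt x L w) {f : M}
    (hf : ∀ J, L (hM.raiseList hq J f) = 0) (s : AdjPair N) (J : List (AdjPair N)) :
    L (hM.raiseList hq J (hM.lower hq s f)) = L (hM.lower hq s (hM.raiseList hq J f)) := by
  induction J generalizing L w with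
  | nil => rfl
  | cons s' J ih =>
    have h1 := ih (hM.hasColWt_raise hq hL s') (fun J' => hf (s' :: J'))
    simp only [LinearMap.comp_apply] at h1
    rw [raiseList_cons, h1, raiseList_cons]
    by_cases h : s' = s
    · subst h
      rw [hM.apply_raise_lower_self hq hg hL, hf J, mul_zero, add_zero]
    · rw [hM.raise_lower_of_ne hq h]

theorem apply_raise_pow_lower (hg : IsGeneric q) (hL : HasColWt x L w) (s : AdjPair N) (f : M)
    (k : ℕ) :
    L (hM.raiseList hq (List.replicate (k + 1) s) (hM.lower hq s f)) =
      L (hM.lower hq s (hM.raiseList hq (List.replicate (k + 1) s) f)) +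
        quantumInt q (k + 1) * quantumInt q (w s.lo - w s.hi - k) *
          L (hM.raiseList hq (List.replicate k s) f) := by
  induction k generalizing L w with
  | zero =>
    have : quantumInt q 1 = 1 := by
      simpa [quantumInt_zero] using hg.quantumInt_add_one hq 0
    simp [raiseList, hM.apply_raise_lower_self hq hg hL, this]
  | succ k ih =>
    rw [List.replicate_succ, raiseList_cons]
    have h1 := ih (hM.hasColWt_raise hq hL s)
    simp only [LinearMap.comp_apply] at h1
    rw [h1, hM.apply_raise_lower_self hq hg hL, raiseList_cons]
    have h2 := hg.quantumInt_mul_succ hq (k + 1) (w s.lo - w s.hi)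
    simp only [Pi.sub_apply, s.root_lo, s.root_hi]
    push_cast
    rw [h2, show w s.lo - 1 - (w s.hi - -1) - (k : ℤ) = w s.lo - w s.hi - (k + 1) - 1 by ring,
      ← raiseList_cons, ← raiseList_cons, ← List.replicate_succ, ← List.replicate_succ]
    ring

end IsQuantumMatrixAlgebra

/-- Coefficient extraction with integer exponents; negative exponents give `0`. -/
def intCoeff {N : ℕ} (w : Fin N → ℤ) : MvPolynomial (Fin N) ℂ →ₗ[ℂ] ℂ :=
  if ∀ i, 0 ≤ w i then
    MvPolynomial.lcoeff ℂ (Finsupp.equivFunOnFinite.symm fun i => (w i).toNat)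
  else 0

section intCoeff

variable {N : ℕ}

theorem intCoeff_natCast (a : Fin N →₀ ℕ) (p : MvPolynomial (Fin N) ℂ) :
    intCoeff (fun i => (a i : ℤ)) p = p.coeff a := by
  rw [intCoeff, if_pos (fun i => by simp)]
  simp only [Int.toNat_natCast, MvPolynomial.lcoeff_apply]
  congr 1
  ext; simp

theorem intCoeff_of_neg {w : Fin N → ℤ} {i : Fin N} (h : w i < 0) (p : MvPolynomial (Fin N) ℂ) :
    intCoeff w p = 0 := by
  rw [intCoeff, if_neg (fun h' => absurd (h' i) (not_le.mpr h))]
  rfl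

theorem exists_natCast {w : Fin N → ℤ} (h : 0 ≤ w) :
    ∃ a : Fin N →₀ ℕ, w = fun i => (a i : ℤ) :=
  ⟨Finsupp.equivFunOnFinite.symm fun i => (w i).toNat, by
    ext i; simpa using (h i : (0 : ℤ) ≤ w i)⟩

theorem intCoeff_X_mul (w : Fin N → ℤ) (i : Fin N) (p : MvPolynomial (Fin N) ℂ) :
    intCoeff w (MvPolynomial.X i * p) = intCoeff (w - Pi.single i 1) p := by
  by_cases hw : 0 ≤ w
  · obtain ⟨a, rfl⟩ := exists_natCast hw
    rw [intCoeff_natCast, MvPolynomial.coeff_X_mul']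
    split_ifs with h
    · rw [← intCoeff_natCast]
      congr 1
      congr 1
      ext k
      rw [Finsupp.mem_support_iff] at h
      by_cases hk : k = i
      · subst hk
        simpa using Nat.cast_pred (Nat.pos_of_ne_zero h)
      · simp [Pi.single_eq_of_ne hk, Finsupp.single_eq_of_ne hk]
    · rw [Finsupp.notMem_support_iff] at h
      rw [intCoeff_of_neg (i := i)]
      simp [h]
  · have : ∃ k, w k < 0 := by
      by_contra! h
      exact hw h
    obtain ⟨k, hk⟩ := this
    rw [intCoeff_of_neg hk, intCoeff_of_neg (i := k)]
    have : (0 : ℤ) ≤ (Pi.single i 1 : Fin N → ℤ) k := by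
      rw [Pi.single_apply]; split_ifs <;> simp
    simp only [Pi.sub_apply]
    omega

theorem intCoeff_one_of_ne {w : Fin N → ℤ} (hw : w ≠ 0) :
    intCoeff w (1 : MvPolynomial (Fin N) ℂ) = 0 := by
  by_cases h : 0 ≤ w
  · obtain ⟨a, rfl⟩ := exists_natCast h
    rw [intCoeff_natCast, MvPolynomial.coeff_one, if_neg]
    rintro rfl
    exact hw (by ext; simp)
  · have : ∃ k, w k < 0 := by
      by_contra! h'
      exact h h'
    obtain ⟨k, hk⟩ := this
    exact intCoeff_of_neg hk _

end intCoeff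

namespace AdjPair

variable {N : ℕ}

/-- The height functional on weights. -/
def height (w : Fin N → ℤ) : ℤ := ∑ k, (k.val : ℤ) * w k

theorem height_sub (v w : Fin N → ℤ) : height (v - w) = height v - height w := by
  simp [height, mul_sub]

theorem height_add (v w : Fin N → ℤ) : height (v + w) = height v + height w := by
  simp [height, mul_add, Finset.sum_add_distrib]

theorem height_root (s : AdjPair N) : height s.root = -1 := by
  have := s.lo_hi
  simp only [height, root_apply, mul_sub, mul_ite, mul_one, mul_zero, Finset.sum_sub_distrib,
    Finset.sum_ite_eq', Finset.mem_univ, if_true]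
  omega

theorem height_rootSum (J : List (AdjPair N)) : height (J.map root).sum = -J.length := by
  induction J with
  | nil => simp [height]
  | cons s J ih =>
    rw [List.map_cons, List.sum_cons, height_add, ih, height_root]
    simp

theorem height_nonneg {w : Fin N → ℤ} (h : 0 ≤ w) : 0 ≤ height w :=
  Finset.sum_nonneg fun k _ => mul_nonneg (by simp) (h k)

theorem antitone_of_le {w : Fin N → ℤ} (h : ∀ s : AdjPair N, w s.hi ≤ w s.lo) : Antitone w := by
  have key : ∀ (n : ℕ) (a b : Fin N), a.val + n = b.val → w b ≤ w a := by
    intro n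
    induction n with
    | zero => intro a b hab; rw [show a = b from Fin.ext (by simpa using hab)]
    | succ n ih =>
      intro a b hab
      have hc : a.val + n < N := by omega
      exact (h ⟨(⟨a.val + n, hc⟩, b), by simpa using by omega⟩).trans (ih a _ rfl)
  intro a b hab
  exact key (b.val - a.val) a b (by have : a.val ≤ b.val := hab; omega)

end AdjPair

namespace IsQuantumMatrixAlgebra

variable {N : ℕ} {q : ℂ} {M : Type} [Ring M] [Algebra ℂ M] {x : Fin N → Fin N → M}
  {Δ : M →ₐ[ℂ] M ⊗[ℂ] M} (hM : IsQuantumMatrixAlgebra q x Δ) (hq : q ≠ 0)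
include hM

/-- Restriction to diagonal matrices. -/
def toDiag : M →ₐ[ℂ] MvPolynomial (Fin N) ℂ := hM.diagHom MvPolynomial.X

theorem toDiag_gen (i j : Fin N) : hM.toDiag (x i j) = if i = j then MvPolynomial.X i else 0 :=
  hM.diagHom_gen _ i j

/-- Coefficients of the restriction to diagonal matrices. -/
def diagCoeff (w : Fin N → ℤ) : M →ₗ[ℂ] ℂ := intCoeff w ∘ₗ hM.toDiag.toLinearMap

theorem hasColWt_diagCoeff (w : Fin N → ℤ) : HasColWt x (hM.diagCoeff w) w := by
  intro μ hμ m hm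
  induction hm using colWt_induction generalizing w with
  | zero μ => simp
  | one => simpa [diagCoeff] using intCoeff_one_of_ne hμ.symm
  | add μ a b _ _ ha hb => rw [map_add, ha w hμ, hb w hμ, add_zero]
  | smul μ c a _ ha => rw [map_smul, ha w hμ, smul_zero]
  | gen_mul i j μ m hm ih =>
    simp only [diagCoeff, LinearMap.comp_apply, AlgHom.toLinearMap_apply, map_mul, toDiag_gen]
    split_ifs with h
    · subst h
      rw [intCoeff_X_mul]
      exact ih _ fun h => hμ (by rw [h]; abel)
    · simp

theorem toDiag_rowAct_diagHom (t : Fin N → ℂ) (m : M) :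
    hM.toDiag (rowAct Δ (hM.diagHom t).toLinearMap m) =
      hM.toDiag (colAct Δ (hM.diagHom t).toLinearMap m) := by
  induction m using hM.induction with
  | one => simp [rowAct_algHom_one, colAct_algHom_one]
  | add a b ha hb => simp [ha, hb]
  | smul c a ha => simp [ha]
  | gen_mul i j a ha =>
    rw [rowAct_algHom_mul, colAct_algHom_mul, map_mul, map_mul, ha, rowAct_diagHom_gen,
      colAct_diagHom_gen, map_smul, map_smul, toDiag_gen]
    split_ifs with h
    · rw [h]
    · simp

theorem X_lo_mul_toDiag_lower (s : AdjPair N) (m : M) :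
    MvPolynomial.X s.lo * hM.toDiag (hM.lower hq s m) =
      MvPolynomial.X s.hi * hM.toDiag (hM.rowLower hq s m) := by
  induction m using hM.induction with
  | one => simp [lower_one, rowLower_one]
  | add a b ha hb => simp [mul_add, ha, hb]
  | smul c a ha => simp [ha]
  | gen_mul i j a ha =>
    have h1 : hM.toDiag (rowAct Δ (hM.diagHom fun i => q ^ (-s.root i)).toLinearMap a) =
        hM.toDiag (hM.tor (-1) s a) := by
      rw [toDiag_rowAct_diagHom, tor]
      simp
    have h2 : MvPolynomial.X s.lo * hM.toDiag (hM.lower hq s (x i j)) =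
        MvPolynomial.X s.hi * hM.toDiag (hM.rowLower hq s (x i j)) := by
      rw [lower_gen, rowLower_gen, apply_ite hM.toDiag, apply_ite hM.toDiag, toDiag_gen,
        toDiag_gen, map_zero]
      by_cases hi : i = s.hi <;> by_cases hj : j = s.lo <;> simp [hi, hj, mul_comm]
      simp [Ne.symm hj]
    rw [lower_mul, rowLower_mul, map_add, map_add, map_mul, map_mul, map_mul, map_mul, h1,
      mul_add, mul_add, ← mul_assoc, h2, mul_left_comm, ha]
    ring

theorem diagCoeff_lower (s : AdjPair N) (w : Fin N → ℤ) (m : M) :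
    hM.diagCoeff w (hM.lower hq s m) = hM.diagCoeff (w + s.root) (hM.rowLower hq s m) := by
  have := congrArg (intCoeff (w + Pi.single s.lo 1)) (hM.X_lo_mul_toDiag_lower hq s m)
  rw [intCoeff_X_mul, intCoeff_X_mul, add_sub_cancel_right, add_sub_assoc] at this
  exact this

theorem diagCoeff_rowAct_diagHom (t : Fin N → ℂ) (ht : ∀ i, t i ≠ 0) (w : Fin N → ℤ) (m : M) :
    hM.diagCoeff w (rowAct Δ (hM.diagHom t).toLinearMap m) =
      (∏ j, t j ^ w j) * hM.diagCoeff w m := by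
  rw [← hM.apply_colAct_diagHom (hM.hasColWt_diagCoeff w) t ht]
  simp only [diagCoeff, LinearMap.comp_apply, AlgHom.toLinearMap_apply, toDiag_rowAct_diagHom]

theorem rowAct_raiseList (u : M →ₗ[ℂ] ℂ) (J : List (AdjPair N)) (m : M) :
    rowAct Δ u (hM.raiseList hq J m) = hM.raiseList hq J (rowAct Δ u m) := by
  induction J with
  | nil => rfl
  | cons s J ih => rw [raiseList_cons, raiseList_cons, ← ih]; exact hM.rowAct_colAct _ _ _

theorem rowAct_lowerList (u : M →ₗ[ℂ] ℂ) (J : List (AdjPair N)) (m : M) :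
    rowAct Δ u (hM.lowerList hq J m) = hM.lowerList hq J (rowAct Δ u m) := by
  induction J with
  | nil => rfl
  | cons s J ih => rw [lowerList_cons, lowerList_cons, ← ih]; exact hM.rowAct_colAct _ _ _

theorem apply_eq_zero_of_neg {L : M →ₗ[ℂ] ℂ} {w : Fin N → ℤ} (hL : HasColWt x L w) {k : Fin N}
    (hk : w k < 0) (m : M) : L m = 0 := by
  refine hM.eq_of_colWt (L := L) (L' := 0) (fun μ m hm => ?_) m
  by_cases hμ : μ = w
  · subst hμ
    rw [eq_zero_of_mem_colWt hk hm, map_zero, map_zero]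
  · exact hL μ hμ m hm

theorem hasColWt_diagCoeff_lowerList (w : Fin N → ℤ) (I : List (AdjPair N)) :
    HasColWt x (hM.diagCoeff (w - (I.map AdjPair.root).sum) ∘ₗ hM.lowerList hq I) w := by
  simpa using hM.hasColWt_lowerList hq (hM.hasColWt_diagCoeff (w - (I.map AdjPair.root).sum)) I

variable {f : M}

section Cocommutative

variable (hf : ∀ s, hM.rowLower hq s f = hM.lower hq s f)
include hf

theorem diagCoeff_lowerList_cons (s : AdjPair N) (I J : List (AdjPair N)) (w : Fin N → ℤ) :
    hM.diagCoeff (w - ((s :: I).map AdjPair.root).sum)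
        (hM.lowerList hq (s :: I) (hM.raiseList hq J f)) =
      hM.diagCoeff (w - (I.map AdjPair.root).sum)
        (hM.lowerList hq I (hM.raiseList hq J (hM.lower hq s f))) := by
  rw [lowerList_cons, diagCoeff_lower, rowLower, rowAct_lowerList, rowAct_raiseList, ← rowLower,
    hf, List.map_cons, List.sum_cons]
  congr 2
  abel

theorem diagCoeff_eq_zero_of_not_dominant (hg : IsGeneric q) {w : Fin N → ℤ}
    (hw : ∀ s : AdjPair N, ∀ I J, hM.diagCoeff (w + s.root - (I.map AdjPair.root).sum)
      (hM.lowerList hq I (hM.raiseList hq J f)) = 0)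
    {s : AdjPair N} (hs : w s.lo < w s.hi) : hM.diagCoeff w f = 0 := by
  have rec_ : ∀ k : ℕ, hM.diagCoeff (w - ((List.replicate k s).map AdjPair.root).sum)
      (hM.lowerList hq (List.replicate k s) (hM.raiseList hq (List.replicate k s) f)) = 0 →
      hM.diagCoeff w f = 0 := by
    intro k
    induction k with
    | zero => simp [raiseList, lowerList]
    | succ k ih =>
      intro h
      apply ih
      have h1 := hM.apply_raise_pow_lower hq hg
        (hM.hasColWt_diagCoeff_lowerList hq w (List.replicate k s)) s f k
      have h2 := hM.diagCoeff_lowerList_cons hq hf s (List.replicate k s)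
        (List.replicate (k + 1) s) w
      have h3 := hw s (List.replicate k s ++ [s]) (List.replicate (k + 1) s)
      rw [lowerList_append_singleton, List.map_append, List.sum_append, List.map_singleton,
        List.sum_singleton, add_sub_add_right_eq_sub] at h3
      simp only [LinearMap.comp_apply] at h1
      rw [← h2, ← List.replicate_succ, h, h3, zero_add, eq_comm, mul_eq_zero, mul_eq_zero] at h1
      obtain (h1 | h1) | h1 := h1
      · exact absurd h1 (hg.quantumInt_ne_zero hq (by omega))
      · exact absurd h1 (hg.quantumInt_ne_zero hq (by omega))
      · exact h1
  apply rec_ ((w s.lo).toNat + 1)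
  refine intCoeff_of_neg (i := s.lo) ?_ _
  simp only [List.map_replicate, List.sum_replicate, Pi.sub_apply, Pi.smul_apply, s.root_lo]
  simp

/-- A cocommutative element without dominant diagonal coefficients has vanishing
diagonal matrix coefficients. -/
theorem diagCoeff_lowerList_raiseList_eq_zero (hg : IsGeneric q)
    (hf' : ∀ t : Fin N → ℂ, (∀ i, t i ≠ 0) →
      rowAct Δ (hM.diagHom t).toLinearMap f = colAct Δ (hM.diagHom t).toLinearMap f)
    (hdom : ∀ w : Fin N → ℤ, Antitone w → hM.diagCoeff w f = 0)
    (w : Fin N → ℤ) (I J : List (AdjPair N)) :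
    hM.diagCoeff w (hM.lowerList hq I (hM.raiseList hq J f)) = 0 := by
  have key : ∀ n : ℕ, ∀ w : Fin N → ℤ, AdjPair.height w < n → ∀ I J : List (AdjPair N),
      hM.diagCoeff (w - (I.map AdjPair.root).sum)
        (hM.lowerList hq I (hM.raiseList hq J f)) = 0 := by
    intro n
    induction n with
    | zero =>
      intro w hw I J
      have : ∃ k, w k < 0 := by
        by_contra! h
        exact absurd (AdjPair.height_nonneg h) (not_le.mpr (by exact_mod_cast hw))
      obtain ⟨k, hk⟩ := this
      exact hM.apply_eq_zero_of_neg (hM.hasColWt_diagCoeff_lowerList hq w I) hk _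
    | succ n ih =>
      intro w hw I
      have ih' : ∀ s : AdjPair N, ∀ I J,
          hM.diagCoeff (w + s.root - (I.map AdjPair.root).sum)
            (hM.lowerList hq I (hM.raiseList hq J f)) = 0 := by
        intro s
        apply ih
        rw [AdjPair.height_add, AdjPair.height_root]
        push_cast at hw
        omega
      induction I with
      | cons s I ihI =>
        intro J
        rw [hM.diagCoeff_lowerList_cons hq hf]
        have h1 := hM.apply_raiseList_lower hq hg (hM.hasColWt_diagCoeff_lowerList hq w I)
          (f := f) ihI s J
        have h2 := ih' s (I ++ [s]) J
        rw [lowerList_append_singleton, List.map_append, List.sum_append, List.map_singleton,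
          List.sum_singleton, add_sub_add_right_eq_sub] at h2
        exact h1.trans h2
      | nil =>
        intro J
        simp only [List.map_nil, List.sum_nil, sub_zero, lowerList, LinearMap.id_apply]
        by_cases hJ : J = []
        · subst hJ
          simp only [raiseList, LinearMap.id_apply]
          by_cases ha : Antitone w
          · exact hdom w ha
          · have : ∃ s : AdjPair N, w s.lo < w s.hi := by
              by_contra! h
              exact ha (AdjPair.antitone_of_le h)
            obtain ⟨s, hs⟩ := this
            exact hM.diagCoeff_eq_zero_of_not_dominant hq hf hg ih' hs
        · have h2 : (2 : ℂ) ≠ 0 := two_ne_zero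
          let t : Fin N → ℂ := fun i => 2 ^ (i.val : ℤ)
          have ht : ∀ i, t i ≠ 0 := fun i => zpow_ne_zero _ h2
          have hprod : ∀ v : Fin N → ℤ, ∏ j, t j ^ v j = 2 ^ AdjPair.height v := by
            intro v
            simp only [t, ← zpow_mul, prod_zpow_eq_zpow_sum h2, AdjPair.height]
          have h3 := hM.diagCoeff_rowAct_diagHom t ht w (hM.raiseList hq J f)
          rw [rowAct_raiseList, hf' t ht] at h3
          have h4 := hM.apply_colAct_diagHom
            (hM.hasColWt_raiseList hq (hM.hasColWt_diagCoeff w) J) t ht f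
          simp only [LinearMap.comp_apply] at h4
          rw [h4, hprod, hprod, AdjPair.height_sub, AdjPair.height_rootSum, sub_neg_eq_add,
            zpow_add₀ h2, mul_assoc] at h3
          have h5 := mul_left_cancel₀ (zpow_ne_zero _ h2) h3
          by_contra hne
          have h6 := mul_right_cancel₀ hne (h5.trans (one_mul _).symm)
          rw [zpow_natCast] at h6
          have h7 : 2 ^ J.length = 1 := by exact_mod_cast h6
          have h8 := List.length_pos_of_ne_nil hJ
          exact absurd h7 (Nat.one_lt_two_pow h8.ne').ne'
  have := key ((AdjPair.height (w + (I.map AdjPair.root).sum)).toNat + 1)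
    (w + (I.map AdjPair.root).sum) (by push_cast; omega) I J
  rwa [add_sub_cancel_right] at this

end Cocommutative

end IsQuantumMatrixAlgebra

section OrderedMonomials

variable {B : Type} [Ring B] [Algebra ℂ B] {P : Type}

/-- Ordered monomial along the list `L`. -/
def ordMon (X : P → B) (L : List P) (A : P → ℕ) : B := (L.map fun p => X p ^ A p).prod

/-- The two-sided ideal generated by a set of letters, as a submodule. -/
def letterIdeal (X : P → B) (Z : Set P) : Submodule ℂ B :=
  Submodule.span ℂ {m | ∃ a b, ∃ z ∈ Z, m = a * X z * b}

/-- Ordered monomials avoiding `Z` are independent modulo `V` and the ideal of `Z`. -/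
def IndepMod (X : P → B) (L : List P) (V : Submodule ℂ B) (Z : Set P) : Prop :=
  ∀ c : (P → ℕ) →₀ ℂ, (∀ A, c A ≠ 0 → ∀ z ∈ Z, A z = 0) →
    (c.sum fun A r => r • ordMon X L A) ∈ V ⊔ letterIdeal X Z → c = 0

variable {X : P → B}

omit [Algebra ℂ B] in
theorem ordMon_nil (A : P → ℕ) : ordMon X [] A = 1 := rfl

omit [Algebra ℂ B] in
theorem ordMon_cons (p : P) (L : List P) (A : P → ℕ) :
    ordMon X (p :: L) A = X p ^ A p * ordMon X L A := rfl

omit [Algebra ℂ B] in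
theorem ordMon_append (L L' : List P) (A : P → ℕ) :
    ordMon X (L ++ L') A = ordMon X L A * ordMon X L' A := by
  simp [ordMon]

omit [Algebra ℂ B] in
theorem ordMon_congr {L : List P} {A A' : P → ℕ} (h : ∀ p ∈ L, A p = A' p) :
    ordMon X L A = ordMon X L A' := by
  rw [ordMon, ordMon, List.map_congr_left fun p hp => by rw [h p hp]]

theorem letterIdeal_mono {Z Z' : Set P} (h : Z ⊆ Z') : letterIdeal X Z ≤ letterIdeal X Z' :=
  Submodule.span_mono fun _ ⟨a, b, z, hz, hm⟩ => ⟨a, b, z, h hz, hm⟩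

theorem mem_letterIdeal {Z : Set P} {z : P} (hz : z ∈ Z) (a b : B) :
    a * X z * b ∈ letterIdeal X Z := Submodule.subset_span ⟨a, b, z, hz, rfl⟩

theorem mul_mem_letterIdeal {Z : Set P} (a : B) {m : B} (hm : m ∈ letterIdeal X Z) :
    a * m ∈ letterIdeal X Z := by
  induction hm using Submodule.span_induction with
  | zero => simp
  | add u v _ _ hu hv => rw [mul_add]; exact add_mem hu hv
  | smul r u _ hu => rw [mul_smul_comm]; exact Submodule.smul_mem _ _ hu
  | mem m h =>
    obtain ⟨c, d, z, hz, rfl⟩ := h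
    rw [← mul_assoc, ← mul_assoc]
    exact mem_letterIdeal hz _ _

theorem mul_mem_letterIdeal_right {Z : Set P} (a : B) {m : B} (hm : m ∈ letterIdeal X Z) :
    m * a ∈ letterIdeal X Z := by
  induction hm using Submodule.span_induction with
  | zero => simp
  | add u v _ _ hu hv => rw [add_mul]; exact add_mem hu hv
  | smul r u _ hu => rw [smul_mul_assoc]; exact Submodule.smul_mem _ _ hu
  | mem m h =>
    obtain ⟨c, d, z, hz, rfl⟩ := h
    rw [mul_assoc]
    exact mem_letterIdeal hz _ _

section Kill

variable {D K : B →ₗ[ℂ] B} (hD : ∀ f g, D (f * g) = D f * g + K f * D g)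
  {k : P → ℂ} (hK : ∀ l, K (X l) = k l • X l)
include hD hK

theorem letterIdeal_stable {Z : Set P} (hZ : ∀ z ∈ Z, D (X z) ∈ letterIdeal X Z) {m : B}
    (hm : m ∈ letterIdeal X Z) : D m ∈ letterIdeal X Z := by
  induction hm using Submodule.span_induction with
  | zero => simp
  | add u v _ _ hu hv => rw [map_add]; exact add_mem hu hv
  | smul r u _ hu => rw [map_smul]; exact Submodule.smul_mem _ _ hu
  | mem m h =>
    obtain ⟨a, b, z, hz, rfl⟩ := h
    rw [mul_assoc, hD, hD, hK, mul_add, smul_mul_assoc, mul_smul_comm, ← mul_assoc,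
      ← mul_assoc, ← mul_assoc]
    exact add_mem (mem_letterIdeal hz _ _) (add_mem
      (mul_mem_letterIdeal_right _ (mul_mem_letterIdeal _ (hZ z hz)))
      (Submodule.smul_mem _ _ (mem_letterIdeal hz _ _)))

theorem iterate_pow_mul {l : P} (hl : D (X l) = 0) (a r : ℕ) (h : B) :
    (D ^ r) (X l ^ a * h) = (k l ^ a) ^ r • (X l ^ a * (D ^ r) h) := by
  have h1 : ∀ (a : ℕ) (h : B), D (X l ^ a * h) = k l ^ a • (X l ^ a * D h) := by
    intro a
    induction a with
    | zero => simp
    | succ a ih =>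
      intro h
      rw [pow_succ', mul_assoc, hD, hl, zero_mul, zero_add, hK, ih, smul_mul_smul_comm,
        ← pow_succ', ← mul_assoc, ← pow_succ']
  induction r with
  | zero => simp
  | succ r ih =>
    rw [pow_succ' D, Module.End.mul_apply, ih, map_smul, h1, smul_smul, ← pow_succ,
      Module.End.mul_apply]

theorem iterate_ordMon_mul (hk : ∀ l, k l ≠ 0) (L : List P) (A : P → ℕ)
    (hL : ∀ l ∈ L, A l = 0 ∨ D (X l) = 0) (r : ℕ) :
    ∃ u : ℂ, u ≠ 0 ∧ ∀ h, (D ^ r) (ordMon X L A * h) = u • (ordMon X L A * (D ^ r) h) := by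
  induction L with
  | nil => exact ⟨1, one_ne_zero, by simp [ordMon_nil]⟩
  | cons l L ih =>
    obtain ⟨u, hu, ih⟩ := ih fun l' hl' => hL l' (by simp [hl'])
    obtain h0 | h0 := hL l (by simp)
    · exact ⟨u, hu, by simpa [ordMon_cons, h0] using ih⟩
    · refine ⟨(k l ^ A l) ^ r * u, mul_ne_zero (pow_ne_zero _ (pow_ne_zero _ (hk l))) hu,
        fun h => ?_⟩
      rw [ordMon_cons, mul_assoc, iterate_pow_mul hD hK h0, ih, mul_smul_comm, smul_smul,
        ← mul_assoc]

variable {q : ℂ} (hq : q ≠ 0) (hg : IsGeneric q) {p' p : P} (hp : D (X p) = X p')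
  (hp' : D (X p') = 0) (hkp : k p = q⁻¹) (hkp' : k p' = q)
include hp hp' hkp hkp' hq hg

theorem iterate_letter_mul (r : ℕ) (h : B) :
    (D ^ (r + 1)) (X p * h) = quantumInt q (r + 1) • (X p' * (D ^ r) h) +
      q⁻¹ ^ (r + 1) • (X p * (D ^ (r + 1)) h) := by
  induction r with
  | zero =>
    have : quantumInt q 1 = 1 := by
      simpa [quantumInt_zero] using hg.quantumInt_add_one hq 0
    simp [hD, hK, hp, hkp, this]
  | succ r ih =>
    have h1 : quantumInt q ((r + 1 : ℕ) + 1) =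
        quantumInt q (r + 1) * q + q⁻¹ ^ (r + 1) := by
      rw [hg.quantumInt_add_one hq, inv_pow, ← zpow_natCast, ← zpow_neg]
      push_cast
      ring
    have hD1 : ∀ n : ℕ, D ((D ^ n) h) = (D ^ (n + 1)) h := fun n => by
      rw [pow_succ' D, Module.End.mul_apply]
    rw [pow_succ' D (r + 1), Module.End.mul_apply, ih, map_add, map_smul, map_smul, hD, hD, hp,
      hp', hK, hK, hkp, hkp', h1, hD1, hD1, ← pow_succ' D (r + 1), pow_succ q⁻¹ (r + 1)]
    simp only [zero_mul, zero_add, smul_mul_assoc]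
    module

theorem iterate_letter_pow_mul_mem {Z : Set P} (hpZ : p ∈ Z) (a r : ℕ) (hr : r < a) (h : B) :
    (D ^ r) (X p ^ a * h) ∈ letterIdeal X Z := by
  induction a generalizing r with
  | zero => omega
  | succ a ih =>
    rw [pow_succ', mul_assoc]
    cases r with
    | zero => simpa using mem_letterIdeal hpZ 1 (X p ^ a * h)
    | succ r =>
      rw [iterate_letter_mul hD hK hq hg hp hp' hkp hkp']
      refine add_mem (Submodule.smul_mem _ _ (mul_mem_letterIdeal _ (ih r (by omega))))
        (Submodule.smul_mem _ _ ?_)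
      simpa using mem_letterIdeal hpZ 1 ((D ^ (r + 1)) (X p ^ a * h))

theorem iterate_letter_pow_mul {Z : Set P} (hpZ : p ∈ Z) (a : ℕ) :
    ∃ u : ℂ, u ≠ 0 ∧ ∀ h, (D ^ a) (X p ^ a * h) - u • (X p' ^ a * h) ∈ letterIdeal X Z := by
  induction a with
  | zero => exact ⟨1, one_ne_zero, by simp⟩
  | succ a ih =>
    obtain ⟨u, hu, ih⟩ := ih
    refine ⟨quantumInt q (a + 1) * u,
      mul_ne_zero (hg.quantumInt_ne_zero hq (by omega)) hu, fun h => ?_⟩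
    rw [pow_succ' (X p), mul_assoc, iterate_letter_mul hD hK hq hg hp hp' hkp hkp']
    have h1 := Submodule.smul_mem _ (quantumInt q (a + 1)) (mul_mem_letterIdeal (X p') (ih h))
    have h2 := Submodule.smul_mem (letterIdeal X Z) (q⁻¹ ^ (a + 1))
      (mem_letterIdeal hpZ 1 ((D ^ (a + 1)) (X p ^ a * h)))
    convert add_mem h1 h2 using 1
    rw [one_mul, pow_succ' (X p'), mul_sub, mul_smul_comm, ← mul_assoc]
    module

/-- Moving one letter out of the way with the skew derivation `D`. -/
theorem IndepMod.step (hk : ∀ l, k l ≠ 0) {V : Submodule ℂ B} (hV : ∀ f ∈ V, D f ∈ V)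
    {L L₁ L₂ : List P} (hL : L = L₁ ++ p' :: p :: L₂) (hnd : L.Nodup)
    {Z : Set P} (hZ : ∀ z ∈ Z, D (X z) ∈ letterIdeal X Z) (hpZ' : p' ∉ Z)
    (hL₁ : ∀ l ∈ L₁, l ∈ Z ∨ D (X l) = 0)
    (h : IndepMod X L V (insert p Z)) : IndepMod X L V Z := by
  classical
  intro c hc hmem
  by_contra hne
  have hpp : p' ≠ p := by
    rintro rfl
    rw [hL, List.nodup_append] at hnd
    simpa using hnd.2.1
  obtain ⟨A₀, hA₀, hmin⟩ := Finset.exists_min_image c.support (fun A => A p)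
    (Finsupp.support_nonempty_iff.mpr hne)
  set r := A₀ p with hr
  let shift : (P → ℕ) → (P → ℕ) := fun A =>
    Function.update (Function.update A p 0) p' (A p' + A p)
  have key : ∀ A, c A ≠ 0 → ∃ u : ℂ, (A p = r → u ≠ 0) ∧ (A p ≠ r → u = 0) ∧
      (D ^ r) (ordMon X L A) - u • ordMon X L (shift A) ∈ letterIdeal X (insert p Z) := by
    intro A hA
    obtain ⟨u₁, hu₁, h1⟩ := iterate_ordMon_mul hD hK hk (L₁ ++ [p']) A (by
      intro l hl
      rw [List.mem_append, List.mem_singleton] at hl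
      obtain hl | rfl := hl
      · exact (hL₁ l hl).imp (hc A hA l) id
      · exact Or.inr hp') r
    have hsplit : ordMon X L A = ordMon X (L₁ ++ [p']) A * (X p ^ A p * ordMon X L₂ A) := by
      rw [hL, ordMon_append, ordMon_cons, ordMon_cons, ordMon_append, ordMon_cons, ordMon_nil,
        mul_one, mul_assoc]
    have hle : r ≤ A p := hmin A (by simpa using hA)
    obtain hlt | heq := hle.lt_or_eq
    · refine ⟨0, fun h => absurd h hlt.ne', fun _ => rfl, ?_⟩
      rw [zero_smul, sub_zero, hsplit, h1]
      exact Submodule.smul_mem _ _ (mul_mem_letterIdeal _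
        (iterate_letter_pow_mul_mem hD hK hq hg hp hp' hkp hkp' (by simp) _ _ hlt _))
    · obtain ⟨u₂, hu₂, h2⟩ := iterate_letter_pow_mul hD hK hq hg hp hp' hkp hkp'
        (Z := insert p Z) (by simp) r
      refine ⟨u₁ * u₂, fun _ => mul_ne_zero hu₁ hu₂, fun h => absurd heq.symm h, ?_⟩
      have h3 : ordMon X L (shift A) =
          ordMon X (L₁ ++ [p']) A * (X p' ^ r * ordMon X L₂ A) := by
        rw [hL] at hnd ⊢
        rw [List.nodup_append] at hnd
        obtain ⟨-, h4, h5⟩ := hnd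
        rw [List.nodup_cons, List.nodup_cons] at h4
        have e1 : ordMon X L₁ (shift A) = ordMon X L₁ A := ordMon_congr fun l hl => by
          have n1 : l ≠ p' := h5 l hl p' (by simp)
          have n2 : l ≠ p := h5 l hl p (by simp)
          simp [shift, n1, n2]
        have e2 : ordMon X L₂ (shift A) = ordMon X L₂ A := ordMon_congr fun l hl => by
          have n1 : l ≠ p' := by rintro rfl; simp [hl] at h4
          have n2 : l ≠ p := by rintro rfl; simp [hl] at h4
          simp [shift, n1, n2]
        rw [ordMon_append, ordMon_cons, ordMon_cons, ordMon_append, ordMon_cons, ordMon_nil,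
          e1, e2]
        simp [shift, hpp.symm, pow_add, mul_assoc, heq]
      rw [hsplit, h1, h3, ← heq, mul_smul, ← smul_sub, ← mul_smul_comm, ← mul_sub]
      exact Submodule.smul_mem _ _ (mul_mem_letterIdeal _ (h2 _))
  choose! u hu1 hu2 hu3 using key
  have hDV : ∀ r : ℕ, ∀ f ∈ V, (D ^ r) f ∈ V := by
    intro r
    induction r with
    | zero => simp
    | succ r ih => intro f hf; rw [pow_succ', Module.End.mul_apply]; exact hV _ (ih f hf)
  have hDI : ∀ r : ℕ, ∀ f ∈ letterIdeal X Z, (D ^ r) f ∈ letterIdeal X Z := by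
    intro r
    induction r with
    | zero => simp
    | succ r ih =>
      intro f hf
      rw [pow_succ', Module.End.mul_apply]
      exact letterIdeal_stable hD hK hZ (ih f hf)
  let T := c.support.filter fun A => A p = r
  let c' : (P → ℕ) →₀ ℂ := ∑ A ∈ T, Finsupp.single (shift A) (c A * u A)
  have hinj : ∀ A ∈ T, ∀ A' ∈ T, shift A = shift A' → A = A' := by
    intro A hA A' hA' hAA
    simp only [T, Finset.mem_filter] at hA hA'
    have h1 : ∀ l, l ≠ p → A l = A' l := by
      intro l hl
      by_cases hl' : l = p'
      · subst hl'
        have := congrFun hAA l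
        simp only [shift, Function.update_self, hA.2, hA'.2] at this
        omega
      · have := congrFun hAA l
        simpa [shift, hl, hl'] using this
    ext l
    by_cases hl : l = p
    · rw [hl, hA.2, hA'.2]
    · exact h1 l hl
  have hc'_apply : ∀ A ∈ T, c' (shift A) = c A * u A := by
    intro A hA
    rw [Finsupp.finsetSum_apply, Finset.sum_eq_single A]
    · simp
    · intro A' hA' hne'
      rw [Finsupp.single_apply, if_neg]
      exact fun h => hne' (hinj _ hA' _ hA h)
    · exact fun h => absurd hA h
  have hc'0 : c' = 0 := by
    apply h
    · intro A hA z hz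
      have : ∃ A' ∈ T, shift A' = A := by
        by_contra! hno
        apply hA
        rw [Finsupp.finsetSum_apply]
        refine Finset.sum_eq_zero fun A' hA' => ?_
        rw [Finsupp.single_apply, if_neg (hno A' hA')]
      obtain ⟨A', hA', rfl⟩ := this
      obtain rfl | hz := hz
      · simp [shift, hpp.symm]
      · have n1 : z ≠ p' := by rintro rfl; exact hpZ' hz
        have h4 := hc A' (by simpa using (Finset.mem_filter.mp hA').1) z hz
        by_cases hzp : z = p
        · subst hzp; simp [shift, n1]
        · simp [shift, n1, hzp, h4]
    · have e1 : (c'.sum fun A s => s • ordMon X L A) =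
          ∑ A ∈ c.support, (c A * u A) • ordMon X L (shift A) := by
        rw [← Finsupp.sum_finsetSum_index (by simp) (by simp [add_smul])]
        simp only [Finsupp.sum_single_index, zero_smul]
        rw [Finset.sum_filter]
        refine Finset.sum_congr rfl fun A hA => ?_
        split_ifs with hAr
        · rfl
        · rw [hu2 A (by simpa using hA) hAr, mul_zero, zero_smul]
      have e2 : (D ^ r) (c.sum fun A s => s • ordMon X L A) -
          ∑ A ∈ c.support, (c A * u A) • ordMon X L (shift A) ∈ letterIdeal X (insert p Z) := by
        rw [Finsupp.sum, map_sum, ← Finset.sum_sub_distrib]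
        refine Submodule.sum_mem _ fun A hA => ?_
        rw [map_smul, mul_smul, ← smul_sub]
        exact Submodule.smul_mem _ _ (hu3 A (by simpa using hA))
      rw [e1]
      have e3 : (D ^ r) (c.sum fun A s => s • ordMon X L A) ∈
          V ⊔ letterIdeal X (insert p Z) := by
        obtain ⟨v, hv, m, hm, hvm⟩ := Submodule.mem_sup.mp hmem
        rw [← hvm, map_add]
        exact Submodule.add_mem_sup (hDV r v hv)
          (letterIdeal_mono (Set.subset_insert p Z) (hDI r m hm))
      have := sub_mem e3 (Submodule.mem_sup_right (S := V) e2)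
      rwa [sub_sub_cancel] at this
  have hT : A₀ ∈ T := Finset.mem_filter.mpr ⟨hA₀, rfl⟩
  have h6 := hc'_apply A₀ hT
  rw [hc'0, Finsupp.zero_apply, eq_comm, mul_eq_zero] at h6
  have h7 : c A₀ ≠ 0 := by simpa using hA₀
  exact h6.elim h7 (hu1 A₀ h7 rfl)

end Kill

end OrderedMonomials

theorem List.Pairwise.exists_eq_append_cons_cons {α : Type*} {r : α → α → Prop} {L : List α}
    (hL : L.Pairwise r) (hr : ∀ c d, r c d → ¬ r d c) {a b : α} (ha : a ∈ L) (hb : b ∈ L)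
    (hab : r a b) (hno : ∀ c, ¬ (r a c ∧ r c b)) :
    ∃ L₁ L₂, L = L₁ ++ a :: b :: L₂ ∧ ∀ l ∈ L₁, r l a := by
  obtain ⟨L₁, L', rfl⟩ := List.append_of_mem ha
  rw [List.pairwise_append, List.pairwise_cons] at hL
  obtain ⟨-, ⟨h1, h2⟩, h3⟩ := hL
  have h4 : ∀ l ∈ L₁, r l a := fun l hl => h3 l hl a (by simp)
  have hb' : b ∈ L' := by
    simp only [List.mem_append, List.mem_cons] at hb
    obtain hb | rfl | hb := hb
    · exact absurd (h4 b hb) (hr _ _ hab)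
    · exact absurd hab (hr _ _ hab)
    · exact hb
  cases L' with
  | nil => simp at hb'
  | cons c L₂ =>
    obtain rfl | hb' := List.mem_cons.mp hb'
    · exact ⟨L₁, L₂, rfl, h4⟩
    · exact absurd ⟨h1 c (by simp), List.rel_of_pairwise_cons h2 hb'⟩ (hno c)

/-- The row-major list of all matrix positions. -/
def rowMajor (N : ℕ) : List (Fin N × Fin N) :=
  (List.finRange N).flatMap fun i => (List.finRange N).map fun j => (i, j)

/-- The row-major order on matrix positions. -/
def RowLt {N : ℕ} (a b : Fin N × Fin N) : Prop := a.1 < b.1 ∨ a.1 = b.1 ∧ a.2 < b.2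

section RowMajor

variable {N : ℕ}

theorem mem_rowMajor (p : Fin N × Fin N) : p ∈ rowMajor N := by
  simp [rowMajor]

theorem rowLt_asymm (a b : Fin N × Fin N) (h : RowLt a b) : ¬ RowLt b a := by
  simp only [RowLt] at *
  omega

theorem pairwise_rowMajor : (rowMajor N).Pairwise RowLt := by
  rw [rowMajor, List.pairwise_flatMap]
  constructor
  · intro i _
    rw [List.pairwise_map]
    exact (List.pairwise_lt_finRange N).imp fun h => Or.inr ⟨rfl, h⟩
  · refine (List.pairwise_lt_finRange N).imp fun h => ?_
    intro a ha b hb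
    simp only [List.mem_map, List.mem_finRange, true_and] at ha hb
    obtain ⟨_, rfl⟩ := ha
    obtain ⟨_, rfl⟩ := hb
    exact Or.inl h

theorem nodup_rowMajor : (rowMajor N).Nodup :=
  pairwise_rowMajor.imp fun h => by rintro rfl; exact rowLt_asymm _ _ h h

theorem finProdFinEquiv_lt_iff (a b : Fin N × Fin N) :
    finProdFinEquiv a < finProdFinEquiv b ↔ RowLt a b := by
  obtain ⟨a, a'⟩ := a
  obtain ⟨b, b'⟩ := b
  simp only [RowLt, Fin.lt_def, finProdFinEquiv_apply_val, Fin.ext_iff]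
  have ha := a'.isLt
  have hb := b'.isLt
  rcases lt_trichotomy a.val b.val with h | h | h
  · have := Nat.mul_le_mul_left N h
    rw [Nat.mul_succ] at this
    omega
  · rw [h]; omega
  · have := Nat.mul_le_mul_left N h
    rw [Nat.mul_succ] at this
    omega

end RowMajor

section Independence

variable {B : Type} [Ring B] [Algebra ℂ B] {P : Type} {X : P → B} {L : List P}

theorem IndepMod.mono {V V' : Submodule ℂ B} {Z : Set P} (h : V' ≤ V) (hI : IndepMod X L V Z) :
    IndepMod X L V' Z :=
  fun c hc hmem => hI c hc (sup_le_sup_right h _ hmem)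

theorem IndepMod.of_steps {V : Submodule ℂ B} {n : ℕ} (ρ : P ≃ Fin n) {Z U : Set P}
    (hstep : ∀ p ∈ U, IndepMod X L V (insert p (Z ∪ {z | z ∈ U ∧ ρ z < ρ p})) →
      IndepMod X L V (Z ∪ {z | z ∈ U ∧ ρ z < ρ p})) (h : IndepMod X L V (Z ∪ U)) :
    IndepMod X L V Z := by
  have key : ∀ m : ℕ, IndepMod X L V (Z ∪ {z | z ∈ U ∧ (ρ z).val < m}) → IndepMod X L V Z := by
    intro m
    induction m with
    | zero => intro h; simpa using h
    | succ m ih =>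
      intro h
      apply ih
      by_cases hp : ∃ p ∈ U, (ρ p).val = m
      · obtain ⟨p, hp, rfl⟩ := hp
        refine hstep p hp ?_
        convert h using 1
        ext z
        simp only [Set.mem_insert_iff, Set.mem_union, Set.mem_ofPred_eq, Nat.lt_succ_iff_lt_or_eq,
          Fin.lt_def, ← Fin.ext_iff, ρ.apply_eq_iff_eq]
        constructor
        · rintro (rfl | h | h)
          · exact Or.inr ⟨hp, Or.inr rfl⟩
          · exact Or.inl h
          · exact Or.inr ⟨h.1, Or.inl h.2⟩
        · rintro (h | ⟨h, h' | rfl⟩)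
          · exact Or.inr (Or.inl h)
          · exact Or.inr (Or.inr ⟨h, h'⟩)
          · exact Or.inl rfl
      · convert h using 1
        ext z
        simp only [Set.mem_union, Set.mem_ofPred_eq, Nat.lt_succ_iff_lt_or_eq]
        have : z ∈ U → (ρ z).val ≠ m := fun hz h => hp ⟨z, hz, h⟩
        tauto
  refine key n ?_
  convert h using 2
  ext z
  simp

omit [Algebra ℂ B] in
theorem ordMon_reverse_op (A : P → ℕ) :
    ordMon (fun p => MulOpposite.op (X p)) L.reverse A = MulOpposite.op (ordMon X L A) := by
  induction L with
  | nil => simp [ordMon_nil]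
  | cons p L ih => simp [ordMon_append, ordMon_cons, ordMon_nil, ih]

theorem map_op_letterIdeal (Z : Set P) :
    (letterIdeal X Z).map (MulOpposite.opLinearEquiv ℂ : B ≃ₗ[ℂ] Bᵐᵒᵖ).toLinearMap =
      letterIdeal (fun p => MulOpposite.op (X p)) Z := by
  rw [letterIdeal, letterIdeal, Submodule.map_span]
  congr 1
  ext m
  simp only [Set.mem_image, Set.mem_ofPred_eq]
  constructor
  · rintro ⟨_, ⟨a, b, z, hz, rfl⟩, rfl⟩
    exact ⟨.op b, .op a, z, hz, by simp [mul_assoc]⟩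
  · rintro ⟨a, b, z, hz, rfl⟩
    exact ⟨_, ⟨b.unop, a.unop, z, hz, rfl⟩, by simp [mul_assoc]⟩

theorem indepMod_op_iff {V : Submodule ℂ B} {Z : Set P} :
    IndepMod (fun p => MulOpposite.op (X p)) L.reverse
      (V.map (MulOpposite.opLinearEquiv ℂ : B ≃ₗ[ℂ] Bᵐᵒᵖ).toLinearMap) Z ↔
      IndepMod X L V Z := by
  refine forall_congr' fun c => forall_congr' fun _ => ?_
  rw [← map_op_letterIdeal, ← Submodule.map_sup]
  have : (c.sum fun A r => r • ordMon (fun p => MulOpposite.op (X p)) L.reverse A) =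
      (MulOpposite.opLinearEquiv ℂ : B ≃ₗ[ℂ] Bᵐᵒᵖ).toLinearMap
        (c.sum fun A r => r • ordMon X L A) := by
    simp [Finsupp.sum, ordMon_reverse_op]
  rw [this, LinearEquiv.coe_coe, Submodule.mem_map_equiv, LinearEquiv.symm_apply_apply]

end Independence

section Spanning

variable {N : ℕ} {q : ℂ} {M : Type} [Ring M] [Algebra ℂ M] {x : Fin N → Fin N → M}

theorem IsQuantumMatrix.gen_mul_mem_span (hx : IsQuantumMatrix q x) (hq : q ≠ 0)
    {L : List (Fin N × Fin N)} (hL : L.Pairwise RowLt)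
    (hup : ∀ a ∈ L, ∀ b, RowLt a b → b ∈ L) (p : Fin N × Fin N) (hp : p ∈ L) (v : M)
    (hv : v ∈ Submodule.span ℂ (Set.range (ordMon (fun p : Fin N × Fin N => x p.1 p.2) L))) :
    x p.1 p.2 * v ∈
      Submodule.span ℂ (Set.range (ordMon (fun p : Fin N × Fin N => x p.1 p.2) L)) := by
  set X : Fin N × Fin N → M := fun p => x p.1 p.2 with hX
  have hlin : ∀ (b : M) {L : List (Fin N × Fin N)} {W : Submodule ℂ M},
      (∀ A, b * ordMon X L A ∈ W) → ∀ v ∈ Submodule.span ℂ (Set.range (ordMon X L)),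
      b * v ∈ W := by
    intro b L W h v hv
    induction hv using Submodule.span_induction with
    | mem v hv => obtain ⟨A, rfl⟩ := hv; exact h A
    | zero => simp
    | add u v _ _ hu hv => rw [mul_add]; exact add_mem hu hv
    | smul c u _ hu => rw [mul_smul_comm]; exact Submodule.smul_mem _ _ hu
  change X p * v ∈ _
  induction L generalizing p v with
  | nil => simp at hp
  | cons r L ih =>
    rw [List.pairwise_cons] at hL
    obtain ⟨hr, hL⟩ := hL
    have hrL : r ∉ L := fun h => rowLt_asymm _ _ (hr r h) (hr r h)
    have hupL : ∀ a ∈ L, ∀ b, RowLt a b → b ∈ L := by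
      intro a ha b hb
      obtain rfl | h := List.mem_cons.mp (hup a (by simp [ha]) b hb)
      · exact absurd (hr a ha) (rowLt_asymm _ _ hb)
      · exact h
    have hmem : ∀ b, RowLt r b → b ∈ L := by
      intro b hb
      obtain rfl | h := List.mem_cons.mp (hup r (by simp) b hb)
      · exact absurd hb (rowLt_asymm _ _ hb)
      · exact h
    set W := Submodule.span ℂ (Set.range (ordMon X (r :: L))) with hW
    have hpow : ∀ (a : ℕ) (v : M), v ∈ Submodule.span ℂ (Set.range (ordMon X L)) →
        X r ^ a * v ∈ W := by
      intro a
      refine hlin _ fun A => Submodule.subset_span ⟨Function.update A r a, ?_⟩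
      rw [ordMon_cons, Function.update_self]
      congr 1
      exact ordMon_congr fun l hl => Function.update_of_ne (by rintro rfl; exact hrL hl) _ _
    have hself : ∀ v ∈ W, X r * v ∈ W := by
      refine hlin _ fun A => ?_
      rw [ordMon_cons, ← mul_assoc, ← pow_succ']
      exact hpow _ _ (Submodule.subset_span ⟨A, rfl⟩)
    have hcomm : ∀ b, RowLt r b → ∀ c : ℂ, X b * X r = c • (X r * X b) →
        ∀ v ∈ W, X b * v ∈ W := by
      intro b hb c hc
      refine hlin _ fun A => ?_
      have h1 : ∀ a : ℕ, X b * X r ^ a = c ^ a • (X r ^ a * X b) := by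
        intro a
        induction a with
        | zero => simp
        | succ a iha =>
          rw [pow_succ, ← mul_assoc, iha, smul_mul_assoc, mul_assoc, hc, mul_smul_comm, smul_smul,
            ← pow_succ, mul_assoc]
      rw [ordMon_cons, ← mul_assoc, h1, smul_mul_assoc, mul_assoc]
      exact Submodule.smul_mem _ _ (hpow _ _
        (ih hL hupL b (hmem b hb) _ (Submodule.subset_span ⟨A, rfl⟩)))
    obtain rfl | hpL := List.mem_cons.mp hp
    · exact hself v hv
    have hinv : ∀ a b : M, a = q • b → b = q⁻¹ • a := fun a b h => by
      rw [h, smul_smul, inv_mul_cancel₀ hq, one_smul]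
    obtain h | ⟨h, h'⟩ := hr p hpL
    · rcases lt_trichotomy r.2 p.2 with h' | h' | h'
      · have hst : X p * X r = X r * X p -
            (q - q⁻¹) • (X (r.1, p.2) * X (p.1, r.2)) := by
          rw [← hx.diag r.1 p.1 r.2 p.2 h h']
          simp [hX]
        have hall : ∀ a : ℕ, ∀ v ∈ Submodule.span ℂ (Set.range (ordMon X L)),
            X p * (X r ^ a * v) ∈ W := by
          intro a v hv
          induction a with
          | zero => simpa using hpow 0 _ (ih hL hupL p hpL v hv)
          | succ a iha =>
            rw [pow_succ', mul_assoc, ← mul_assoc, hst, sub_mul, smul_mul_assoc, mul_assoc,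
              mul_assoc]
            refine sub_mem (hself _ iha) (Submodule.smul_mem _ _ ?_)
            refine hcomm (r.1, p.2) (Or.inr ⟨rfl, h'⟩) q⁻¹
              (hinv _ _ (hx.row r.1 r.2 p.2 h')) _ ?_
            exact hcomm (p.1, r.2) (Or.inl h) q⁻¹ (hinv _ _ (hx.col r.1 p.1 r.2 h)) _
              (hpow _ _ hv)
        refine hlin (X p) (fun A => ?_) v hv
        rw [ordMon_cons]
        exact hall _ _ (Submodule.subset_span ⟨A, rfl⟩)
      · refine hcomm p (Or.inl h) q⁻¹ (hinv _ _ ?_) v hv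
        simpa [hX, h'] using hx.col r.1 p.1 r.2 h
      · refine hcomm p (Or.inl h) 1 ?_ v hv
        rw [one_smul]
        exact (hx.anti r.1 p.1 p.2 r.2 h h').symm
    · refine hcomm p (Or.inr ⟨h, h'⟩) q⁻¹ (hinv _ _ ?_) v hv
      simpa [hX, h] using hx.row r.1 r.2 p.2 h'

theorem IsQuantumMatrixAlgebra.span_ordMon {Δ : M →ₐ[ℂ] M ⊗[ℂ] M}
    (hM : IsQuantumMatrixAlgebra q x Δ) (hq : q ≠ 0) :
    Submodule.span ℂ
      (Set.range (ordMon (fun p : Fin N × Fin N => x p.1 p.2) (rowMajor N))) = ⊤ := by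
  rw [eq_top_iff]
  intro m _
  induction m using hM.induction with
  | one => exact Submodule.subset_span ⟨0, by simp [ordMon]⟩
  | add a b ha hb => exact add_mem (ha trivial) (hb trivial)
  | smul c a ha => exact Submodule.smul_mem _ _ (ha trivial)
  | gen_mul i j a ha =>
    exact hM.toIsQuantumMatrix.gen_mul_mem_span hq pairwise_rowMajor
      (fun _ _ b _ => mem_rowMajor b) (i, j) (mem_rowMajor _) a (ha trivial)

end Spanning

namespace IsQuantumMatrixAlgebra

variable {N : ℕ} {q : ℂ} {M : Type} [Ring M] [Algebra ℂ M] {x : Fin N → Fin N → M}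
  {Δ : M →ₐ[ℂ] M ⊗[ℂ] M} (hM : IsQuantumMatrixAlgebra q x Δ) (hq : q ≠ 0)
include hM hq

theorem raiseList_append_singleton (I : List (AdjPair N)) (s : AdjPair N) (m : M) :
    hM.raiseList hq (I ++ [s]) m = hM.raiseList hq I (hM.raise hq s m) := by
  induction I with
  | nil => rfl
  | cons a I ih => rw [List.cons_append, raiseList_cons, ih]; rfl

/-- Elements all of whose lowered diagonal coefficients vanish. -/
def lowerNull : Submodule ℂ M where
  carrier := {f | ∀ I w, hM.diagCoeff w (hM.lowerList hq I f) = 0}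
  add_mem' ha hb I w := by rw [map_add, map_add, ha, hb, add_zero]
  zero_mem' I w := by rw [map_zero, map_zero]
  smul_mem' c a ha I w := by rw [map_smul, map_smul, ha, smul_zero]

/-- Elements all of whose raised and then lowered diagonal coefficients vanish. -/
def raiseLowerNull : Submodule ℂ M where
  carrier := {f | ∀ J, hM.raiseList hq J f ∈ hM.lowerNull hq}
  add_mem' ha hb J := by rw [map_add]; exact add_mem (ha J) (hb J)
  zero_mem' J := by rw [map_zero]; exact zero_mem _
  smul_mem' c a ha J := by rw [map_smul]; exact Submodule.smul_mem _ _ (ha J)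

theorem raiseLowerNull_le : hM.raiseLowerNull hq ≤ hM.lowerNull hq := fun _ hf => hf []

theorem lower_mem_lowerNull (s : AdjPair N) {f : M} (hf : f ∈ hM.lowerNull hq) :
    hM.lower hq s f ∈ hM.lowerNull hq := fun I w => by
  rw [← lowerList_append_singleton]; exact hf _ w

theorem raise_mem_raiseLowerNull (s : AdjPair N) {f : M} (hf : f ∈ hM.raiseLowerNull hq) :
    hM.raise hq s f ∈ hM.raiseLowerNull hq := fun J => by
  rw [← raiseList_append_singleton]; exact hf _

omit hq in
theorem toDiag_ordMon {A : Fin N × Fin N → ℕ} (hA : ∀ z : Fin N × Fin N, z.1 ≠ z.2 → A z = 0) :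
    hM.toDiag (ordMon (fun p : Fin N × Fin N => x p.1 p.2) (rowMajor N) A) =
      MvPolynomial.monomial (Finsupp.equivFunOnFinite.symm fun i => A (i, i)) 1 := by
  have h1 : ∀ p : Fin N × Fin N, hM.toDiag (x p.1 p.2 ^ A p) =
      if p.1 = p.2 then MvPolynomial.X p.1 ^ A (p.1, p.1) else 1 := by
    rintro ⟨i, j⟩
    by_cases h : i = j
    · subst h; simp [toDiag_gen]
    · simp [h, hA (i, j) h]
  rw [ordMon, map_list_prod, List.map_map]
  simp only [Function.comp_def, h1]
  rw [← List.prod_toFinset _ nodup_rowMajor]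
  have h2 : (rowMajor N).toFinset = Finset.univ := by
    ext p; simp [mem_rowMajor]
  rw [h2, Fintype.prod_prod_type, MvPolynomial.monomial_eq]
  simp [Finsupp.prod_fintype]

theorem indepMod_diag : IndepMod (fun p : Fin N × Fin N => x p.1 p.2) (rowMajor N)
    (hM.lowerNull hq) {z | z.1 ≠ z.2} := by
  intro c hc hmem
  have hker : hM.lowerNull hq ⊔ letterIdeal (fun p : Fin N × Fin N => x p.1 p.2) {z | z.1 ≠ z.2} ≤
      LinearMap.ker hM.toDiag.toLinearMap := by
    refine sup_le (fun f hf => ?_) (Submodule.span_le.mpr ?_)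
    · rw [LinearMap.mem_ker]
      ext a
      have := hf [] (fun i => a i)
      simpa [diagCoeff, lowerList, intCoeff_natCast] using this
    · rintro _ ⟨a, b, z, hz, rfl⟩
      have : z.1 ≠ z.2 := hz
      simp [toDiag_gen, this]
  have h0 := hker hmem
  rw [LinearMap.mem_ker, AlgHom.toLinearMap_apply, Finsupp.sum, map_sum] at h0
  by_contra hne
  obtain ⟨A₀, hA₀⟩ := Finsupp.support_nonempty_iff.mpr hne
  have h1 : ∀ A ∈ c.support, hM.toDiag
      (c A • ordMon (fun p : Fin N × Fin N => x p.1 p.2) (rowMajor N) A) =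
      MvPolynomial.monomial (Finsupp.equivFunOnFinite.symm fun i => A (i, i)) (c A) := by
    intro A hA
    rw [map_smul, hM.toDiag_ordMon (hc A (by simpa using hA)), MvPolynomial.smul_monomial,
      smul_eq_mul, mul_one]
  rw [Finset.sum_congr rfl h1] at h0
  have h2 := congrArg (MvPolynomial.coeff
    (Finsupp.equivFunOnFinite.symm fun i => A₀ (i, i))) h0
  rw [MvPolynomial.coeff_sum, Finset.sum_eq_single A₀] at h2
  · rw [MvPolynomial.coeff_monomial, if_pos rfl, MvPolynomial.coeff_zero] at h2
    simp [h2] at hA₀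
  · intro A hA hne'
    rw [MvPolynomial.coeff_monomial, if_neg]
    intro h
    apply hne'
    funext ⟨i, j⟩
    by_cases hij : i = j
    · subst hij
      exact congrFun (Finsupp.equivFunOnFinite.symm.injective h) i
    · rw [hc A (by simpa using hA) (i, j) hij, hc A₀ (by simpa using hA₀) (i, j) hij]
  · exact fun h => absurd hA₀ h

variable (hg : IsGeneric q)
include hg

theorem indepMod_upper : IndepMod (fun p : Fin N × Fin N => x p.1 p.2) (rowMajor N)
    (hM.lowerNull hq) {z | z.1 < z.2} := by
  have hbase := hM.indepMod_diag hq
  have hset : {z : Fin N × Fin N | z.1 ≠ z.2} = {z | z.1 < z.2} ∪ {z | z.2 < z.1} := by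
    ext z; simp
  rw [hset, ← indepMod_op_iff] at hbase
  rw [← indepMod_op_iff]
  set ρ : Fin N × Fin N ≃ Fin (N * N) :=
    (Fin.revPerm.prodCongr (Equiv.refl _)).trans finProdFinEquiv with hρ
  have hlt : ∀ a b, ρ a < ρ b ↔ b.1 < a.1 ∨ a.1 = b.1 ∧ a.2 < b.2 := by
    intro a b
    simp [hρ, finProdFinEquiv_lt_iff, RowLt]
  have hop : ∀ (g : M →ₗ[ℂ] M) (m : M), ((MulOpposite.opLinearEquiv ℂ).conj g) (MulOpposite.op m) =
      MulOpposite.op (g m) := fun _ _ => rfl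
  refine hbase.of_steps ρ fun p hp h => ?_
  have hpN : p.2.val + 1 < N := lt_of_le_of_lt (Nat.succ_le_of_lt hp) p.1.isLt
  let s : AdjPair N := ⟨(p.2, ⟨p.2.val + 1, hpN⟩), rfl⟩
  have hlo : s.lo = p.2 := rfl
  have hhi : s.hi.val = p.2.val + 1 := rfl
  have hp2 : p.2 < p.1 := hp
  have hne : p.2 ≠ s.hi := s.lo_ne_hi
  obtain ⟨L₁, L₂, hL, hL₁⟩ := (List.pairwise_reverse.mpr (pairwise_rowMajor (N := N)))
    |>.exists_eq_append_cons_cons (fun c d => rowLt_asymm d c) (a := (p.1, s.hi)) (b := p)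
    (by simp [mem_rowMajor]) (by simp [mem_rowMajor]) (Or.inr ⟨rfl, by simp [Fin.lt_def, hhi]⟩)
    (by
      rintro c ⟨hc, hc'⟩
      simp only [RowLt, Fin.lt_def, Fin.ext_iff, hhi] at hc hc'
      omega)
  have hgen : ∀ z : Fin N × Fin N, ((MulOpposite.opLinearEquiv ℂ).conj (hM.lower hq s))
      (MulOpposite.op (x z.1 z.2)) =
      if z.2 = p.2 then MulOpposite.op (x z.1 s.hi) else 0 := by
    intro z
    rw [hop, lower_gen, hlo]
    split_ifs <;> simp
  refine h.step (D := (MulOpposite.opLinearEquiv ℂ).conj (hM.lower hq s))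
    (K := (MulOpposite.opLinearEquiv ℂ).conj (hM.tor (-1) s))
    (k := fun z => q ^ (-1 * s.root z.2)) (p' := (p.1, s.hi)) (p := p) (L₁ := L₁) (L₂ := L₂)
    ?_ ?_ hq hg ?_ ?_ ?_ ?_ ?_ ?_ hL (List.nodup_reverse.mpr nodup_rowMajor) ?_ ?_ ?_
  · intro f g
    induction f using MulOpposite.rec'
    induction g using MulOpposite.rec'
    simp only [← MulOpposite.op_mul, hop, ← MulOpposite.op_add, lower_mul]
    rw [add_comm]
  · intro l
    rw [hop, tor_gen, MulOpposite.op_smul]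
  · simp [hgen]
  · exact (hgen (p.1, s.hi)).trans (if_neg hne.symm)
  · rw [← hlo, s.root_lo]; simp
  · simp only [s.root_hi]; simp
  · intro l
    exact zpow_ne_zero _ hq
  · rintro _ ⟨m, hm, rfl⟩
    exact ⟨_, hM.lower_mem_lowerNull hq s hm, rfl⟩
  · intro z hz
    rw [hgen]
    split_ifs with hz2
    · have := mem_letterIdeal (X := fun p : Fin N × Fin N => MulOpposite.op (x p.1 p.2))
        (Z := {z | z.1 < z.2} ∪ {z | z ∈ {z | z.2 < z.1} ∧ ρ z < ρ p}) (z := (z.1, s.hi)) ?_ 1 1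
      · simpa using this
      · simp only [Set.mem_union, Set.mem_ofPred_eq, hlt] at hz ⊢
        simp only [Fin.lt_def, Fin.ext_iff, hhi] at hz hz2 ⊢
        omega
    · exact zero_mem _
  · simp only [Set.mem_union, Set.mem_ofPred_eq, hlt, not_or, not_and]
    simp only [Fin.lt_def, hhi] at hp2 ⊢
    omega
  · intro l hl
    rw [hgen]
    split_ifs with hz2
    · left
      have := hL₁ l hl
      simp only [Set.mem_union, Set.mem_ofPred_eq, hlt, RowLt] at this ⊢
      simp only [Fin.lt_def, Fin.ext_iff, hhi] at this hz2 hp2 ⊢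
      omega
    · exact Or.inr rfl

theorem indepMod_empty : IndepMod (fun p : Fin N × Fin N => x p.1 p.2) (rowMajor N)
    (hM.raiseLowerNull hq) ∅ := by
  have hbase := (hM.indepMod_upper hq hg).mono (hM.raiseLowerNull_le hq)
  rw [← Set.empty_union {z : Fin N × Fin N | z.1 < z.2}] at hbase
  set ρ : Fin N × Fin N ≃ Fin (N * N) :=
    ((Equiv.refl _).prodCongr Fin.revPerm).trans finProdFinEquiv with hρ
  have hlt : ∀ a b, ρ a < ρ b ↔ a.1 < b.1 ∨ a.1 = b.1 ∧ b.2 < a.2 := by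
    intro a b
    simp [hρ, finProdFinEquiv_lt_iff, RowLt]
  refine hbase.of_steps ρ fun p hp h => ?_
  have hp2 : p.1 < p.2 := hp
  have hpN : p.2.val - 1 + 1 = p.2.val := Nat.sub_add_cancel (by rw [Fin.lt_def] at hp2; omega)
  let s : AdjPair N := ⟨(⟨p.2.val - 1, by omega⟩, p.2), hpN⟩
  have hhi : s.hi = p.2 := rfl
  have hlo : s.lo.val + 1 = p.2.val := hpN
  have hne : s.lo ≠ p.2 := s.lo_ne_hi
  obtain ⟨L₁, L₂, hL, hL₁⟩ := (pairwise_rowMajor (N := N))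
    |>.exists_eq_append_cons_cons rowLt_asymm (a := (p.1, s.lo)) (b := p)
    (by simp [mem_rowMajor]) (by simp [mem_rowMajor])
    (Or.inr ⟨rfl, by simp [Fin.lt_def, ← hlo]⟩)
    (by
      rintro c ⟨hc, hc'⟩
      simp only [RowLt, Fin.lt_def, Fin.ext_iff] at hc hc'
      omega)
  have hgen : ∀ z : Fin N × Fin N, hM.raise hq s (x z.1 z.2) =
      if z.2 = p.2 then x z.1 s.lo else 0 := fun z => by rw [raise_gen, hhi]
  refine h.step (D := hM.raise hq s) (K := hM.tor 1 s)
    (k := fun z => q ^ (1 * s.root z.2)) (p' := (p.1, s.lo)) (p := p) (L₁ := L₁) (L₂ := L₂)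
    (hM.raise_mul hq s) ?_ hq hg ?_ ?_ ?_ ?_ ?_ ?_ hL nodup_rowMajor ?_ ?_ ?_
  · intro l
    rw [tor_gen]
  · simp [hgen]
  · exact (hgen (p.1, s.lo)).trans (if_neg hne)
  · rw [← hhi, s.root_hi]; simp
  · simp only [s.root_lo]; simp
  · intro l
    exact zpow_ne_zero _ hq
  · exact fun f hf => hM.raise_mem_raiseLowerNull hq s hf
  · intro z hz
    rw [hgen]
    split_ifs with hz2
    · have := mem_letterIdeal (X := fun p : Fin N × Fin N => x p.1 p.2)
        (Z := ∅ ∪ {z | z ∈ {z | z.1 < z.2} ∧ ρ z < ρ p}) (z := (z.1, s.lo)) ?_ 1 1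
      · simpa using this
      · simp only [Set.empty_union, Set.mem_ofPred_eq, hlt] at hz ⊢
        simp only [Fin.lt_def, Fin.ext_iff] at hp2 hz hz2 ⊢
        omega
    · exact zero_mem _
  · simp only [Set.empty_union, Set.mem_ofPred_eq, hlt, not_or, not_and]
    simp only [Fin.lt_def] at hp2 ⊢
    omega
  · intro l hl
    rw [hgen]
    split_ifs with hz2
    · left
      have := hL₁ l hl
      simp only [Set.empty_union, Set.mem_ofPred_eq, hlt, RowLt] at this ⊢
      simp only [Fin.lt_def, Fin.ext_iff] at this hz2 hp2 ⊢
      omega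
    · exact Or.inr rfl

theorem raiseLowerNull_eq_bot : hM.raiseLowerNull hq = ⊥ := by
  rw [eq_bot_iff]
  intro f hf
  obtain ⟨c, rfl⟩ := Finsupp.mem_span_range_iff_exists_finsupp.mp
    ((hM.span_ordMon hq).ge (Submodule.mem_top (x := f)))
  have := hM.indepMod_empty hq hg c (by simp) (Submodule.mem_sup_left hf)
  simp [this]

end IsQuantumMatrixAlgebra

/-- `G` is the localization of the quantum matrix algebra `M` at the quantum determinant,
with its Hopf algebra structure. -/
structure IsQuantumGL {N : ℕ} (q : ℂ) {M G : Type} [Ring M] [Algebra ℂ M] [Ring G] [Algebra ℂ G]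
    (x : Fin N → Fin N → M) (Δ : M →ₐ[ℂ] M ⊗[ℂ] M) (ι : M →ₐ[ℂ] G) (ΔG : G →ₐ[ℂ] G ⊗[ℂ] G)
    (εG : G →ₐ[ℂ] ℂ) (St : G →ₗ[ℂ] G) : Prop extends IsQuantumMatrixAlgebra q x Δ where
  isUnit : IsUnit (ι (qdet q x))
  extend : ∀ (B : Type) [Ring B] [Algebra ℂ B] (φ : M →ₐ[ℂ] B), IsUnit (φ (qdet q x)) →
    ∃! ψ : G →ₐ[ℂ] B, ψ.comp ι = φ
  comul_algebraMap : ∀ m, ΔG (ι m) = Algebra.TensorProduct.map ι ι (Δ m)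
  counit_gen : ∀ i j, εG (ι (x i j)) = if i = j then 1 else 0
  antipode_left : LinearMap.mul' ℂ G ∘ₗ TensorProduct.map St LinearMap.id ∘ₗ ΔG.toLinearMap
      = Algebra.linearMap ℂ G ∘ₗ εG.toLinearMap
  antipode_right : LinearMap.mul' ℂ G ∘ₗ TensorProduct.map LinearMap.id St ∘ₗ ΔG.toLinearMap
      = Algebra.linearMap ℂ G ∘ₗ εG.toLinearMap

namespace IsQuantumGL

variable {N : ℕ} {q : ℂ} {M G : Type} [Ring M] [Algebra ℂ M] [Ring G] [Algebra ℂ G]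
  {x : Fin N → Fin N → M} {Δ : M →ₐ[ℂ] M ⊗[ℂ] M} {ι : M →ₐ[ℂ] G} {ΔG : G →ₐ[ℂ] G ⊗[ℂ] G}
  {εG : G →ₐ[ℂ] ℂ} {St : G →ₗ[ℂ] G} (hG : IsQuantumGL q x Δ ι ΔG εG St)
include hG

theorem algHom_ext_gen {B : Type} [Ring B] [Algebra ℂ B] {ψ ψ' : G →ₐ[ℂ] B}
    (h : ∀ i j, ψ (ι (x i j)) = ψ' (ι (x i j))) : ψ = ψ' :=
  (hG.extend B (ψ.comp ι) (hG.isUnit.map ψ)).unique rfl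
    (AlgHom.ext fun m => (hG.algHom_ext (φ := ψ.comp ι) (ψ := ψ'.comp ι) h m).symm)

theorem comul_gen (i j : Fin N) : ΔG (ι (x i j)) = ∑ k, ι (x i k) ⊗ₜ[ℂ] ι (x k j) := by
  simp [hG.comul_algebraMap, hG.comul]

/-- The Hopf algebra structure on `G`. -/
abbrev hopfAlgebra : HopfAlgebra ℂ G :=
  { __ := Bialgebra.ofAlgHom ΔG εG
      (hG.algHom_ext_gen fun i j => by
        simp only [AlgHom.comp_apply, hG.comul_gen, map_sum, Algebra.TensorProduct.map_tmul,
          AlgHom.id_apply, TensorProduct.sum_tmul, TensorProduct.tmul_sum]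
        exact Finset.sum_comm)
      (hG.algHom_ext_gen fun i j => by
        simp [hG.comul_gen, hG.counit_gen, TensorProduct.ite_tmul])
      (hG.algHom_ext_gen fun i j => by
        simp [hG.comul_gen, hG.counit_gen, TensorProduct.tmul_ite])
    antipode := St
    mul_antipode_rTensor_comul := hG.antipode_left
    mul_antipode_lTensor_comul := hG.antipode_right }

theorem antipode_mul (a b : G) : St (a * b) = St b * St a :=
  letI := hG.hopfAlgebra
  HopfAlgebra.antipode_mul_antidistrib (R := ℂ) a b

theorem antipode_one : St 1 = 1 :=
  letI := hG.hopfAlgebra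
  HopfAlgebra.antipode_one (R := ℂ)

theorem counit_tmul (m : M) :
    TensorProduct.map (εG.comp ι).toLinearMap LinearMap.id (Δ m) = (1 : ℂ) ⊗ₜ[ℂ] m := by
  have := hG.algHom_ext (φ := (Algebra.TensorProduct.map (εG.comp ι) (.id ℂ M)).comp Δ)
    (ψ := Algebra.TensorProduct.includeRight)
    (fun i j => by
      simp [hG.comul, hG.counit_gen, TensorProduct.ite_tmul]) m
  exact this

end IsQuantumGL

section Coaction

variable {M G : Type} [Ring M] [Algebra ℂ M] [Ring G] [Algebra ℂ G]

/-- The map `a ⊗ b ⊗ c ↦ b ⊗ cS(a)`. -/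
def twist (ι : M →ₐ[ℂ] G) (St : G →ₗ[ℂ] G) : (M ⊗[ℂ] M) ⊗[ℂ] M →ₗ[ℂ] M ⊗[ℂ] G :=
  TensorProduct.map LinearMap.id (LinearMap.mul' ℂ G) ∘ₗ
  TensorProduct.map LinearMap.id (TensorProduct.comm ℂ G G).toLinearMap ∘ₗ
  (TensorProduct.assoc ℂ M G G).toLinearMap ∘ₗ
  TensorProduct.map
    ((TensorProduct.comm ℂ G M).toLinearMap ∘ₗ
      TensorProduct.map (St ∘ₗ ι.toLinearMap) LinearMap.id)
    ι.toLinearMap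

theorem twist_tmul (ι : M →ₐ[ℂ] G) (St : G →ₗ[ℂ] G) (a b c : M) :
    twist ι St ((a ⊗ₜ b) ⊗ₜ c) = b ⊗ₜ (ι c * St (ι a)) := by
  simp [twist]

theorem adjAlpha_apply (Δ : M →ₐ[ℂ] M ⊗[ℂ] M) (ι : M →ₐ[ℂ] G) (St : G →ₗ[ℂ] G) (f : M) :
    adjAlpha Δ ι St f = twist ι St (Algebra.TensorProduct.map Δ (.id ℂ M) (Δ f)) := rfl

end Coaction

namespace IsQuantumGL

variable {N : ℕ} {q : ℂ} {M G : Type} [Ring M] [Algebra ℂ M] [Ring G] [Algebra ℂ G]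
  {x : Fin N → Fin N → M} {Δ : M →ₐ[ℂ] M ⊗[ℂ] M} {ι : M →ₐ[ℂ] G} {ΔG : G →ₐ[ℂ] G ⊗[ℂ] G}
  {εG : G →ₐ[ℂ] ℂ} {St : G →ₗ[ℂ] G} (hG : IsQuantumGL q x Δ ι ΔG εG St)
include hG

theorem twist_mul (a b c : M) (Y : (M ⊗[ℂ] M) ⊗[ℂ] M) :
    twist ι St ((a ⊗ₜ b) ⊗ₜ c * Y) = (b ⊗ₜ ι c) * twist ι St Y * (1 ⊗ₜ St (ι a)) := by
  induction Y with
  | zero => simp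
  | add u v hu hv => rw [mul_add, map_add, map_add, hu, hv, mul_add, add_mul]
  | tmul u c' =>
    induction u with
    | zero => simp
    | add u v hu hv =>
      rw [TensorProduct.add_tmul, mul_add, map_add, map_add, hu, hv, mul_add, add_mul]
    | tmul a' b' => simp [twist_tmul, hG.antipode_mul, mul_assoc]

theorem adjAlpha_mul {f : M} (hf : adjAlpha Δ ι St f = f ⊗ₜ 1) (h : M) :
    adjAlpha Δ ι St (h * f) = adjAlpha Δ ι St h * f ⊗ₜ 1 := by
  rw [adjAlpha_apply, map_mul, map_mul, adjAlpha_apply]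
  rw [adjAlpha_apply] at hf
  generalize Algebra.TensorProduct.map Δ (.id ℂ M) (Δ h) = X
  induction X with
  | zero => simp
  | add u v hu hv => rw [add_mul, map_add, map_add, hu, hv, add_mul]
  | tmul u c =>
    induction u with
    | zero => simp
    | add u v hu hv => rw [TensorProduct.add_tmul, add_mul, map_add, map_add, hu, hv, add_mul]
    | tmul a b => simp [hG.twist_mul, hf, twist_tmul]

theorem adjAlpha_one : adjAlpha Δ ι St (1 : M) = 1 ⊗ₜ 1 := by
  rw [adjAlpha_apply, map_one, map_one]
  change twist ι St (((1 : M) ⊗ₜ (1 : M)) ⊗ₜ (1 : M)) = _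
  simp [twist_tmul, hG.antipode_one]

/-- The subalgebra of coinvariants. -/
def coinvariants : Subalgebra ℂ M where
  carrier := {f | adjAlpha Δ ι St f = f ⊗ₜ 1}
  mul_mem' {a b} ha hb := by
    simp only [Set.mem_ofPred_eq] at *
    rw [hG.adjAlpha_mul hb, ha]
    simp
  add_mem' {a b} ha hb := by
    simp only [Set.mem_ofPred_eq] at *
    rw [map_add, ha, hb, TensorProduct.add_tmul]
  algebraMap_mem' c := by
    simp only [Set.mem_ofPred_eq]
    rw [Algebra.algebraMap_eq_smul_one, map_smul, hG.adjAlpha_one, TensorProduct.smul_tmul']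

theorem mem_coinvariants {f : M} : f ∈ hG.coinvariants ↔ adjAlpha Δ ι St f = f ⊗ₜ 1 := Iff.rfl

theorem coorbit_mul {f : M} (hf : f ∈ hG.coinvariants) (e : M →ₐ[ℂ] ℂ) (h : M) :
    coorbit e (adjAlpha Δ ι St) (h * (f - algebraMap ℂ M (e f))) = 0 := by
  have h1 : ∀ Y : M ⊗[ℂ] G, TensorProduct.map e.toLinearMap LinearMap.id (Y * f ⊗ₜ[ℂ] (1 : G)) =
      e f • TensorProduct.map e.toLinearMap LinearMap.id Y := by
    intro Y
    induction Y with
    | zero => simp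
    | add u v hu hv => rw [add_mul, map_add, map_add, hu, hv, smul_add]
    | tmul a b => simp [mul_comm, TensorProduct.smul_tmul']
  rw [mul_sub, Algebra.algebraMap_eq_smul_one, mul_smul_comm, mul_one, map_sub, map_smul,
    sub_eq_zero]
  simp only [coorbit, LinearMap.comp_apply, hG.adjAlpha_mul hf, h1, map_smul]

/-- Coinvariants are cocommutative. -/
theorem cocommutative {f : M} (hf : f ∈ hG.coinvariants) :
    Algebra.TensorProduct.map ι (.id ℂ M) (Δ f) =
      Algebra.TensorProduct.map ι (.id ℂ M) (TensorProduct.comm ℂ M M (Δ f)) := by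
  let Φ : (M ⊗[ℂ] M) ⊗[ℂ] M →ₗ[ℂ] G ⊗[ℂ] M := TensorProduct.map
    (LinearMap.mul' ℂ G ∘ₗ TensorProduct.map (St ∘ₗ ι.toLinearMap) ι.toLinearMap) LinearMap.id
  have hΦ : ∀ y, Φ (TensorProduct.map Δ.toLinearMap LinearMap.id (Δ y)) = 1 ⊗ₜ y := by
    intro y
    have h1 : ∀ m, LinearMap.mul' ℂ G (TensorProduct.map (St ∘ₗ ι.toLinearMap) ι.toLinearMap
        (Δ m)) = algebraMap ℂ G (εG (ι m)) := by
      intro m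
      have h2 := LinearMap.congr_fun hG.antipode_left (ι m)
      simp only [LinearMap.comp_apply, AlgHom.toLinearMap_apply, hG.comul_algebraMap,
        Algebra.linearMap_apply] at h2
      rw [← h2]
      congr 1
      generalize Δ m = Y
      induction Y with
      | zero => simp
      | add u v hu hv => simp only [map_add, hu, hv]
      | tmul a b => simp
    have h3 : ∀ Y : M ⊗[ℂ] M, Φ (TensorProduct.map Δ.toLinearMap LinearMap.id Y) =
        TensorProduct.map (Algebra.linearMap ℂ G) LinearMap.id
          (TensorProduct.map (εG.comp ι).toLinearMap LinearMap.id Y) := by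
      intro Y
      induction Y with
      | zero => simp
      | add u v hu hv => simp only [map_add, hu, hv]
      | tmul a b => simp [Φ, h1]
    rw [h3, hG.counit_tmul]
    simp
  let Θ : M ⊗[ℂ] G →ₗ[ℂ] G ⊗[ℂ] M := TensorProduct.lift (LinearMap.flip
    ((LinearMap.mul ℂ (G ⊗[ℂ] M) ∘ₗ (TensorProduct.mk ℂ G M).flip 1).compl₂
      ((Algebra.TensorProduct.map ι (.id ℂ M)).comp Δ).toLinearMap))
  have hΘ : ∀ m g, Θ (m ⊗ₜ g) = (g ⊗ₜ 1) * Algebra.TensorProduct.map ι (.id ℂ M) (Δ m) :=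
    fun m g => rfl
  have hΘT : ∀ (c : M) (Y : M ⊗[ℂ] M), Θ (twist ι St (Y ⊗ₜ c)) =
      (ι c ⊗ₜ 1) * Φ ((TensorProduct.assoc ℂ M M M).symm
        (TensorProduct.map LinearMap.id Δ.toLinearMap Y)) := by
    intro c Y
    induction Y with
    | zero => simp
    | add u v hu hv => simp only [TensorProduct.add_tmul, map_add, hu, hv, mul_add]
    | tmul a b =>
      rw [twist_tmul, hΘ]
      simp only [TensorProduct.map_tmul, LinearMap.id_apply, AlgHom.toLinearMap_apply]
      generalize Δ b = Z
      induction Z with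
      | zero => simp
      | add u v hu hv => simp only [TensorProduct.tmul_add, map_add, hu, hv, mul_add]
      | tmul u v => simp [Φ, mul_assoc]
  have h4 : ∀ Y : M ⊗[ℂ] M, Θ (twist ι St (Algebra.TensorProduct.map Δ (.id ℂ M) Y)) =
      Algebra.TensorProduct.map ι (.id ℂ M) (TensorProduct.comm ℂ M M Y) := by
    intro Y
    induction Y with
    | zero => simp
    | add u v hu hv => simp only [map_add, hu, hv]
    | tmul y c =>
      rw [Algebra.TensorProduct.map_tmul, hΘT, ← hG.coassoc, LinearEquiv.symm_apply_apply, hΦ]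
      simp
  rw [← h4, ← adjAlpha_apply, hG.mem_coinvariants.mp hf, hΘ]
  exact (one_mul _).symm

theorem rowAct_eq_colAct {f : M} (hf : f ∈ hG.coinvariants) (u : G →ₗ[ℂ] ℂ) :
    rowAct Δ (u ∘ₗ ι.toLinearMap) f = colAct Δ (u ∘ₗ ι.toLinearMap) f := by
  have h := congrArg (fun Y => TensorProduct.lid ℂ M (TensorProduct.map u LinearMap.id Y))
    (hG.cocommutative hf)
  have h1 : ∀ Y : M ⊗[ℂ] M, TensorProduct.lid ℂ M (TensorProduct.map u LinearMap.id
      (Algebra.TensorProduct.map ι (.id ℂ M) Y)) =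
      TensorProduct.lid ℂ M (TensorProduct.map (u ∘ₗ ι.toLinearMap) LinearMap.id Y) := by
    intro Y
    induction Y with
    | zero => simp
    | add u v hu hv => simp only [map_add, hu, hv]
    | tmul a b => simp
  have h2 : ∀ Y : M ⊗[ℂ] M, TensorProduct.lid ℂ M (TensorProduct.map u LinearMap.id
      (Algebra.TensorProduct.map ι (.id ℂ M) (TensorProduct.comm ℂ M M Y))) =
      TensorProduct.rid ℂ M (TensorProduct.map LinearMap.id (u ∘ₗ ι.toLinearMap) Y) := by
    intro Y
    induction Y with
    | zero => simp
    | add u v hu hv => simp only [map_add, hu, hv]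
    | tmul a b => simp
  exact (h1 (Δ f)).symm.trans (h.trans (h2 (Δ f)))

theorem rowAct_diagHom_eq {f : M} (hf : f ∈ hG.coinvariants) (t : Fin N → ℂ) (ht : ∀ i, t i ≠ 0) :
    rowAct Δ (hG.diagHom t).toLinearMap f = colAct Δ (hG.diagHom t).toLinearMap f := by
  obtain ⟨ψ, hψ, -⟩ := hG.extend ℂ (hG.diagHom t) (by
    rw [qdet, map_qMinor]
    refine isUnit_qdet_triangular q (fun i j h => ?_) fun i => ?_
    · simp [hG.diagHom_gen, h.ne]
    · simpa [hG.diagHom_gen] using ht i)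
  rw [← hψ]
  exact hG.rowAct_eq_colAct hf ψ.toLinearMap

theorem rowLower_eq_lower (hq : q ≠ 0) {f : M} (hf : f ∈ hG.coinvariants) (s : AdjPair N) :
    hG.rowLower hq s f = hG.lower hq s f := by
  have hφ := (hG.exists_skew_lower hq s).choose_spec.1
  obtain ⟨ψ, hψ, -⟩ := hG.extend _ (hG.exists_skew_lower hq s).choose (by
    rw [qdet, map_qMinor]
    refine isUnit_qdet_triangular q (fun i j h => ?_) fun i => ?_
    · rw [hφ]
      have : ¬ (i = s.hi ∧ j = s.lo) := by
        rintro ⟨rfl, rfl⟩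
        have := s.lo_hi
        rw [Fin.lt_def] at h
        omega
      ext a b
      fin_cases a <;> fin_cases b <;> simp [skewMatrix, h.ne, this]
    · rw [hφ, Matrix.isUnit_iff_isUnit_det]
      simp [skewMatrix, Matrix.det_fin_two_of, zpow_ne_zero _ hq])
  rw [IsQuantumMatrixAlgebra.rowLower, IsQuantumMatrixAlgebra.lower,
    IsQuantumMatrixAlgebra.lowerFun, ← hψ]
  exact hG.rowAct_eq_colAct hf (Matrix.entryLinearMap ℂ ℂ 0 1 ∘ₗ ψ.toLinearMap)

/-- A coinvariant without dominant diagonal coefficients vanishes. -/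
theorem eq_zero_of_dominant (hq : q ≠ 0) (hg : IsGeneric q) {f : M} (hf : f ∈ hG.coinvariants)
    (hdom : ∀ w : Fin N → ℤ, Antitone w → hG.diagCoeff w f = 0) : f = 0 := by
  have : f ∈ hG.raiseLowerNull hq := fun J I w =>
    hG.diagCoeff_lowerList_raiseList_eq_zero hq (hG.rowLower_eq_lower hq hf) hg
      (hG.rowAct_diagHom_eq hf) hdom w I J
  rwa [hG.raiseLowerNull_eq_bot hq hg] at this

end IsQuantumGL

theorem List.exists_prod_map_finRange_adjacent {R : Type*} [Monoid R] {t : ℕ} (g : Fin t → R)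
    {r r' : Fin t} (hr : r.val + 1 = r'.val) :
    ∃ a b, ∀ f : Fin t → R, (∀ i, i ≠ r → i ≠ r' → f i = g i) →
      ((List.finRange t).map f).prod = a * (f r * f r') * b := by
  induction t with
  | zero => exact r.elim0
  | succ t ih =>
    cases r using Fin.cases with
    | zero =>
      cases t with
      | zero => exact absurd r'.isLt (by simp at hr)
      | succ t =>
        obtain rfl : r' = Fin.succ 0 := Fin.ext (by simpa using hr.symm)
        refine ⟨1, ((List.finRange t).map fun i => g i.succ.succ).prod, fun f hf => ?_⟩
        rw [List.finRange_succ, List.map_cons, List.prod_cons, List.map_map, List.finRange_succ,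
          List.map_cons, List.prod_cons, List.map_map, one_mul, mul_assoc]
        congr 4
        funext i
        exact hf _ (Fin.succ_ne_zero _) fun h => Fin.succ_ne_zero i (Fin.succ_injective _ h)
    | succ r =>
      cases r' using Fin.cases with
      | zero => simp at hr
      | succ r' =>
        obtain ⟨a, b, h⟩ := ih (fun i => g i.succ) (r := r) (r' := r') (by simpa using hr)
        refine ⟨g 0 * a, b, fun f hf => ?_⟩
        rw [List.finRange_succ, List.map_cons, List.prod_cons, List.map_map,
          hf 0 (Fin.succ_ne_zero _).symm (Fin.succ_ne_zero _).symm,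
          h (f ∘ Fin.succ) fun i h1 h2 => hf _ (by simpa using h1) (by simpa using h2)]
        simp [mul_assoc]

theorem List.prod_map_finRange_sum {R ι : Type*} [Ring R] [Fintype ι] {t : ℕ}
    (f : Fin t → ι → R) :
    ((List.finRange t).map fun r => ∑ m, f r m).prod =
      ∑ k : Fin t → ι, ((List.finRange t).map fun r => f r (k r)).prod := by
  induction t with
  | zero => simp
  | succ t ih =>
    rw [← (Fin.consEquiv fun _ => ι).sum_comp, Fintype.sum_prod_type]
    simp only [List.finRange_succ, List.map_cons, List.prod_cons, List.map_map,
      Function.comp_def, ih, Finset.sum_mul_sum, Fin.consEquiv_apply, Fin.cons_zero, Fin.cons_succ]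

theorem List.prod_map_tmul {R M M' ι : Type*} [CommRing R] [Ring M] [Algebra R M] [Ring M']
    [Algebra R M'] (l : List ι) (a : ι → M) (b : ι → M') :
    (l.map fun r => a r ⊗ₜ[R] b r).prod = (l.map a).prod ⊗ₜ[R] (l.map b).prod := by
  induction l with
  | nil => rfl
  | cons i l ih => simp [ih]

/-- The number of inversions of a tuple. -/
def invNum {t N : ℕ} (k : Fin t → Fin N) : ℕ :=
  (Finset.univ.filter fun p : Fin t × Fin t => p.1 < p.2 ∧ k p.2 < k p.1).card

theorem invNum_comp_swap {t N : ℕ} {k : Fin t → Fin N} {r r' : Fin t} (hr : r.val + 1 = r'.val)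
    (hk : k r < k r') : invNum (k ∘ Equiv.swap r r') = invNum k + 1 := by
  have hne : r ≠ r' := by rintro rfl; omega
  have hlt : r < r' := by rw [Fin.lt_def]; omega
  set s := Equiv.swap r r' with hs
  have key : (Finset.univ.filter fun p : Fin t × Fin t => p.1 < p.2 ∧ (k ∘ s) p.2 < (k ∘ s) p.1) =
      insert (r, r') ((Finset.univ.filter fun p : Fin t × Fin t =>
        p.1 < p.2 ∧ k p.2 < k p.1).map (s.prodCongr s).toEmbedding) := by
    ext ⟨a, b⟩
    rw [Finset.mem_insert, Finset.mem_map_equiv]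
    simp only [Finset.mem_filter, Finset.mem_univ, true_and, Function.comp_apply, Prod.mk.injEq,
      Equiv.prodCongr_symm, Equiv.prodCongr_apply, Prod.map, hs, Equiv.symm_swap]
    simp only [Equiv.swap_apply_def]
    split_ifs <;> grind
  rw [invNum, key, Finset.card_insert_of_notMem, Finset.card_map]
  · rfl
  · rw [Finset.mem_map_equiv]
    simp [hs, hlt.le]

theorem Fin.exists_adjacent_le_of_not_strictMono {t N : ℕ} {k : Fin t → Fin N}
    (hk : ¬ StrictMono k) : ∃ r r' : Fin t, r.val + 1 = r'.val ∧ k r' ≤ k r := by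
  cases t with
  | zero => exact absurd (fun a => a.elim0) hk
  | succ t =>
    rw [Fin.strictMono_iff_lt_succ] at hk
    push Not at hk
    obtain ⟨i, hi⟩ := hk
    exact ⟨_, _, by simp, hi⟩

/-- The quantum minor with rows `k` and columns `J`. -/
def minor {M : Type} [Ring M] [Algebra ℂ M] {N : ℕ} (q : ℂ) (x : Fin N → Fin N → M) {t : ℕ}
    (k J : Fin t → Fin N) : M :=
  ∑ σ : Equiv.Perm (Fin t),
    ((-q) ^ invCount σ) • ((List.finRange t).map fun r => x (k r) (J (σ r))).prod

theorem sum_perm_eq_sum_adjacent {M : Type} [AddCommMonoid M] {t : ℕ} {r r' : Fin t}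
    (hr : r.val + 1 = r'.val) (F : Equiv.Perm (Fin t) → M) :
    ∑ σ, F σ = ∑ σ : Equiv.Perm (Fin t) with σ r < σ r', (F σ + F (σ * Equiv.swap r r')) := by
  have hne : r ≠ r' := by rintro rfl; omega
  rw [← Finset.sum_filter_add_sum_filter_not Finset.univ
    (fun σ : Equiv.Perm (Fin t) => σ r < σ r'), Finset.sum_add_distrib]
  congr 1
  refine Finset.sum_nbij' (· * Equiv.swap r r') (· * Equiv.swap r r') ?_ ?_ ?_ ?_ ?_
  · intro σ h
    have h1 : σ r ≠ σ r' := σ.injective.ne hne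
    simp only [Finset.mem_filter, Finset.mem_univ, true_and, not_lt] at h
    simpa using lt_of_le_of_ne h h1.symm
  · intro σ h
    simp only [Finset.mem_filter, Finset.mem_univ, true_and] at h
    simpa using h.le
  · intro σ _; simp [mul_assoc]
  · intro σ _; simp [mul_assoc]
  · intro σ _; simp [mul_assoc]

namespace IsQuantumMatrix

variable {N : ℕ} {q : ℂ} {M : Type} [Ring M] [Algebra ℂ M] {x : Fin N → Fin N → M}
  (hx : IsQuantumMatrix q x) {t : ℕ} {k J : Fin t → Fin N}
include hx

theorem minor_eq_zero_of_adjacent (hJ : StrictMono J) {r r' : Fin t} (hr : r.val + 1 = r'.val)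
    (hk : k r = k r') : minor q x k J = 0 := by
  have hne : r ≠ r' := by rintro rfl; omega
  rw [minor, sum_perm_eq_sum_adjacent hr]
  refine Finset.sum_eq_zero fun σ hσ => ?_
  simp only [Finset.mem_filter, Finset.mem_univ, true_and] at hσ
  have h1 : invCount (σ * Equiv.swap r r') = invCount σ + 1 := invNum_comp_swap hr hσ
  obtain ⟨a, b, hab⟩ :=
    List.exists_prod_map_finRange_adjacent (fun i => x (k i) (J (σ i))) hr
  rw [hab _ fun i _ _ => rfl, hab _ fun i h h' => by
    simp [Equiv.swap_apply_of_ne_of_ne h h'], h1]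
  simp only [Equiv.Perm.mul_apply, Equiv.swap_apply_left, Equiv.swap_apply_right]
  rw [hk, hx.row _ _ _ (hJ hσ), pow_succ]
  simp only [mul_smul_comm, smul_mul_assoc, smul_smul, ← add_smul]
  ring_nf
  simp

theorem minor_comp_swap (hq : q ≠ 0) (hJ : StrictMono J) {r r' : Fin t} (hr : r.val + 1 = r'.val)
    (hk : k r < k r') : minor q x (k ∘ Equiv.swap r r') J = (-q) • minor q x k J := by
  have hne : r ≠ r' := by rintro rfl; omega
  rw [minor, sum_perm_eq_sum_adjacent hr, minor, sum_perm_eq_sum_adjacent hr, Finset.smul_sum]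
  refine Finset.sum_congr rfl fun σ hσ => ?_
  simp only [Finset.mem_filter, Finset.mem_univ, true_and] at hσ
  have h1 : invCount (σ * Equiv.swap r r') = invCount σ + 1 := invNum_comp_swap hr hσ
  obtain ⟨a, b, hab⟩ :=
    List.exists_prod_map_finRange_adjacent (fun i => x (k i) (J (σ i))) hr
  rw [hab _ fun i h h' => by simp [Equiv.swap_apply_of_ne_of_ne h h'],
    hab _ fun i h h' => by simp [Equiv.swap_apply_of_ne_of_ne h h'],
    hab _ fun i _ _ => rfl, hab _ fun i h h' => by
    simp [Equiv.swap_apply_of_ne_of_ne h h'], h1]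
  simp only [Equiv.Perm.mul_apply, Equiv.swap_apply_left, Equiv.swap_apply_right,
    Function.comp_apply]
  have h2 := hx.anti _ _ _ _ hk (hJ hσ)
  have h3 := sub_eq_iff_eq_add.mp (hx.diag _ _ _ _ hk (hJ hσ))
  rw [h3, ← h2, pow_succ]
  simp only [mul_smul_comm, smul_mul_assoc, mul_add, add_mul, smul_add, smul_smul]
  have h4 : (-q) ^ invCount σ =
      -q * (-q) ^ invCount σ * (q - q⁻¹) + -q * ((-q) ^ invCount σ * -q) := by
    field_simp
    ring
  rw [show ∀ A B : M, (-q) ^ invCount σ • A + ((-q) ^ invCount σ * -q) • B =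
    (-q * (-q) ^ invCount σ * (q - q⁻¹) + -q * ((-q) ^ invCount σ * -q)) • A +
      ((-q) ^ invCount σ * -q) • B from fun A B => by rw [← h4]]
  rw [add_smul, mul_comm ((-q) ^ invCount σ) (-q), mul_assoc]
  abel

theorem minor_eq_zero (hq : q ≠ 0) (hJ : StrictMono J) (hk : ¬ Function.Injective k) :
    minor q x k J = 0 := by
  induction h : invNum k using Nat.strong_induction_on generalizing k with
  | _ n ih =>
    obtain ⟨r, r', hr, hle⟩ := Fin.exists_adjacent_le_of_not_strictMono fun h => hk h.injective
    rcases hle.eq_or_lt with heq | hlt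
    · exact hx.minor_eq_zero_of_adjacent hJ hr heq.symm
    · have h1 : (k ∘ Equiv.swap r r') ∘ Equiv.swap r r' = k := by ext; simp
      have h2 : (k ∘ Equiv.swap r r') r < (k ∘ Equiv.swap r r') r' := by simpa using hlt
      have h3 := invNum_comp_swap hr h2
      have h4 := hx.minor_comp_swap hq hJ hr h2
      rw [h1] at h3 h4
      rw [h4, ih (invNum (k ∘ Equiv.swap r r')) (by omega) ?_ rfl, smul_zero]
      intro hinj
      exact hk (h1 ▸ hinj.comp (Equiv.swap r r').injective)

theorem minor_comp_perm (hq : q ≠ 0) (hJ : StrictMono J) (hk : StrictMono k)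
    (τ : Equiv.Perm (Fin t)) : minor q x (k ∘ τ) J = ((-q) ^ invCount τ) • minor q x k J := by
  induction h : invCount τ using Nat.strong_induction_on generalizing τ with
  | _ n ih =>
    by_cases hτ : StrictMono τ
    · obtain rfl : τ = 1 := Equiv.ext fun i => by
        rw [(hτ.range_inj strictMono_id).mp (by simp [τ.surjective.range_eq])]; rfl
      rw [← h, invCount_one]
      simp
    · obtain ⟨r, r', hr, hle⟩ := Fin.exists_adjacent_le_of_not_strictMono hτ
      have hne : r ≠ r' := by rintro rfl; omega
      have hlt := lt_of_le_of_ne hle (τ.injective.ne hne).symm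
      have h1 : τ * Equiv.swap r r' * Equiv.swap r r' = τ := by simp [mul_assoc]
      have h2 : (τ * Equiv.swap r r') r < (τ * Equiv.swap r r') r' := by simpa using hlt
      have h3 : invCount (τ * Equiv.swap r r' * Equiv.swap r r') =
        invCount (τ * Equiv.swap r r') + 1 := invNum_comp_swap hr h2
      have h4 := hx.minor_comp_swap (k := k ∘ ⇑(τ * Equiv.swap r r')) hq hJ hr (hk h2)
      rw [h1, h] at h3
      rw [Function.comp_assoc, ← Equiv.Perm.coe_mul, h1] at h4
      rw [h4, ih _ (by omega) _ rfl, h3, smul_smul, pow_succ, mul_comm]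

end IsQuantumMatrix

theorem strictMono_comp_perm_injective {t N : ℕ} : Function.Injective
    fun p : (Fin t ↪o Fin N) × Equiv.Perm (Fin t) => (p.1 ∘ p.2 : Fin t → Fin N) := by
  rintro ⟨K, σ⟩ ⟨L, τ⟩ h
  simp only at h
  have h1 : Set.range K = Set.range L := by
    rw [← σ.surjective.range_comp K, h, τ.surjective.range_comp]
  have h2 : K = L := OrderEmbedding.range_inj.mp h1
  subst h2
  refine Prod.ext rfl (Equiv.ext fun i => K.injective (congrFun h i))

theorem exists_strictMono_comp_perm {t N : ℕ} {k : Fin t → Fin N} (hk : Function.Injective k) :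
    ∃ p : (Fin t ↪o Fin N) × Equiv.Perm (Fin t), (p.1 ∘ p.2 : Fin t → Fin N) = k := by
  refine ⟨(OrderEmbedding.ofStrictMono _ ((Tuple.monotone_sort k).strictMono_of_injective
    (hk.comp (Tuple.sort k).injective)), (Tuple.sort k)⁻¹), ?_⟩
  ext i
  simp

namespace IsQuantumMatrixAlgebra

variable {N : ℕ} {q : ℂ} {M : Type} [Ring M] [Algebra ℂ M] {x : Fin N → Fin N → M}
  {Δ : M →ₐ[ℂ] M ⊗[ℂ] M} (hM : IsQuantumMatrixAlgebra q x Δ)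
include hM

theorem comul_minor (hq : q ≠ 0) {t : ℕ} (I J : Fin t ↪o Fin N) :
    Δ (minor q x I J) = ∑ K : Fin t ↪o Fin N, minor q x I K ⊗ₜ[ℂ] minor q x K J := by
  have h1 : Δ (minor q x I J) = ∑ k : Fin t → Fin N,
      ((List.finRange t).map fun r => x (I r) (k r)).prod ⊗ₜ[ℂ] minor q x k J := by
    simp only [minor, map_sum, map_smul, map_list_prod, List.map_map, Function.comp_def, hM.comul,
      List.prod_map_finRange_sum, List.prod_map_tmul, TensorProduct.tmul_sum,
      TensorProduct.tmul_smul, Finset.smul_sum]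
    exact Finset.sum_comm
  rw [h1, ← Fintype.sum_of_injective _ strictMono_comp_perm_injective
    (fun p : (Fin t ↪o Fin N) × Equiv.Perm (Fin t) =>
      ((List.finRange t).map fun r => x (I r) (p.1 (p.2 r))).prod ⊗ₜ[ℂ]
        minor q x (p.1 ∘ p.2) J) _ ?_ fun _ => rfl, Fintype.sum_prod_type]
  · refine Finset.sum_congr rfl fun K _ => ?_
    conv_rhs => rw [minor]
    rw [TensorProduct.sum_tmul]
    refine Finset.sum_congr rfl fun τ _ => ?_
    rw [hM.minor_comp_perm hq J.strictMono K.strictMono, TensorProduct.smul_tmul]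
  · intro k hk
    rw [hM.minor_eq_zero hq J.strictMono fun h => hk (exists_strictMono_comp_perm h),
      TensorProduct.tmul_zero]

end IsQuantumMatrixAlgebra

theorem qMinor_eq_minor {M : Type} [Ring M] [Algebra ℂ M] {N : ℕ} (q : ℂ) (x : Fin N → Fin N → M)
    {t : ℕ} {I : Finset (Fin N)} (h : I.card = t) :
    qMinor q x I = minor q x (I.orderEmbOfFin h) (I.orderEmbOfFin h) := by
  subst h
  rfl

theorem sigmaCoinv_eq_sum_minor {M : Type} [Ring M] [Algebra ℂ M] {N : ℕ} (q : ℂ)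
    (x : Fin N → Fin N → M) (t : ℕ) :
    sigmaCoinv q x t = ∑ K : Fin t ↪o Fin N, minor q x K K := by
  symm
  refine Finset.sum_bij (fun K _ => Finset.univ.map K.toEmbedding) (by simp) ?_ ?_ ?_
  · intro K _ L _ h
    have h1 : Set.range K = Set.range L := by
      simpa using congrArg (fun s : Finset (Fin N) => (s : Set (Fin N))) h
    exact OrderEmbedding.range_inj.mp h1
  · intro I hI
    have hI : I.card = t := by simpa using hI
    exact ⟨I.orderEmbOfFin hI, Finset.mem_univ _, Finset.coe_injective (by simp)⟩
  · intro K _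
    rw [qMinor_eq_minor q x (by simp : (Finset.univ.map K.toEmbedding).card = t)]
    have := Finset.orderEmbOfFin_unique' (by simp : (Finset.univ.map K.toEmbedding).card = t)
      (f := K) (by simp)
    rw [← this]

namespace IsQuantumGL

variable {N : ℕ} {q : ℂ} {M G : Type} [Ring M] [Algebra ℂ M] [Ring G] [Algebra ℂ G]
  {x : Fin N → Fin N → M} {Δ : M →ₐ[ℂ] M ⊗[ℂ] M} {ι : M →ₐ[ℂ] G} {ΔG : G →ₐ[ℂ] G ⊗[ℂ] G}
  {εG : G →ₐ[ℂ] ℂ} {St : G →ₗ[ℂ] G} (hG : IsQuantumGL q x Δ ι ΔG εG St)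
include hG

theorem counit_minor {t : ℕ} (K L : Fin t ↪o Fin N) :
    εG (ι (minor q x K L)) = if K = L then 1 else 0 := by
  have h1 : ∀ σ : Equiv.Perm (Fin t), ((List.finRange t).map fun r =>
      εG (ι (x (K r) (L (σ r))))).prod = if K = L ∧ σ = 1 then 1 else 0 := by
    intro σ
    simp only [hG.counit_gen]
    split_ifs with h
    · obtain ⟨rfl, rfl⟩ := h
      simp
    · have h2 : ∃ r, K r ≠ L (σ r) := by
        by_contra! h2
        have := @strictMono_comp_perm_injective t N (K, 1) (L, σ) (funext h2)
        simp only [Prod.mk.injEq] at this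
        exact h ⟨this.1, this.2.symm⟩
      obtain ⟨r, hr⟩ := h2
      exact List.prod_eq_zero (List.mem_map.mpr ⟨r, List.mem_finRange r, if_neg hr⟩)
  simp only [minor, map_sum, map_smul, map_list_prod, List.map_map, Function.comp_def, h1]
  by_cases h : K = L <;> simp [h, invCount_one]

theorem sum_minor_mul_antipode (hq : q ≠ 0) {t : ℕ} (K L : Fin t ↪o Fin N) :
    ∑ I : Fin t ↪o Fin N, ι (minor q x L I) * St (ι (minor q x I K)) = if L = K then 1 else 0 := by
  have h := LinearMap.congr_fun hG.antipode_right (ι (minor q x L K))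
  simp only [LinearMap.comp_apply, AlgHom.toLinearMap_apply, hG.comul_algebraMap,
    hG.comul_minor hq, hG.counit_minor, map_sum, Algebra.TensorProduct.map_tmul,
    TensorProduct.map_tmul, LinearMap.id_apply, LinearMap.mul'_apply, Algebra.linearMap_apply] at h
  rw [h]
  split_ifs <;> simp

/-- The sums of principal quantum minors are coinvariant. -/
theorem sigmaCoinv_mem_coinvariants (hq : q ≠ 0) (t : ℕ) :
    sigmaCoinv q x t ∈ hG.coinvariants := by
  rw [hG.mem_coinvariants, adjAlpha_apply, sigmaCoinv_eq_sum_minor]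
  simp only [map_sum, hG.comul_minor hq, Algebra.TensorProduct.map_tmul, TensorProduct.sum_tmul,
    twist_tmul, AlgHom.id_apply]
  calc _ = ∑ L : Fin t ↪o Fin N, ∑ K : Fin t ↪o Fin N, minor q x K L ⊗ₜ[ℂ]
      ∑ I : Fin t ↪o Fin N, ι (minor q x L I) * St (ι (minor q x I K)) := by
        rw [Finset.sum_comm]
        refine Finset.sum_congr rfl fun L _ => ?_
        rw [Finset.sum_comm]
        simp only [TensorProduct.tmul_sum]
    _ = _ := by simp [hG.sum_minor_mul_antipode hq, TensorProduct.tmul_ite]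

end IsQuantumGL

section Symmetric

variable {N : ℕ}

theorem MvPolynomial.exists_isSymmetric_coeff_antitone (p : MvPolynomial (Fin N) ℂ) :
    ∃ s : MvPolynomial (Fin N) ℂ, s.IsSymmetric ∧
      ∀ b : Fin N →₀ ℕ, Antitone b → s.coeff b = p.coeff b := by
  classical
  induction p using MvPolynomial.induction_on' with
  | add p r hp hr =>
    obtain ⟨s, hs, hsp⟩ := hp
    obtain ⟨s', hs', hsr⟩ := hr
    exact ⟨s + s', hs.add hs', fun b hb => by simp only [coeff_add, hsp b hb, hsr b hb]⟩
  | monomial a c =>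
    by_cases ha : Antitone a
    · let n : ℕ := (Finset.univ.filter fun σ : Equiv.Perm (Fin N) => a.mapDomain σ = a).card
      have hn : (n : ℂ) ≠ 0 := by
        rw [Nat.cast_ne_zero, ← Nat.pos_iff_ne_zero, Finset.card_pos]
        exact ⟨1, by simp⟩
      refine ⟨∑ σ : Equiv.Perm (Fin N), rename σ (monomial a (c / n)), fun τ => ?_,
        fun b hb => ?_⟩
      · rw [map_sum]
        refine Fintype.sum_equiv (Equiv.mulLeft τ) _ _ fun σ => ?_
        rw [rename_rename]
        rfl
      · simp only [rename_monomial, coeff_sum, coeff_monomial]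
        split_ifs with hab
        · subst hab
          rw [← Finset.sum_filter, Finset.sum_const, nsmul_eq_mul]
          exact mul_div_cancel₀ c hn
        · refine Finset.sum_eq_zero fun σ _ => if_neg fun h => hab ?_
          have h1 : (b : Fin N → ℕ) = a ∘ ⇑σ⁻¹ := by
            ext i
            rw [← h, Finsupp.mapDomain_equiv_apply]
            rfl
          refine DFunLike.coe_injective ?_
          rw [h1] at hb ⊢
          exact Tuple.unique_antitone (σ := 1) (by simpa using ha) hb
    · refine ⟨0, .zero, fun b hb => ?_⟩
      rw [coeff_monomial, if_neg, coeff_zero]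
      rintro rfl
      exact ha hb

end Symmetric

namespace IsQuantumMatrixAlgebra

variable {N : ℕ} {q : ℂ} {M : Type} [Ring M] [Algebra ℂ M] {x : Fin N → Fin N → M}
  {Δ : M →ₐ[ℂ] M ⊗[ℂ] M} (hM : IsQuantumMatrixAlgebra q x Δ)
include hM

theorem toDiag_sigmaCoinv (t : ℕ) :
    hM.toDiag (sigmaCoinv q x t) = MvPolynomial.esymm (Fin N) ℂ t := by
  rw [sigmaCoinv, map_sum, MvPolynomial.esymm, ← Finset.powerset_univ,
    Finset.powersetCard_eq_filter]
  refine Finset.sum_congr rfl fun I _ => ?_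
  rw [map_qMinor, qMinor_triangular q (fun i j h => by simp [hM.toDiag_gen, h.ne]),
    ← Fin.prod_univ_def]
  simp only [hM.toDiag_gen, if_true]
  exact ((I.orderIsoOfFin rfl).toEquiv.prod_comp fun i : I => MvPolynomial.X i.1).trans
    (Finset.prod_coe_sort I fun i => MvPolynomial.X i)

theorem exists_toDiag_eq_of_isSymmetric {s : MvPolynomial (Fin N) ℂ} (hs : s.IsSymmetric) :
    ∃ p ∈ Algebra.adjoin ℂ (Set.range fun i : Fin N => sigmaCoinv q x (i.1 + 1)),
      hM.toDiag p = s := by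
  obtain ⟨P, hP⟩ := MvPolynomial.esymmAlgHom_surjective ℂ (n := N) (σ := Fin N) (by simp) ⟨s, hs⟩
  have h1 : s ∈ (Algebra.adjoin ℂ
      (Set.range fun i : Fin N => sigmaCoinv q x (i.1 + 1))).map hM.toDiag := by
    rw [AlgHom.map_adjoin, ← Set.range_comp]
    simp only [Function.comp_def, hM.toDiag_sigmaCoinv]
    rw [Algebra.adjoin_range_eq_range_aeval]
    exact ⟨P, (MvPolynomial.esymmAlgHom_apply P).symm.trans (congrArg Subtype.val hP)⟩
  exact h1

end IsQuantumMatrixAlgebra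

namespace IsQuantumGL

variable {N : ℕ} {q : ℂ} {M G : Type} [Ring M] [Algebra ℂ M] [Ring G] [Algebra ℂ G]
  {x : Fin N → Fin N → M} {Δ : M →ₐ[ℂ] M ⊗[ℂ] M} {ι : M →ₐ[ℂ] G} {ΔG : G →ₐ[ℂ] G ⊗[ℂ] G}
  {εG : G →ₐ[ℂ] ℂ} {St : G →ₗ[ℂ] G} (hG : IsQuantumGL q x Δ ι ΔG εG St)
include hG

/-- For generic `q`, the coinvariants are generated by the sums of principal quantum minors. -/
theorem coinvariants_le_adjoin (hq : q ≠ 0) (hg : IsGeneric q) :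
    hG.coinvariants ≤ Algebra.adjoin ℂ (Set.range fun i : Fin N => sigmaCoinv q x (i.1 + 1)) := by
  intro f hf
  obtain ⟨s, hs, hsf⟩ := MvPolynomial.exists_isSymmetric_coeff_antitone (hG.toDiag f)
  obtain ⟨p, hp, rfl⟩ := hG.exists_toDiag_eq_of_isSymmetric hs
  have h1 : p ∈ hG.coinvariants := by
    refine Algebra.adjoin_le ?_ hp
    rintro _ ⟨i, rfl⟩
    exact hG.sigmaCoinv_mem_coinvariants hq _
  have h2 : f - p = 0 := by
    refine hG.eq_zero_of_dominant hq hg (sub_mem hf h1) fun w hw => ?_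
    rw [IsQuantumMatrixAlgebra.diagCoeff, LinearMap.comp_apply, AlgHom.toLinearMap_apply, map_sub]
    by_cases h : 0 ≤ w
    · obtain ⟨a, rfl⟩ := exists_natCast h
      rw [intCoeff_natCast, MvPolynomial.coeff_sub, hsf a fun i j hij => by
        simpa using hw hij, sub_self]
    · obtain ⟨i, hi⟩ : ∃ i, w i < 0 := by
        by_contra! h'
        exact h h'
      exact intCoeff_of_neg hi _
  rwa [sub_eq_zero.mp h2]

end IsQuantumGL

/-- The augmented elements of a generated subalgebra lie in the left ideal spanned by
the augmented generators. -/
theorem mul_sub_mem_span_of_mem_adjoin {R M κ : Type*} [CommRing R] [Ring M] [Algebra R M]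
    (e : M →ₐ[R] R) (g : κ → M) {f : M} (hf : f ∈ Algebra.adjoin R (Set.range g)) (h : M) :
    h * (f - algebraMap R M (e f)) ∈
      Submodule.span R {y : M | ∃ (i : κ) (h : M), y = h * (g i - algebraMap R M (e (g i)))} := by
  induction hf using Algebra.adjoin_induction generalizing h with
  | mem f hf =>
    obtain ⟨i, rfl⟩ := hf
    exact Submodule.subset_span ⟨i, h, rfl⟩
  | algebraMap c => simp
  | add a b _ _ ha hb =>
    convert add_mem (ha h) (hb h) using 1
    rw [map_add, map_add]
    noncomm_ring
  | mul a b _ _ ha hb =>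
    convert add_mem (hb (h * a)) (Submodule.smul_mem _ (e b) (ha h)) using 1
    rw [map_mul, map_mul, Algebra.smul_def, mul_sub, mul_sub, mul_sub, mul_sub,
      ← mul_assoc (algebraMap R M (e b)) h, ← mul_assoc (algebraMap R M (e b)) h,
      Algebra.commutes (e b) h, mul_assoc h (algebraMap R M (e b)) a,
      Algebra.commutes (e b) a, mul_assoc h (algebraMap R M (e b)),
      Algebra.commutes (e b) (algebraMap R M (e a))]
    simp only [mul_assoc]
    abel

/-- The kernel of `α^ξ` contains the left ideal generated by the `α`-coinvariants
`f - f(ξ)`, which contains the left ideal generated by the `σ_i - σ_i(ξ)`;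
for `q` not a root of unity (or `q = 1`) the two left ideals agree. -/
theorem ker_coorbit_alpha_contains_coinvariants
    {N : ℕ} (q : ℂ) (hq : q ≠ 0)
    (M G : Type) [Ring M] [Algebra ℂ M] [Ring G] [Algebra ℂ G]
    (x : Fin N → Fin N → M)
    (hrow : ∀ i j l : Fin N, j < l → x i j * x i l = (q) • (x i l * x i j))
    (hcol : ∀ i k j : Fin N, i < k → x i j * x k j = (q) • (x k j * x i j))
    (hanti : ∀ i k j l : Fin N, i < k → j < l → x i l * x k j = x k j * x i l)
    (hdiag : ∀ i k j l : Fin N, i < k → j < l →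
      x i j * x k l - x k l * x i j = ((q) - (q⁻¹)) • (x i l * x k j))
    (hgen : Algebra.adjoin ℂ (Set.range fun p : Fin N × Fin N => x p.1 p.2) = ⊤)
    (hfree : ∀ (B : Type) [Ring B] [Algebra ℂ B] (y : Fin N → Fin N → B),
      (∀ i j l : Fin N, j < l → y i j * y i l = (q) • (y i l * y i j)) →
      (∀ i k j : Fin N, i < k → y i j * y k j = (q) • (y k j * y i j)) →
      (∀ i k j l : Fin N, i < k → j < l → y i l * y k j = y k j * y i l) →
      (∀ i k j l : Fin N, i < k → j < l →
        y i j * y k l - y k l * y i j = ((q) - (q⁻¹)) • (y i l * y k j)) →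
      ∃! φ : M →ₐ[ℂ] B, ∀ i j, φ (x i j) = y i j)
    (ι : M →ₐ[ℂ] G) (dInv : G)
    (hd1 : ι (qdet (q) x) * dInv = 1)
    (hd2 : dInv * ι (qdet (q) x) = 1)
    (hgenG : Algebra.adjoin ℂ
      (Set.range (fun p : Fin N × Fin N => ι (x p.1 p.2)) ∪ {dInv}) = ⊤)
    (hfreeG : ∀ (B : Type) [Ring B] [Algebra ℂ B] (φ : M →ₐ[ℂ] B) (u : B),
      φ (qdet (q) x) * u = 1 → u * φ (qdet (q) x) = 1 →
      ∃! ψ : G →ₐ[ℂ] B, ψ.comp ι = φ)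
    (ΔM : M →ₐ[ℂ] M ⊗[ℂ] M)
    (hΔM : ∀ i j, ΔM (x i j) = ∑ k, x i k ⊗ₜ[ℂ] x k j)
    (ΔG : G →ₐ[ℂ] G ⊗[ℂ] G)
    (hΔG : ∀ m, ΔG (ι m) = Algebra.TensorProduct.map ι ι (ΔM m))
    (εG : G →ₐ[ℂ] ℂ)
    (hεG : ∀ i j, εG (ι (x i j)) = if i = j then 1 else 0)
    (St : G →ₗ[ℂ] G)
    (hS1 : LinearMap.mul' ℂ G ∘ₗ TensorProduct.map St LinearMap.id ∘ₗ ΔG.toLinearMap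
      = Algebra.linearMap ℂ G ∘ₗ εG.toLinearMap)
    (hS2 : LinearMap.mul' ℂ G ∘ₗ TensorProduct.map LinearMap.id St ∘ₗ ΔG.toLinearMap
      = Algebra.linearMap ℂ G ∘ₗ εG.toLinearMap)
    (ξ : Matrix (Fin N) (Fin N) ℂ)
    (e : M →ₐ[ℂ] ℂ) (he : ∀ i j, e (x i j) = ξ i j) :
    Submodule.span ℂ {y : M | ∃ (i : Fin N) (h : M),
        y = h * (sigmaCoinv q x (i.1 + 1) - algebraMap ℂ M (e (sigmaCoinv q x (i.1 + 1))))}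
      ≤ Submodule.span ℂ {y : M | ∃ f h : M,
        adjAlpha ΔM ι St f = f ⊗ₜ[ℂ] (1 : G) ∧ y = h * (f - algebraMap ℂ M (e f))}
    ∧ Submodule.span ℂ {y : M | ∃ f h : M,
        adjAlpha ΔM ι St f = f ⊗ₜ[ℂ] (1 : G) ∧ y = h * (f - algebraMap ℂ M (e f))}
      ≤ LinearMap.ker (coorbit e (adjAlpha ΔM ι St))
    ∧ (((∀ n : ℕ, 0 < n → q ^ n ≠ 1) ∨ q = 1) →
      Submodule.span ℂ {y : M | ∃ (i : Fin N) (h : M),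
          y = h * (sigmaCoinv q x (i.1 + 1) - algebraMap ℂ M (e (sigmaCoinv q x (i.1 + 1))))}
        = Submodule.span ℂ {y : M | ∃ f h : M,
          adjAlpha ΔM ι St f = f ⊗ₜ[ℂ] (1 : G) ∧ y = h * (f - algebraMap ℂ M (e f))}) := by
  have hG : IsQuantumGL q x ΔM ι ΔG εG St :=
    { row := hrow
      col := hcol
      anti := hanti
      diag := hdiag
      gen := hgen
      lift := fun B _ _ y hy =>
        let ⟨φ, hφ, _⟩ := hfree B y hy.row hy.col hy.anti hy.diag
        ⟨φ, hφ⟩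
      comul := hΔM
      isUnit := ⟨⟨ι (qdet q x), dInv, hd1, hd2⟩, rfl⟩
      extend := fun B _ _ φ ⟨u, hu⟩ =>
        hfreeG B φ ↑u⁻¹ (by rw [← hu, u.mul_inv]) (by rw [← hu, u.inv_mul])
      comul_algebraMap := hΔG
      counit_gen := hεG
      antipode_left := hS1
      antipode_right := hS2 }
  have h1 : Submodule.span ℂ {y : M | ∃ (i : Fin N) (h : M),
      y = h * (sigmaCoinv q x (i.1 + 1) - algebraMap ℂ M (e (sigmaCoinv q x (i.1 + 1))))}
      ≤ Submodule.span ℂ {y : M | ∃ f h : M,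
        adjAlpha ΔM ι St f = f ⊗ₜ[ℂ] (1 : G) ∧ y = h * (f - algebraMap ℂ M (e f))} := by
    refine Submodule.span_mono ?_
    rintro _ ⟨i, h, rfl⟩
    exact ⟨_, h, hG.sigmaCoinv_mem_coinvariants hq _, rfl⟩
  refine ⟨h1, Submodule.span_le.mpr ?_, fun hg => le_antisymm h1 (Submodule.span_le.mpr ?_)⟩
  · rintro _ ⟨f, h, hf, rfl⟩
    exact hG.coorbit_mul hf e h
  · rintro _ ⟨f, h, hf, rfl⟩
    exact mul_sub_mem_span_of_mem_adjoin e _ (hG.coinvariants_le_adjoin hq hg hf) h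
end
end

section
/- Let q ∈ ℂ* and let ξ be a diagonal N×N complex matrix (hence a ℂ-point of M_q). Then the image of the co-orbit map β^ξ is contained in O(D\GL_q), the subalgebra of coinvariants of the left coaction λ_D of the diagonal quantum subgroup. Similarly, the image of α^ξ is contained in O(D\GL_q). -/
open TensorProduct

noncomputable section

open WithConv

section Convolution

variable {R C B B' : Type} [CommRing R] [Ring C] [Bialgebra R C] [Ring B] [Algebra R B]
  [Ring B'] [Algebra R B']

/-- Postcomposition of an element of the convolution algebra with a linear map. -/
def convPost (h : B →ₗ[R] B') (f : WithConv (C →ₗ[R] B)) : WithConv (C →ₗ[R] B') :=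
  toConv (h ∘ₗ f.ofConv)

theorem convPost_mul (h : B →ₐ[R] B') (f g : WithConv (C →ₗ[R] B)) :
    convPost h.toLinearMap (f * g) = convPost h.toLinearMap f * convPost h.toLinearMap g :=
  congrArg toConv (LinearMap.algHom_comp_convMul_distrib h f g)

theorem convPost_one (h : B →ₐ[R] B') :
    convPost h.toLinearMap (1 : WithConv (C →ₗ[R] B)) = 1 := by
  ext c
  simp [convPost]

/-- Linear maps with commuting values have the same convolution product in the opposite algebra. -/
theorem convPost_op_mul (f g : WithConv (C →ₗ[R] B)) (hfg : ∀ a b, Commute (f a) (g b)) :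
    convPost (MulOpposite.opLinearEquiv R).toLinearMap (f * g) =
      convPost (MulOpposite.opLinearEquiv R).toLinearMap f *
        convPost (MulOpposite.opLinearEquiv R).toLinearMap g := by
  have key : (MulOpposite.opLinearEquiv R).toLinearMap ∘ₗ LinearMap.mul' R B ∘ₗ
        TensorProduct.map f.ofConv g.ofConv =
      LinearMap.mul' R Bᵐᵒᵖ ∘ₗ TensorProduct.map
        ((MulOpposite.opLinearEquiv R).toLinearMap ∘ₗ f.ofConv)
        ((MulOpposite.opLinearEquiv R).toLinearMap ∘ₗ g.ofConv) := by
    ext a b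
    simpa using congrArg MulOpposite.op (hfg a b).eq
  ext c
  exact LinearMap.congr_fun key (CoalgebraStruct.comul c)

theorem convPost_op_one :
    convPost (MulOpposite.opLinearEquiv R).toLinearMap (1 : WithConv (C →ₗ[R] B)) = 1 := by
  ext c
  simp [convPost]

/-- The convolution monoid form of the cancellation `a'p'epa = a'ea`. -/
theorem mul_mul_cancel_of_commute {W : Type} [Monoid W] {p p' a a' e : W}
    (hp : p' * p = 1) (he : Commute e p) : a' * p' * e * (p * a) = a' * e * a := by
  calc a' * p' * e * (p * a) = a' * p' * (e * p) * a := by simp only [mul_assoc]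
    _ = a' * (p' * p) * e * a := by rw [he.eq]; simp only [mul_assoc]
    _ = a' * e * a := by rw [hp, mul_one]

end Convolution

section Coorbit

variable {R M G D : Type} [CommRing R] [Ring M] [Bialgebra R M] [Ring G] [Algebra R G]
  [CommRing D] [Algebra R D]

/-- A character, viewed in the convolution algebra with values in `B`. -/
def convChar (B : Type) [Ring B] [Algebra R B] (e : M →ₐ[R] R) : WithConv (M →ₗ[R] B) :=
  toConv (Algebra.linearMap R B ∘ₗ e.toLinearMap)

theorem convPost_convChar {B B' : Type} [Ring B] [Algebra R B] [Ring B'] [Algebra R B']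
    (h : B →ₐ[R] B') (e : M →ₐ[R] R) :
    convPost h.toLinearMap (convChar B e) = convChar B' e := by
  ext c
  simp [convPost, convChar]

theorem convPost_op_convChar {B : Type} [Ring B] [Algebra R B] (e : M →ₐ[R] R) :
    convPost (MulOpposite.opLinearEquiv R).toLinearMap (convChar B e) = convChar Bᵐᵒᵖ e := by
  ext c
  simp [convPost, convChar]

theorem coorbit_adjBeta_eq (e : M →ₐ[R] R) (ι : M →ₐ[R] G) (St : G →ₗ[R] G) :
    toConv (coorbit e (adjBeta (Bialgebra.comulAlgHom R M) ι St)) =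
      toConv (St ∘ₗ ι.toLinearMap) * convChar G e * toConv ι.toLinearMap := by
  have key : (TensorProduct.lid R G).toLinearMap ∘ₗ TensorProduct.map e.toLinearMap LinearMap.id ∘ₗ
      TensorProduct.map LinearMap.id (LinearMap.mul' R G) ∘ₗ
      (TensorProduct.assoc R M G G).toLinearMap ∘ₗ
      TensorProduct.map ((TensorProduct.comm R G M).toLinearMap ∘ₗ
        TensorProduct.map (St ∘ₗ ι.toLinearMap) LinearMap.id) ι.toLinearMap =
      LinearMap.mul' R G ∘ₗ TensorProduct.map (LinearMap.mul' R G ∘ₗ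
        TensorProduct.map (St ∘ₗ ι.toLinearMap) (Algebra.linearMap R G ∘ₗ e.toLinearMap))
        ι.toLinearMap := by
    ext a b c
    simp [Algebra.smul_def, ← Algebra.commutes, mul_assoc]
  ext m
  refine (LinearMap.congr_fun key (TensorProduct.map (CoalgebraStruct.comul (R := R) (A := M))
    LinearMap.id (CoalgebraStruct.comul m))).trans ?_
  simp [LinearMap.convMul_def, convChar, TensorProduct.map_map, LinearMap.comp_assoc]

theorem coorbit_adjAlpha_eq (e : M →ₐ[R] R) (ι : M →ₐ[R] G) (St : G →ₗ[R] G) :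
    convPost (MulOpposite.opLinearEquiv R).toLinearMap
        (toConv (coorbit e (adjAlpha (Bialgebra.comulAlgHom R M) ι St))) =
      convPost (MulOpposite.opLinearEquiv R).toLinearMap (toConv (St ∘ₗ ι.toLinearMap)) *
        convChar Gᵐᵒᵖ e *
        convPost (MulOpposite.opLinearEquiv R).toLinearMap (toConv ι.toLinearMap) := by
  have key : (MulOpposite.opLinearEquiv R).toLinearMap ∘ₗ (TensorProduct.lid R G).toLinearMap ∘ₗ
      TensorProduct.map e.toLinearMap LinearMap.id ∘ₗ
      TensorProduct.map LinearMap.id (LinearMap.mul' R G) ∘ₗ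
      TensorProduct.map LinearMap.id (TensorProduct.comm R G G).toLinearMap ∘ₗ
      (TensorProduct.assoc R M G G).toLinearMap ∘ₗ
      TensorProduct.map ((TensorProduct.comm R G M).toLinearMap ∘ₗ
        TensorProduct.map (St ∘ₗ ι.toLinearMap) LinearMap.id) ι.toLinearMap =
      LinearMap.mul' R Gᵐᵒᵖ ∘ₗ TensorProduct.map (LinearMap.mul' R Gᵐᵒᵖ ∘ₗ
        TensorProduct.map ((MulOpposite.opLinearEquiv R).toLinearMap ∘ₗ St ∘ₗ ι.toLinearMap)
          (Algebra.linearMap R Gᵐᵒᵖ ∘ₗ e.toLinearMap))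
        ((MulOpposite.opLinearEquiv R).toLinearMap ∘ₗ ι.toLinearMap) := by
    ext a b c
    simpa [Algebra.smul_def, ← MulOpposite.op_mul, mul_assoc] using
      (Algebra.left_comm (ι c) (e b) (St (ι a))).symm
  ext m
  refine (LinearMap.congr_fun key (TensorProduct.map (CoalgebraStruct.comul (R := R) (A := M))
    LinearMap.id (CoalgebraStruct.comul m))).trans ?_
  simp [LinearMap.convMul_def, convChar, convPost, TensorProduct.map_map, LinearMap.comp_assoc]

theorem coorbit_mem_dCoinv (e : M →ₐ[R] R) (ι : M →ₐ[R] G) (St : G →ₗ[R] G)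
    (πD : G →ₐ[R] D) (ΔG : G →ₐ[R] G ⊗[R] G)
    (hΔG : ∀ m, ΔG (ι m) = Algebra.TensorProduct.map ι ι (Bialgebra.comulAlgHom R M m))
    (hS1 : toConv (St ∘ₗ ι.toLinearMap) * toConv ι.toLinearMap = 1)
    (hS2 : toConv ι.toLinearMap * toConv (St ∘ₗ ι.toLinearMap) = 1)
    (he : Commute (convChar D e) (convPost πD.toLinearMap (toConv ι.toLinearMap))) (m : M) :
    coorbit e (adjBeta (Bialgebra.comulAlgHom R M) ι St) m ∈ dCoinv πD ΔG ∧
      coorbit e (adjAlpha (Bialgebra.comulAlgHom R M) ι St) m ∈ dCoinv πD ΔG := by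
  let L : G →ₐ[R] D ⊗[R] G := (Algebra.TensorProduct.map πD (AlgHom.id R G)).comp ΔG
  let i₁ : D →ₐ[R] D ⊗[R] G := Algebra.TensorProduct.includeLeft
  let i₂ : G →ₐ[R] D ⊗[R] G := Algebra.TensorProduct.includeRight
  let o := (MulOpposite.opLinearEquiv R : D ⊗[R] G ≃ₗ[R] (D ⊗[R] G)ᵐᵒᵖ).toLinearMap
  let j : WithConv (M →ₗ[R] G) := toConv ι.toLinearMap
  let j' : WithConv (M →ₗ[R] G) := toConv (St ∘ₗ ι.toLinearMap)
  let a := convPost i₂.toLinearMap j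
  let a' := convPost i₂.toLinearMap j'
  let p := convPost i₁.toLinearMap (convPost πD.toLinearMap j)
  let p' := convPost i₁.toLinearMap (convPost πD.toLinearMap j')
  have comm₁₂ (u : D) (v : G) : Commute (i₁ u) (i₂ v) := by
    simp [i₁, i₂, Commute, SemiconjBy]
  have comm₁₁ (u v : D) : Commute (i₁ u) (i₁ v) := by
    simp [i₁, Commute, SemiconjBy, mul_comm]
  have haa : a * a' = 1 := by rw [← convPost_mul, hS2, convPost_one]
  have hpp : p * p' = 1 := by
    rw [← convPost_mul, ← convPost_mul, hS2, convPost_one, convPost_one]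
  have hpp' : p' * p = 1 := by
    rw [← convPost_mul, ← convPost_mul, hS1, convPost_one, convPost_one]
  have hep : Commute (convChar (D ⊗[R] G) e) p := by
    rw [← convPost_convChar i₁]
    exact (convPost_mul _ _ _).symm.trans
      ((congrArg (convPost i₁.toLinearMap) he.eq).trans (convPost_mul _ _ _))
  have hj : convPost L.toLinearMap j = p * a := by
    have key : (Algebra.TensorProduct.map πD (AlgHom.id R G)).toLinearMap ∘ₗ
        (Algebra.TensorProduct.map ι ι).toLinearMap =
        LinearMap.mul' R (D ⊗[R] G) ∘ₗ TensorProduct.map p.ofConv a.ofConv := by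
      ext x y
      simp [p, a, i₁, i₂, j, convPost]
    ext x
    exact (congrArg (Algebra.TensorProduct.map πD (AlgHom.id R G)) (hΔG x)).trans
      (LinearMap.congr_fun key (CoalgebraStruct.comul x))
  have hj' : convPost L.toLinearMap j' = a' * p' := by
    refine left_inv_eq_right_inv (a := convPost L.toLinearMap j) ?_ ?_
    · rw [← convPost_mul, hS1, convPost_one]
    · rw [hj, mul_assoc, ← mul_assoc a, haa, one_mul, hpp]
  have hβ : convPost L.toLinearMap
        (toConv (coorbit e (adjBeta (Bialgebra.comulAlgHom R M) ι St))) =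
      convPost i₂.toLinearMap
        (toConv (coorbit e (adjBeta (Bialgebra.comulAlgHom R M) ι St))) := by
    rw [coorbit_adjBeta_eq]
    simp only [convPost_mul, convPost_convChar]
    exact (congrArg₂ (fun u v => u * convChar (D ⊗[R] G) e * v) hj' hj).trans
      (mul_mul_cancel_of_commute hpp' hep)
  have hop : convPost o (convPost L.toLinearMap j') * convChar (D ⊗[R] G)ᵐᵒᵖ e *
        convPost o (convPost L.toLinearMap j) =
      convPost o a' * convChar (D ⊗[R] G)ᵐᵒᵖ e * convPost o a := by
    rw [hj, hj', convPost_op_mul _ _ fun u v => (comm₁₂ _ _).symm,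
      convPost_op_mul _ _ fun u v => comm₁₂ _ _]
    refine mul_mul_cancel_of_commute ?_ ?_
    · rw [← convPost_op_mul _ _ fun u v => comm₁₁ _ _, hpp', convPost_op_one]
    · rw [← convPost_op_convChar, Commute, SemiconjBy,
        ← convPost_op_mul (convChar _ e) p fun u v => Algebra.commute_algebraMap_left (e u) _, hep.eq,
        convPost_op_mul p (convChar _ e) fun u v => Algebra.commute_algebraMap_right (e v) _]
  have op_nat (h : G →ₐ[R] D ⊗[R] G) (f : WithConv (M →ₗ[R] G)) :
      convPost o (convPost h.toLinearMap f) = convPost (AlgHom.op h).toLinearMap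
        (convPost (MulOpposite.opLinearEquiv R).toLinearMap f) := rfl
  have hα : convPost o (convPost L.toLinearMap
        (toConv (coorbit e (adjAlpha (Bialgebra.comulAlgHom R M) ι St)))) =
      convPost o (convPost i₂.toLinearMap
        (toConv (coorbit e (adjAlpha (Bialgebra.comulAlgHom R M) ι St)))) := by
    rw [op_nat, op_nat, coorbit_adjAlpha_eq]
    simp only [convPost_mul, convPost_convChar, ← op_nat]
    exact hop
  exact ⟨LinearMap.congr_fun (congrArg ofConv hβ) m,
    MulOpposite.op_injective (LinearMap.congr_fun (congrArg ofConv hα) m)⟩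

end Coorbit

/-- For a diagonal `ℂ`-point `ξ`, the images of `β^ξ` and `α^ξ` are contained in
the quantum quotient space `O(D\GL_q)`. -/
theorem image_coorbit_diagonal_in_quotient_space
    {N : ℕ} (q : ℂ) (hq : q ≠ 0)
    (M G : Type) [Ring M] [Algebra ℂ M] [Ring G] [Algebra ℂ G]
    (x : Fin N → Fin N → M)
    (hrow : ∀ i j l : Fin N, j < l → x i j * x i l = (q) • (x i l * x i j))
    (hcol : ∀ i k j : Fin N, i < k → x i j * x k j = (q) • (x k j * x i j))
    (hanti : ∀ i k j l : Fin N, i < k → j < l → x i l * x k j = x k j * x i l)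
    (hdiag : ∀ i k j l : Fin N, i < k → j < l →
      x i j * x k l - x k l * x i j = ((q) - (q⁻¹)) • (x i l * x k j))
    (hgen : Algebra.adjoin ℂ (Set.range fun p : Fin N × Fin N => x p.1 p.2) = ⊤)
    (hfree : ∀ (B : Type) [Ring B] [Algebra ℂ B] (y : Fin N → Fin N → B),
      (∀ i j l : Fin N, j < l → y i j * y i l = (q) • (y i l * y i j)) →
      (∀ i k j : Fin N, i < k → y i j * y k j = (q) • (y k j * y i j)) →
      (∀ i k j l : Fin N, i < k → j < l → y i l * y k j = y k j * y i l) →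
      (∀ i k j l : Fin N, i < k → j < l →
        y i j * y k l - y k l * y i j = ((q) - (q⁻¹)) • (y i l * y k j)) →
      ∃! φ : M →ₐ[ℂ] B, ∀ i j, φ (x i j) = y i j)
    (ι : M →ₐ[ℂ] G) (dInv : G)
    (hd1 : ι (qdet (q) x) * dInv = 1)
    (hd2 : dInv * ι (qdet (q) x) = 1)
    (hgenG : Algebra.adjoin ℂ
      (Set.range (fun p : Fin N × Fin N => ι (x p.1 p.2)) ∪ {dInv}) = ⊤)
    (hfreeG : ∀ (B : Type) [Ring B] [Algebra ℂ B] (φ : M →ₐ[ℂ] B) (u : B),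
      φ (qdet (q) x) * u = 1 → u * φ (qdet (q) x) = 1 →
      ∃! ψ : G →ₐ[ℂ] B, ψ.comp ι = φ)
    (ΔM : M →ₐ[ℂ] M ⊗[ℂ] M)
    (hΔM : ∀ i j, ΔM (x i j) = ∑ k, x i k ⊗ₜ[ℂ] x k j)
    (ΔG : G →ₐ[ℂ] G ⊗[ℂ] G)
    (hΔG : ∀ m, ΔG (ι m) = Algebra.TensorProduct.map ι ι (ΔM m))
    (εG : G →ₐ[ℂ] ℂ)
    (hεG : ∀ i j, εG (ι (x i j)) = if i = j then 1 else 0)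
    (St : G →ₗ[ℂ] G)
    (hS1 : LinearMap.mul' ℂ G ∘ₗ TensorProduct.map St LinearMap.id ∘ₗ ΔG.toLinearMap
      = Algebra.linearMap ℂ G ∘ₗ εG.toLinearMap)
    (hS2 : LinearMap.mul' ℂ G ∘ₗ TensorProduct.map LinearMap.id St ∘ₗ ΔG.toLinearMap
      = Algebra.linearMap ℂ G ∘ₗ εG.toLinearMap)
    (D : Type) [CommRing D] [Algebra ℂ D]
    (t : Fin N → (D)ˣ)
    (πD : G →ₐ[ℂ] D)
    (hπD : ∀ i j, πD (ι (x i j)) = if i = j then (t i : D) else 0)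
    (hfreeD : ∀ (B : Type) [CommRing B] [Algebra ℂ B] (u : Fin N → Bˣ),
      ∃! φ : D →ₐ[ℂ] B, ∀ i, φ (t i : D) = (u i : B))
    (ξ : Matrix (Fin N) (Fin N) ℂ)
    (e : M →ₐ[ℂ] ℂ) (he : ∀ i j, e (x i j) = ξ i j)
    (hξdiag : ∀ i j, i ≠ j → ξ i j = 0) :
    (∀ m : M, coorbit e (adjBeta ΔM ι St) m ∈ dCoinv πD ΔG)
    ∧ (∀ m : M, coorbit e (adjAlpha ΔM ι St) m ∈ dCoinv πD ΔG) := by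
  have alg_ext {B : Type} [Ring B] [Algebra ℂ B] {f g : M →ₐ[ℂ] B}
      (h : ∀ i j, f (x i j) = g (x i j)) : f = g := by
    refine AlgHom.ext_of_adjoin_eq_top hgen ?_
    rintro _ ⟨⟨i, j⟩, rfl⟩
    exact h i j
  let _ : Bialgebra ℂ M := Bialgebra.ofAlgHom ΔM (εG.comp ι)
    (alg_ext fun i j => by
      simp [hΔM, TensorProduct.sum_tmul, TensorProduct.tmul_sum]
      exact Finset.sum_comm)
    (alg_ext fun i j => by simp [hΔM, hεG, ite_tmul])
    (alg_ext fun i j => by simp [hΔM, hεG, tmul_ite])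
  have hS1' : toConv (St ∘ₗ ι.toLinearMap) * toConv ι.toLinearMap = 1 := by
    ext m
    have h := LinearMap.congr_fun hS1 (ι m)
    simp only [LinearMap.comp_apply, AlgHom.toLinearMap_apply, hΔG] at h
    refine Eq.trans ?_ h
    refine congrArg (LinearMap.mul' ℂ G) ?_
    refine Eq.trans ?_ (TensorProduct.map_map _ _ _ _ _).symm
    rfl
  have hS2' : toConv ι.toLinearMap * toConv (St ∘ₗ ι.toLinearMap) = 1 := by
    ext m
    have h := LinearMap.congr_fun hS2 (ι m)
    simp only [LinearMap.comp_apply, AlgHom.toLinearMap_apply, hΔG] at h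
    refine Eq.trans ?_ h
    refine congrArg (LinearMap.mul' ℂ G) ?_
    refine Eq.trans ?_ (TensorProduct.map_map _ _ _ _ _).symm
    rfl
  have he' : Commute (convChar D e) (convPost πD.toLinearMap (toConv ι.toLinearMap)) := by
    have h : ((Algebra.TensorProduct.lmul' ℂ (S := D)).comp
          (Algebra.TensorProduct.map ((Algebra.ofId ℂ D).comp e) (πD.comp ι))).comp ΔM =
        ((Algebra.TensorProduct.lmul' ℂ (S := D)).comp
          (Algebra.TensorProduct.map (πD.comp ι) ((Algebra.ofId ℂ D).comp e))).comp ΔM := by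
      refine alg_ext fun i j => ?_
      simp only [AlgHom.comp_apply, hΔM, map_sum, Algebra.TensorProduct.map_tmul, he, hπD,
        Algebra.TensorProduct.lmul'_apply_tmul]
      rcases eq_or_ne i j with rfl | hij
      · refine Finset.sum_congr rfl fun k _ => ?_
        rcases eq_or_ne i k with rfl | hik
        · simp [mul_comm]
        · simp [hik, hik.symm]
      · rw [Finset.sum_eq_zero, Finset.sum_eq_zero] <;> intro k _
        · rcases eq_or_ne i k with rfl | hik
          · simp [hξdiag _ _ hij]
          · simp [hik]
        · rcases eq_or_ne i k with rfl | hik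
          · simp [hij]
          · simp [hξdiag _ _ hik]
    ext m
    exact AlgHom.congr_fun h m
  exact ⟨fun m => (coorbit_mem_dCoinv e ι St πD ΔG hΔG hS1' hS2' he' m).1,
    fun m => (coorbit_mem_dCoinv e ι St πD ΔG hΔG hS1' hS2' he' m).2⟩
end
end
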